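/- arXiv:2203.00518 — 2 statements merged into one kernel-verified Lean document; each statement's English description precedes it below -/
import Mathlib

section
/- Let H be a separable real Hilbert space, let n ≥ 1 be an integer, let p ≥ 2 be a real number, and let ε_1,…,ε_n be i.i.d. centered H-valued random variables with σ² = E‖ε_1‖² > 0 and τ_p = E‖ε_1‖^p < ∞. Equip H^n with the inner product ⟨x, y⟩^{⊗n} = Σ_{i=1}^n ⟨x_i, y_i⟩ and associated norm ‖·‖^{⊗n}, and set ε̄ = (ε_1,…,ε_n) ∈ H^n. Let m ≥ 1 be an integer, let L be a linear subspace of H^n with dim(L) ≤ m, and let ζ(s) = ‖Π_L^{⊗n}(s)‖^{⊗n}, where Π_L^{⊗n} is the orthogonal projection onto L. Then there exists a constant C depending only on p such that for all x > 0: P( ζ²(ε̄) ≥ m σ² + 2 σ² √(m x) + σ² x ) ≤ C m τ_p σ^{−p} x^{−p/2}. -/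
open MeasureTheory ProbabilityTheory RealInnerProductSpace

universe u v


lemma pnb_add4_pow (a b c d : ℝ) (ha : 0 ≤ a) (hb : 0 ≤ b) (hc : 0 ≤ c) (hd : 0 ≤ d) (n : ℕ) :
    (a + b + c + d) ^ n ≤ 4 ^ n * (a ^ n + b ^ n + c ^ n + d ^ n) := by
  have h1 : ∃ e ∈ ({a, b, c, d} : Set ℝ), a + b + c + d ≤ 4 * e := by
    by_contra! h
    have := h a (by simp)
    have := h b (by simp)
    have := h c (by simp)
    have := h d (by simp)
    linarith
  obtain ⟨e, he, hle⟩ := h1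
  have : (a + b + c + d) ^ n ≤ (4 * e) ^ n := pow_le_pow_left₀ (by positivity) hle n
  rw [mul_pow] at this
  refine this.trans ?_
  have := pow_nonneg ha n
  have := pow_nonneg hb n
  have := pow_nonneg hc n
  have := pow_nonneg hd n
  gcongr
  rcases he with rfl | rfl | rfl | rfl <;> linarith

lemma pnb_step1 (j : ℕ) (a b al be X Y : ℝ) (hab : b - a = 2 * be - 2 * al + Y - X) :
    (b ^ (2 * j + 1) - a ^ (2 * j + 1)) * (be + Y) ≤
      (2 * j + 1) * 9 * ((a ^ (2 * j) + b ^ (2 * j)) * (al ^ 2 + be ^ 2 + X ^ 2 + Y ^ 2)) := by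
  have h1 := abs_pow_sub_pow_le b a (2 * j + 1)
  have h2 : max |b| |a| ^ (2 * j) ≤ a ^ (2 * j) + b ^ (2 * j) := by
    have ha : 0 ≤ a ^ (2 * j) := by rw [pow_mul]; positivity
    have hb : 0 ≤ b ^ (2 * j) := by rw [pow_mul]; positivity
    rcases max_choice |b| |a| with h | h <;> rw [h, pow_mul, sq_abs, ← pow_mul] <;> linarith
  have h3 : |b - a| * |be + Y| ≤ 9 * (al ^ 2 + be ^ 2 + X ^ 2 + Y ^ 2) := by
    rw [← abs_mul, hab, abs_le]
    constructor <;> nlinarith [sq_nonneg (al + be), sq_nonneg (al - be), sq_nonneg (al + Y), sq_nonneg (al - Y), sq_nonneg (be - Y), sq_nonneg (be + Y), sq_nonneg (be + X), sq_nonneg (be - X), sq_nonneg (X + Y), sq_nonneg (X - Y)]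
  calc (b ^ (2 * j + 1) - a ^ (2 * j + 1)) * (be + Y)
      ≤ |b ^ (2 * j + 1) - a ^ (2 * j + 1)| * |be + Y| := by
        rw [← abs_mul]; exact le_abs_self _
    _ ≤ (|b - a| * ((2 * j + 1 : ℕ) : ℝ) * max |b| |a| ^ (2 * j)) * |be + Y| := by
        gcongr
        simpa using h1
    _ = ((2 * j + 1 : ℕ) : ℝ) * (max |b| |a| ^ (2 * j) * (|b - a| * |be + Y|)) := by ring
    _ ≤ ((2 * j + 1 : ℕ) : ℝ) * ((a ^ (2 * j) + b ^ (2 * j)) * (9 * (al ^ 2 + be ^ 2 + X ^ 2 + Y ^ 2))) := by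
        gcongr
        rw [pow_mul, pow_mul]; positivity
    _ = _ := by push_cast; ring

lemma pnb_step2 (j : ℕ) (a b al be X Y W : ℝ) (hab : b - a = 2 * be - 2 * al + Y - X)
    (hW0 : 0 ≤ W) (hW : W ≤ be ^ 2 + Y ^ 2) :
    b ^ (2 * j) * W ≤ 1024 ^ (j + 1) * (a ^ (2 * j) * W +
      (al ^ (2 * j + 2) + be ^ (2 * j + 2) + X ^ (2 * j + 2) + Y ^ (2 * j + 2))) := by
  set N := al ^ 2 + be ^ 2 + X ^ 2 + Y ^ 2 with hN
  have hNn : 0 ≤ N := by positivity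
  have h1 : (b - a) ^ 2 ≤ 16 * N := by
    rw [hab]
    nlinarith [sq_nonneg (al + be), sq_nonneg (al - be), sq_nonneg (al + Y), sq_nonneg (al - Y), sq_nonneg (be - Y), sq_nonneg (be + Y), sq_nonneg (be + X), sq_nonneg (be - X), sq_nonneg (X + Y), sq_nonneg (X - Y), sq_nonneg (al - X), sq_nonneg (al + X)]
  have h2 : b ^ 2 ≤ 2 * a ^ 2 + 32 * N := by nlinarith [sq_nonneg (b - 2 * a)]
  have h3 : b ^ (2 * j) ≤ 4 ^ j * ((2 * a ^ 2) ^ j + (32 * N) ^ j + 0 ^ j + 0 ^ j) := by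
    rw [pow_mul]
    refine (pow_le_pow_left₀ (by positivity) h2 j).trans ?_
    have := pnb_add4_pow (2 * a ^ 2) (32 * N) 0 0 (by positivity) (by positivity) le_rfl le_rfl j
    simpa using this
  have h3' : b ^ (2 * j) ≤ 256 ^ j * (a ^ (2 * j) + N ^ j) := by
    have h2a : (2 * a ^ 2) ^ j + (32 * N) ^ j ≤ 32 ^ j * (a ^ (2 * j) + N ^ j) := by
      rw [mul_pow, mul_pow, mul_add, ← pow_mul]
      have : (0 : ℝ) ≤ a ^ (2 * j) := by rw [pow_mul]; positivity
      gcongr; norm_num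
    rcases Nat.eq_zero_or_pos j with rfl | hj
    · simp
    · rw [zero_pow hj.ne', add_zero, add_zero] at h3
      calc b ^ (2 * j) ≤ 4 ^ j * (32 ^ j * (a ^ (2 * j) + N ^ j)) := by
            refine h3.trans ?_; gcongr
        _ = 128 ^ j * (a ^ (2 * j) + N ^ j) := by rw [← mul_assoc, ← mul_pow]; norm_num
        _ ≤ _ := by
            have : (0 : ℝ) ≤ a ^ (2 * j) := by rw [pow_mul]; positivity
            gcongr; norm_num
  have h4 : N ^ j * W ≤ 4 ^ (j + 1) * (al ^ (2 * j + 2) + be ^ (2 * j + 2) + X ^ (2 * j + 2) + Y ^ (2 * j + 2)) := by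
    have := pnb_add4_pow (al ^ 2) (be ^ 2) (X ^ 2) (Y ^ 2) (by positivity) (by positivity) (by positivity) (by positivity) (j + 1)
    simp only [← pow_mul, mul_add, mul_one] at this ⊢
    refine le_trans ?_ this
    rw [pow_succ]
    gcongr
    nlinarith [sq_nonneg al, sq_nonneg X]
  have hp : ∀ u : ℝ, 0 ≤ u ^ (2 * j) := fun u => by rw [pow_mul]; positivity
  have hp2 : ∀ u : ℝ, 0 ≤ u ^ (2 * j + 2) := fun u => by
    rw [show 2 * j + 2 = 2 * (j + 1) by ring, pow_mul]; positivity
  have ha := hp a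
  have hM : 0 ≤ al ^ (2 * j + 2) + be ^ (2 * j + 2) + X ^ (2 * j + 2) + Y ^ (2 * j + 2) := by
    have := hp2 al; have := hp2 be; have := hp2 X; have := hp2 Y; positivity
  calc b ^ (2 * j) * W ≤ 256 ^ j * (a ^ (2 * j) + N ^ j) * W := by gcongr
    _ = 256 ^ j * (a ^ (2 * j) * W + N ^ j * W) := by ring
    _ ≤ 256 ^ j * (4 ^ (j + 1) * (a ^ (2 * j) * W) + 4 ^ (j + 1) * (al ^ (2 * j + 2) + be ^ (2 * j + 2) + X ^ (2 * j + 2) + Y ^ (2 * j + 2))) := by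
        refine mul_le_mul_of_nonneg_left (add_le_add ?_ h4) (by positivity)
        exact le_mul_of_one_le_left (by positivity) (one_le_pow₀ (by norm_num))
    _ = (256 ^ j * 4 ^ (j + 1)) * (a ^ (2 * j) * W + (al ^ (2 * j + 2) + be ^ (2 * j + 2) + X ^ (2 * j + 2) + Y ^ (2 * j + 2))) := by ring
    _ ≤ _ := by
        gcongr
        calc (256:ℝ) ^ j * 4 ^ (j + 1) ≤ 256 ^ (j + 1) * 4 ^ (j + 1) := by
              gcongr <;> norm_num
          _ = 1024 ^ (j + 1) := by rw [← mul_pow]; norm_num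

lemma pnb_step4 (j : ℕ) (be gam X Y : ℝ) (h : (be - gam) ^ 2 ≤ X * Y) :
    be ^ (2 * j + 2) ≤ 64 ^ (j + 1) * (gam ^ (2 * j + 2) + X ^ (2 * j + 2) + Y ^ (2 * j + 2)) := by
  have h2 : be ^ 2 ≤ 2 * (gam ^ 2 + X ^ 2 + Y ^ 2 + 0) := by
    nlinarith [sq_nonneg (be - 2 * gam), sq_nonneg (X - Y)]
  have := pnb_add4_pow (gam ^ 2) (X ^ 2) (Y ^ 2) 0 (by positivity) (by positivity) (by positivity) le_rfl (j + 1)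
  have h3 := pow_le_pow_left₀ (by positivity) h2 (j + 1)
  rw [mul_pow] at h3
  simp only [← pow_mul, mul_add, mul_one, zero_pow (Nat.succ_ne_zero j), add_zero] at this h3 ⊢
  have hp2 : ∀ u : ℝ, 0 ≤ u ^ (2 * j + 2) := fun u => by
    rw [show 2 * j + 2 = 2 * (j + 1) by ring, pow_mul]; positivity
  have h5 := hp2 gam
  have h6 := hp2 X
  have h7 := hp2 Y
  calc be ^ (2 * j + 2) ≤ 2 ^ (j + 1) * (gam ^ 2 + X ^ 2 + Y ^ 2) ^ (j + 1) := h3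
    _ ≤ 2 ^ (j + 1) * (4 ^ (j + 1) * gam ^ (2 * j + 2) + 4 ^ (j + 1) * X ^ (2 * j + 2) + 4 ^ (j + 1) * Y ^ (2 * j + 2)) := by gcongr
    _ = 8 ^ (j + 1) * (gam ^ (2 * j + 2) + X ^ (2 * j + 2) + Y ^ (2 * j + 2)) := by
        rw [show (8:ℝ) = 2 * 4 by norm_num, mul_pow]; ring
    _ ≤ 64 ^ (j + 1) * (gam ^ (2 * j + 2) + X ^ (2 * j + 2) + Y ^ (2 * j + 2)) := by
        gcongr; norm_num
    _ = _ := by ring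


lemma pnb_integrable_of_cont {X : Type*} [NormedAddCommGroup X] [ProperSpace X] [MeasurableSpace X]
    [BorelSpace X] (μ : Measure X) [IsFiniteMeasure μ] (R : ℝ) (hR : ∀ᵐ x ∂μ, ‖x‖ ≤ R)
    {F : X → ℝ} (hF : Continuous F) : Integrable F μ := by
  obtain ⟨C, hC⟩ := (isCompact_closedBall (0 : X) R).exists_bound_of_continuousOn hF.continuousOn
  refine Integrable.of_bound hF.aestronglyMeasurable C ?_
  filter_upwards [hR] with x hx
  exact hC x (by simpa using hx)

noncomputable def pnbC (j : ℕ) : ℝ :=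
  (2 * j + 1) * 9 * 1000 * (1 + 1024 ^ (j + 1)) ^ 2 * (1 + 64 ^ (j + 1))

lemma pnbC_pos (j : ℕ) : 0 < pnbC j := by unfold pnbC; positivity

lemma pnb_arith (c1 c2 c3 : ℝ) (hc1p : 0 < c1) (hc2p : 0 < c2) (hc3p : 0 < c3)
    (M T1 T2 T3 T4 Z1 Z2 Z3 : ℝ) (nT1 : 0 ≤ T1) (nT2 : 0 ≤ T2) (nT3 : 0 ≤ T3) (nT4 : 0 ≤ T4)
    (hMle : M ≤ c3 * (T3 + 2 * T4)) (hZ2le : Z2 ≤ c2 * (T2 + (2 * M + 2 * T4)))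
    (hZ3le : Z3 ≤ c2 * (Z1 + (2 * M + 2 * T4))) (hZ1le : Z1 ≤ 2 * T1 + Z2 + T2) :
    c1 * (2 * (Z1 + T2 + Z3 + Z2)) ≤
      c1 * 1000 * (1 + c2) ^ 2 * (1 + c3) * (T1 + T2 + T3 + T4) := by
  have q1 : 2 * M + 2 * T4 ≤ 6 * (1 + c3) * (T3 + T4) := by nlinarith [mul_nonneg hc3p.le nT3, mul_nonneg hc3p.le nT4]
  set W := T1 + T2 + T3 + T4 with hW
  have q2 : 2 * M + 2 * T4 ≤ 6 * (1 + c3) * W := q1.trans (by gcongr; linarith)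
  have nW : 0 ≤ W := by rw [hW]; positivity
  have hTW : T1 ≤ W ∧ T2 ≤ W := by constructor <;> linarith
  clear_value W
  have w0 : W ≤ (1 + c3) * W := by nlinarith
  have q2' : 2 * M + 2 * T4 ≤ 6 * ((1 + c3) * W) := by linarith
  have nK : 0 ≤ (1 + c3) * W := by positivity
  have hT1 : T1 ≤ (1 + c3) * W := hTW.1.trans w0
  have hT2 : T2 ≤ (1 + c3) * W := hTW.2.trans w0
  have hgoal : c1 * 1000 * (1 + c2) ^ 2 * (1 + c3) * W = c1 * (1000 * (1 + c2) ^ 2 * ((1 + c3) * W)) := by ring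
  rw [hgoal]
  generalize (1 + c3) * W = K at *
  have q3 : Z2 ≤ c2 * (7 * K) := hZ2le.trans (by gcongr; linarith)
  have n1 : 0 ≤ c2 * K := by positivity
  have n2 : 0 ≤ c2 ^ 2 * K := by positivity
  have q4 : Z1 ≤ 3 * K + 7 * (c2 * K) := by linarith
  have q5 : Z3 ≤ c2 * (3 * K + 7 * (c2 * K) + 6 * K) := hZ3le.trans (by gcongr)
  refine mul_le_mul_of_nonneg_left ?_ hc1p.le
  nlinarith

set_option linter.unusedSectionVars false

section
variable {E : Type*} [NormedAddCommGroup E] [InnerProductSpace ℝ E] [FiniteDimensional ℝ E]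
  [MeasurableSpace E] [BorelSpace E]

lemma pnb_triple_bdd (l ν : Measure E) [IsProbabilityMeasure l] [IsProbabilityMeasure ν]
    (R : ℝ) (hl : ∀ᵐ x ∂l, ‖x‖ ≤ R) (hν : ∀ᵐ x ∂ν, ‖x‖ ≤ R) :
    ∀ᵐ p ∂((l.prod ν).prod ν), ‖p‖ ≤ R := by
  have h1 : ∀ᵐ p ∂(l.prod ν), ‖p.1‖ ≤ R := Measure.quasiMeasurePreserving_fst.ae hl
  have h2 : ∀ᵐ p ∂(l.prod ν), ‖p.2‖ ≤ R := Measure.quasiMeasurePreserving_snd.ae hν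
  have h3 : ∀ᵐ p ∂((l.prod ν).prod ν), ‖p.1.1‖ ≤ R := Measure.quasiMeasurePreserving_fst.ae h1
  have h4 : ∀ᵐ p ∂((l.prod ν).prod ν), ‖p.1.2‖ ≤ R := Measure.quasiMeasurePreserving_fst.ae h2
  have h5 : ∀ᵐ p ∂((l.prod ν).prod ν), ‖p.2‖ ≤ R := Measure.quasiMeasurePreserving_snd.ae hν
  filter_upwards [h3, h4, h5] with p a b c
  simp [Prod.norm_def, a, b, c]

lemma pnb_swap (l ν : Measure E) [IsProbabilityMeasure l] [IsProbabilityMeasure ν]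
    {F : (E × E) × E → ℝ} (hF : Continuous F) :
    ∫ p, F p ∂((l.prod ν).prod ν) = ∫ p, F ((p.1.1, p.2), p.1.2) ∂((l.prod ν).prod ν) := by
  have hm : MeasurePreserving (fun p : (E × E) × E => ((p.1.1, p.2), p.1.2))
      ((l.prod ν).prod ν) ((l.prod ν).prod ν) := by
    have h1 := measurePreserving_prodAssoc l ν ν
    have h2 : MeasurePreserving (Prod.map id Prod.swap) (l.prod (ν.prod ν)) (l.prod (ν.prod ν)) :=
      (MeasurePreserving.id l).prod Measure.measurePreserving_swap
    have h3 := h1.symm.comp (h2.comp h1)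
    exact h3
  conv_lhs => rw [← hm.map_eq]
  rw [integral_map hm.measurable.aemeasurable hF.aestronglyMeasurable]

set_option maxHeartbeats 1000000 in
lemma pnb_triple (j : ℕ) : ∀ (l ν : Measure E) [IsProbabilityMeasure l]
    [IsProbabilityMeasure ν] (R : ℝ) (_ : ∀ᵐ x ∂l, ‖x‖ ≤ R) (_ : ∀ᵐ x ∂ν, ‖x‖ ≤ R)
    (_ : ∫ x, x ∂ν = 0) (α : ℝ),
    ∫ p, (‖p.1.1 + p.1.2‖ ^ 2 - α) ^ (2 * j + 1) * (⟪p.1.1 + p.1.2, p.1.2⟫) ∂((l.prod ν).prod ν)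
     - (∫ x, ‖x‖ ^ 2 ∂ν) * ∫ p, (‖p.1.1 + p.1.2‖ ^ 2 - α) ^ (2 * j + 1) ∂((l.prod ν).prod ν) ≤
    pnbC j * ∫ p, ((‖p.1.1 + p.1.2‖ ^ 2 - α) ^ (2 * j) * (⟪p.1.1 + p.1.2, p.2⟫ ^ 2 + ‖p.2‖ ^ 4) +
       (⟪p.1.1 + p.1.2, p.2⟫ ^ (2 * j + 2) + ‖p.2‖ ^ (4 * j + 4))) ∂((l.prod ν).prod ν) := by
  set c1 : ℝ := (2 * j + 1) * 9 with hc1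
  set c2 : ℝ := 1024 ^ (j + 1) with hc2
  set c3 : ℝ := 64 ^ (j + 1) with hc3
  have hc1p : 0 < c1 := by positivity
  have hc2p : 0 < c2 := by positivity
  have hc3p : 0 < c3 := by positivity
  intro l ν _ _ R hl hν hcent α
  have hb := pnb_triple_bdd l ν R hl hν
  have hIntg : ∀ {F : (E × E) × E → ℝ}, Continuous F → Integrable F ((l.prod ν).prod ν) :=
    fun hF => pnb_integrable_of_cont _ R hb hF
  have hsw : ∀ {F : (E × E) × E → ℝ}, Continuous F → 
      ∫ p, F p ∂((l.prod ν).prod ν) = ∫ p, F ((p.1.1, p.2), p.1.2) ∂((l.prod ν).prod ν) :=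
    fun hF => pnb_swap l ν hF
  have hfub : ∀ {F : (E × E) × E → ℝ}, Continuous F → 
      ∫ p, F p ∂((l.prod ν).prod ν) = ∫ q, ∫ y, F (q, y) ∂ν ∂(l.prod ν) :=
    fun hF => integral_prod _ (hIntg hF)
  set τ := (l.prod ν).prod ν with hτ
  set a : (E × E) × E → ℝ := fun p => ‖p.1.1 + p.1.2‖ ^ 2 - α with ha
  set b : (E × E) × E → ℝ := fun p => ‖p.1.1 + p.2‖ ^ 2 - α with hb'
  set al : (E × E) × E → ℝ := fun p => ⟪p.1.1, p.1.2⟫ with hal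
  set be : (E × E) × E → ℝ := fun p => ⟪p.1.1, p.2⟫ with hbe
  set X : (E × E) × E → ℝ := fun p => ‖p.1.2‖ ^ 2 with hX
  set Y : (E × E) × E → ℝ := fun p => ‖p.2‖ ^ 2 with hY
  set gam : (E × E) × E → ℝ := fun p => ⟪p.1.1 + p.1.2, p.2⟫ with hgam
  have ca : Continuous a := by fun_prop
  have cb : Continuous b := by fun_prop
  have cal : Continuous al := by fun_prop
  have cbe : Continuous be := by fun_prop
  have cX : Continuous X := by fun_prop
  have cY : Continuous Y := by fun_prop
  have cgam : Continuous gam := by fun_prop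
  have hab : ∀ p, b p - a p = 2 * be p - 2 * al p + Y p - X p := by
    intro p
    simp only [ha, hb', hbe, hal, hX, hY, norm_add_sq_real]; ring
  have hgb : ∀ p, (be p - gam p) ^ 2 ≤ X p * Y p := by
    intro p
    have : be p - gam p = - ⟪p.1.2, p.2⟫ := by simp [hbe, hgam, inner_add_left]
    rw [this, neg_sq, ← sq_abs, ← mul_pow]
    gcongr
    exact abs_real_inner_le_norm _ _
  have hY0 : ∀ p, 0 ≤ Y p := fun p => by positivity
  have hX0 : ∀ p, 0 ≤ X p := fun p => by positivity
  have heven : ∀ u : ℝ, 0 ≤ u ^ (2 * j) := fun u => by rw [pow_mul]; positivity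
  have heven2 : ∀ u : ℝ, 0 ≤ u ^ (2 * j + 2) := fun u => by
    rw [show 2 * j + 2 = 2 * (j + 1) by ring, pow_mul]; positivity
  -- the main identity
  have hid : ∫ p, a p ^ (2 * j + 1) * ⟪p.1.1 + p.1.2, p.1.2⟫ ∂τ =
      (∫ x, ‖x‖ ^ 2 ∂ν) * (∫ p, a p ^ (2 * j + 1) ∂τ) +
      ∫ p, (b p ^ (2 * j + 1) - a p ^ (2 * j + 1)) * (be p + Y p) ∂τ := by
    have e1 : ∫ p, a p ^ (2 * j + 1) * ⟪p.1.1 + p.1.2, p.1.2⟫ ∂τ = 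
        ∫ p, b p ^ (2 * j + 1) * (be p + Y p) ∂τ := by
      rw [hsw (by fun_prop)]
      refine integral_congr_ae (Filter.Eventually.of_forall fun p => ?_)
      simp [ha, hb', hbe, hY, inner_add_left]
    have e2 : ∫ p, a p ^ (2 * j + 1) * (be p + Y p) ∂τ =
        (∫ x, ‖x‖ ^ 2 ∂ν) * (∫ p, a p ^ (2 * j + 1) ∂τ) := by
      rw [hfub (by fun_prop), hfub (by fun_prop), ← integral_const_mul]
      refine integral_congr_ae (Filter.Eventually.of_forall fun q => ?_)
      have i1 : Integrable (fun y : E => (⟪q.1, y⟫ : ℝ)) ν :=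
        pnb_integrable_of_cont ν R hν (by fun_prop)
      have i2 : Integrable (fun y : E => ‖y‖ ^ 2) ν :=
        pnb_integrable_of_cont ν R hν (by fun_prop)
      have i3 : Integrable (fun y : E => y) ν := by
        refine Integrable.of_bound aestronglyMeasurable_id R hν
      simp only [ha, hbe, hY, integral_const, integral_const_mul]
      rw [integral_add i1 i2, integral_inner i3, hcent]
      simp; ring
    rw [e1, ← e2, ← integral_add (hIntg (by fun_prop)) (hIntg (by fun_prop))]
    refine integral_congr_ae (Filter.Eventually.of_forall fun p => ?_)
    simp only; ring
  have hA : ∫ p, a p ^ (2 * j) * X p ^ 2 ∂τ = ∫ p, b p ^ (2 * j) * Y p ^ 2 ∂τ := by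
    rw [hsw (by fun_prop)]
  have hA2 : ∫ p, a p ^ (2 * j) * (al p ^ 2 + X p ^ 2) ∂τ = ∫ p, b p ^ (2 * j) * (be p ^ 2 + Y p ^ 2) ∂τ := by
    rw [hsw (by fun_prop)]
  have hA3 : ∫ p, b p ^ (2 * j) * (al p ^ 2 + X p ^ 2) ∂τ = ∫ p, a p ^ (2 * j) * (be p ^ 2 + Y p ^ 2) ∂τ := by
    rw [hsw (by fun_prop)]
  have hA4 : ∫ p, al p ^ (2 * j + 2) ∂τ = ∫ p, be p ^ (2 * j + 2) ∂τ := by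
    rw [hsw (by fun_prop)]
  have hA5 : ∫ p, X p ^ (2 * j + 2) ∂τ = ∫ p, Y p ^ (2 * j + 2) ∂τ := by
    rw [hsw (by fun_prop)]
  -- basic quantities
  set T1 := ∫ p, a p ^ (2 * j) * gam p ^ 2 ∂τ with hT1
  set T2 := ∫ p, a p ^ (2 * j) * Y p ^ 2 ∂τ with hT2
  set T3 := ∫ p, gam p ^ (2 * j + 2) ∂τ with hT3
  set T4 := ∫ p, Y p ^ (2 * j + 2) ∂τ with hT4
  set M := ∫ p, be p ^ (2 * j + 2) ∂τ with hM
  set Z1 := ∫ p, a p ^ (2 * j) * be p ^ 2 ∂τ with hZ1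
  set Z2 := ∫ p, b p ^ (2 * j) * Y p ^ 2 ∂τ with hZ2
  set Z3 := ∫ p, b p ^ (2 * j) * be p ^ 2 ∂τ with hZ3
  have nT1 : 0 ≤ T1 := integral_nonneg fun p => mul_nonneg (heven _) (sq_nonneg _)
  have nT2 : 0 ≤ T2 := integral_nonneg fun p => mul_nonneg (heven _) (sq_nonneg _)
  have nT3 : 0 ≤ T3 := integral_nonneg fun p => heven2 _
  have nT4 : 0 ≤ T4 := integral_nonneg fun p => heven2 _
  have nM : 0 ≤ M := integral_nonneg fun p => heven2 _
  have hMle : M ≤ c3 * (T3 + 2 * T4) := by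
    have : M ≤ ∫ p, c3 * (gam p ^ (2 * j + 2) + X p ^ (2 * j + 2) + Y p ^ (2 * j + 2)) ∂τ :=
      integral_mono (hIntg (by fun_prop)) (hIntg (by fun_prop)) fun p => pnb_step4 j _ _ _ _ (hgb p)
    rw [integral_const_mul, integral_add (hIntg (by fun_prop)) (hIntg (by fun_prop)),
      integral_add (hIntg (by fun_prop)) (hIntg (by fun_prop)), hA5] at this
    linarith
  have hMM : ∫ p, (al p ^ (2 * j + 2) + be p ^ (2 * j + 2) + X p ^ (2 * j + 2) + Y p ^ (2 * j + 2)) ∂τ = 2 * M + 2 * T4 := by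
    rw [integral_add (hIntg (by fun_prop)) (hIntg (by fun_prop)),
      integral_add (hIntg (by fun_prop)) (hIntg (by fun_prop)),
      integral_add (hIntg (by fun_prop)) (hIntg (by fun_prop)), hA4, hA5]
    ring
  have hZ2le : Z2 ≤ c2 * (T2 + (2 * M + 2 * T4)) := by
    have : Z2 ≤ ∫ p, c2 * (a p ^ (2 * j) * Y p ^ 2 + (al p ^ (2 * j + 2) + be p ^ (2 * j + 2) + X p ^ (2 * j + 2) + Y p ^ (2 * j + 2))) ∂τ :=
      integral_mono (hIntg (by fun_prop)) (hIntg (by fun_prop)) fun p =>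
        pnb_step2 j _ _ _ _ _ _ _ (hab p) (sq_nonneg _) (by nlinarith [sq_nonneg (be p)])
    rw [integral_const_mul, integral_add (hIntg (by fun_prop)) (hIntg (by fun_prop)), hMM] at this
    exact this
  have hZ3le : Z3 ≤ c2 * (Z1 + (2 * M + 2 * T4)) := by
    have : Z3 ≤ ∫ p, c2 * (a p ^ (2 * j) * be p ^ 2 + (al p ^ (2 * j + 2) + be p ^ (2 * j + 2) + X p ^ (2 * j + 2) + Y p ^ (2 * j + 2))) ∂τ :=
      integral_mono (hIntg (by fun_prop)) (hIntg (by fun_prop)) fun p =>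
        pnb_step2 j _ _ _ _ _ _ _ (hab p) (sq_nonneg _) (by nlinarith [sq_nonneg (Y p)])
    rw [integral_const_mul, integral_add (hIntg (by fun_prop)) (hIntg (by fun_prop)), hMM] at this
    exact this
  have hZ1le : Z1 ≤ 2 * T1 + Z2 + T2 := by
    have : Z1 ≤ ∫ p, (2 * (a p ^ (2 * j) * gam p ^ 2) + a p ^ (2 * j) * X p ^ 2 + a p ^ (2 * j) * Y p ^ 2) ∂τ :=
      integral_mono (hIntg (by fun_prop)) (hIntg (by fun_prop)) fun p => by
        have h1 : be p ^ 2 ≤ 2 * gam p ^ 2 + X p ^ 2 + Y p ^ 2 := by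
          nlinarith [hgb p, sq_nonneg (be p - 2 * gam p), sq_nonneg (X p - Y p)]
        have := mul_le_mul_of_nonneg_left h1 (heven (a p))
        simp only
        linarith
    rw [integral_add (hIntg (by fun_prop)) (hIntg (by fun_prop)),
      integral_add (hIntg (by fun_prop)) (hIntg (by fun_prop)), integral_const_mul, hA] at this
    exact this
  have hmain : ∫ p, (b p ^ (2 * j + 1) - a p ^ (2 * j + 1)) * (be p + Y p) ∂τ ≤
      c1 * (2 * (Z1 + T2 + Z3 + Z2)) := by
    have : ∫ p, (b p ^ (2 * j + 1) - a p ^ (2 * j + 1)) * (be p + Y p) ∂τ ≤ 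
       ∫ p, c1 * ((a p ^ (2 * j) * (al p ^ 2 + X p ^ 2) + b p ^ (2 * j) * (al p ^ 2 + X p ^ 2)) +
         (a p ^ (2 * j) * (be p ^ 2 + Y p ^ 2) + b p ^ (2 * j) * (be p ^ 2 + Y p ^ 2))) ∂τ :=
      integral_mono (hIntg (by fun_prop)) (hIntg (by fun_prop)) fun p => by
        refine (pnb_step1 j _ _ _ _ _ _ (hab p)).trans (le_of_eq ?_)
        simp only [hc1]
        ring
    rw [integral_const_mul, integral_add (hIntg (by fun_prop)) (hIntg (by fun_prop)),
      integral_add (hIntg (by fun_prop)) (hIntg (by fun_prop)),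
      integral_add (hIntg (by fun_prop)) (hIntg (by fun_prop)), hA2, hA3] at this
    have e1 : ∫ p, a p ^ (2 * j) * (be p ^ 2 + Y p ^ 2) ∂τ = Z1 + T2 := by
      rw [hZ1, hT2, ← integral_add (hIntg (by fun_prop)) (hIntg (by fun_prop))]
      simp only [mul_add]
    have e2 : ∫ p, b p ^ (2 * j) * (be p ^ 2 + Y p ^ 2) ∂τ = Z3 + Z2 := by
      rw [hZ3, hZ2, ← integral_add (hIntg (by fun_prop)) (hIntg (by fun_prop))]
      simp only [mul_add]
    rw [e1, e2] at this
    linarith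
  have hrhs : ∫ p, (a p ^ (2 * j) * (gam p ^ 2 + ‖p.2‖ ^ 4) +
       (gam p ^ (2 * j + 2) + ‖p.2‖ ^ (4 * j + 4))) ∂τ = T1 + T2 + T3 + T4 := by
    rw [hT1, hT2, hT3, hT4, ← integral_add (hIntg (by fun_prop)) (hIntg (by fun_prop)),
      ← integral_add (hIntg (by fun_prop)) (hIntg (by fun_prop)),
      ← integral_add (hIntg (by fun_prop)) (hIntg (by fun_prop))]
    refine integral_congr_ae (Filter.Eventually.of_forall fun p => ?_)
    simp only [hY, ← pow_mul]
    ring_nf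
  rw [hrhs, hid, add_sub_cancel_left, pnbC]
  refine hmain.trans ?_
  exact pnb_arith c1 c2 c3 hc1p hc2p hc3p M T1 T2 T3 T4 Z1 Z2 Z3 nT1 nT2 nT3 nT4 hMle hZ2le hZ3le hZ1le
end


section
variable {E : Type*} [NormedAddCommGroup E] [InnerProductSpace ℝ E] [FiniteDimensional ℝ E]
  [MeasurableSpace E] [BorelSpace E] {Ω : Type*} [MeasurableSpace Ω]

lemma pnb_index (j : ℕ) (μ : Measure Ω) [IsProbabilityMeasure μ] (Z X : Ω → E)
    (hZ : Measurable Z) (hX : Measurable X) (hi : IndepFun Z X μ) (R : ℝ)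
    (hZb : ∀ ω, ‖Z ω‖ ≤ R) (hXb : ∀ ω, ‖X ω‖ ≤ R) (hc : ∫ ω, X ω ∂μ = 0) (α : ℝ) :
    Integrable (fun ω => (‖Z ω + X ω‖ ^ 2 - α) ^ (2 * j) * ((∫ ω', ⟪Z ω + X ω, X ω'⟫ ^ 2 ∂μ) +
        ∫ ω', ‖X ω'‖ ^ 4 ∂μ) + ((∫ ω', ⟪Z ω + X ω, X ω'⟫ ^ (2 * j + 2) ∂μ) +
        ∫ ω', ‖X ω'‖ ^ (4 * j + 4) ∂μ)) μ ∧
    ∫ ω, (‖Z ω + X ω‖ ^ 2 - α) ^ (2 * j + 1) * ⟪Z ω + X ω, X ω⟫ ∂μ -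
      (∫ ω, ‖X ω‖ ^ 2 ∂μ) * ∫ ω, (‖Z ω + X ω‖ ^ 2 - α) ^ (2 * j + 1) ∂μ ≤
    pnbC j * ∫ ω, ((‖Z ω + X ω‖ ^ 2 - α) ^ (2 * j) * ((∫ ω', ⟪Z ω + X ω, X ω'⟫ ^ 2 ∂μ) +
        ∫ ω', ‖X ω'‖ ^ 4 ∂μ) + ((∫ ω', ⟪Z ω + X ω, X ω'⟫ ^ (2 * j + 2) ∂μ) +
        ∫ ω', ‖X ω'‖ ^ (4 * j + 4) ∂μ)) ∂μ := by
  have hmap := hi.map_prod_eq_prod_map_map hZ.aemeasurable hX.aemeasurable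
  set l := μ.map Z with hl
  set ν := μ.map X with hν
  have : IsProbabilityMeasure l := Measure.isProbabilityMeasure_map hZ.aemeasurable
  have : IsProbabilityMeasure ν := Measure.isProbabilityMeasure_map hX.aemeasurable
  have hlb : ∀ᵐ x ∂l, ‖x‖ ≤ R := by
    rw [hl, ae_map_iff hZ.aemeasurable (measurableSet_le (by fun_prop) (by fun_prop))]
    exact Filter.Eventually.of_forall hZb
  have hνb : ∀ᵐ x ∂ν, ‖x‖ ≤ R := by
    rw [hν, ae_map_iff hX.aemeasurable (measurableSet_le (by fun_prop) (by fun_prop))]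
    exact Filter.Eventually.of_forall hXb
  have hνc : ∫ x, x ∂ν = 0 := by
    rw [hν, integral_map hX.aemeasurable (by fun_prop)]; exact hc
  have hν1 : ∀ {F : E → ℝ}, Continuous F → ∫ y, F y ∂ν = ∫ ω, F (X ω) ∂μ := fun hF => by
    rw [hν, integral_map hX.aemeasurable hF.aestronglyMeasurable]
  have hIntg : ∀ {F : (E × E) × E → ℝ}, Continuous F → Integrable F ((l.prod ν).prod ν) :=
    fun hF => pnb_integrable_of_cont _ R (pnb_triple_bdd l ν R hlb hνb) hF
  have hIntgν : ∀ {F : E → ℝ}, Continuous F → Integrable F ν :=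
    fun hF => pnb_integrable_of_cont _ R hνb hF
  have hZX : Measurable fun ω => (Z ω, X ω) := hZ.prodMk hX
  have hfst : ∀ {F : E × E → ℝ}, Continuous F →
      ∫ p, F p.1 ∂((l.prod ν).prod ν) = ∫ ω, F (Z ω, X ω) ∂μ := fun {F} hF => by
    rw [integral_fun_fst (μ := l.prod ν) (ν := ν) F, ← hmap, integral_map hZX.aemeasurable hF.aestronglyMeasurable]
    simp
  have key := pnb_triple j l ν R hlb hνb hνc α
  rw [hfst (F := fun p => (‖p.1 + p.2‖ ^ 2 - α) ^ (2 * j + 1) * ⟪p.1 + p.2, p.2⟫) (by fun_prop),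
    hfst (F := fun p => (‖p.1 + p.2‖ ^ 2 - α) ^ (2 * j + 1)) (by fun_prop),
    hν1 (F := fun x => ‖x‖ ^ 2) (by fun_prop)] at key
  have hI := hIntg (F := fun p => ((‖p.1.1 + p.1.2‖ ^ 2 - α) ^ (2 * j) * (⟪p.1.1 + p.1.2, p.2⟫ ^ 2 + ‖p.2‖ ^ 4) +
       (⟪p.1.1 + p.1.2, p.2⟫ ^ (2 * j + 2) + ‖p.2‖ ^ (4 * j + 4)))) (by fun_prop)
  rw [integral_prod _ hI] at key
  have hI2 := hI.integral_prod_left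
  have hform : ∀ q : E × E, ∫ y, ((‖q.1 + q.2‖ ^ 2 - α) ^ (2 * j) * (⟪q.1 + q.2, y⟫ ^ 2 + ‖y‖ ^ 4) +
       (⟪q.1 + q.2, y⟫ ^ (2 * j + 2) + ‖y‖ ^ (4 * j + 4))) ∂ν =
      (‖q.1 + q.2‖ ^ 2 - α) ^ (2 * j) * ((∫ ω', ⟪q.1 + q.2, X ω'⟫ ^ 2 ∂μ) +
        ∫ ω', ‖X ω'‖ ^ 4 ∂μ) + ((∫ ω', ⟪q.1 + q.2, X ω'⟫ ^ (2 * j + 2) ∂μ) +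
        ∫ ω', ‖X ω'‖ ^ (4 * j + 4) ∂μ) := fun q => by
    rw [integral_add (hIntgν (by fun_prop)) (hIntgν (by fun_prop)), integral_const_mul,
      integral_add (hIntgν (by fun_prop)) (hIntgν (by fun_prop)),
      integral_add (hIntgν (by fun_prop)) (hIntgν (by fun_prop)), hν1 (by fun_prop), hν1 (by fun_prop),
      hν1 (by fun_prop), hν1 (by fun_prop)]
  simp only [hform] at hI2 key
  rw [← hmap] at hI2 key
  rw [integral_map hZX.aemeasurable hI2.aestronglyMeasurable] at key
  exact ⟨hI2.comp_measurable hZX, key⟩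

lemma pnb_core (j n : ℕ) (μ : Measure Ω) [IsProbabilityMeasure μ] (X : Fin n → Ω → E)
    (hX : ∀ i, Measurable (X i)) (hi : iIndepFun X μ) (R : ℝ) (hR : 0 ≤ R)
    (hXb : ∀ i ω, ‖X i ω‖ ≤ R) (hc : ∀ i, ∫ ω, X i ω ∂μ = 0) (w V B G α : ℝ)
    (hα : α = ∑ i, ∫ ω, ‖X i ω‖ ^ 2 ∂μ)
    (h2 : ∀ s : E, ∑ i, ∫ ω, ⟪s, X i ω⟫ ^ 2 ∂μ ≤ w * ‖s‖ ^ 2)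
    (h3 : ∀ s : E, ∑ i, ∫ ω, ⟪s, X i ω⟫ ^ (2 * j + 2) ∂μ ≤ B * ‖s‖ ^ (2 * j + 2))
    (h4 : ∑ i, ∫ ω, ‖X i ω‖ ^ 4 ∂μ ≤ V)
    (h5 : ∑ i, ∫ ω, ‖X i ω‖ ^ (4 * j + 4) ∂μ ≤ G) :
    (∀ F : E → ℝ, Continuous F → Integrable (fun ω => F (∑ i, X i ω)) μ) ∧
    ∫ ω, (‖∑ i, X i ω‖ ^ 2 - α) ^ (2 * j + 2) ∂μ ≤ pnbC j * ∫ ω,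
      ((‖∑ i, X i ω‖ ^ 2 - α) ^ (2 * j) * (w * ‖∑ i, X i ω‖ ^ 2 + V) +
        (B * ‖∑ i, X i ω‖ ^ (2 * j + 2) + G)) ∂μ := by
  classical
  set S : Ω → E := fun ω => ∑ i, X i ω with hS
  have hSm : Measurable S := by rw [hS]; fun_prop
  have hSb : ∀ ω, ‖S ω‖ ≤ n * R := fun ω => by
    refine (norm_sum_le _ _).trans ((Finset.sum_le_sum fun i _ => hXb i ω).trans ?_)
    simp
  have hFb : ∀ (r : ℝ) (F : E × E → ℝ), Continuous F → ∀ Y : Ω → E, Measurable Y → (∀ ω, ‖Y ω‖ ≤ r) →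
      Integrable (fun ω => F (S ω, Y ω)) μ := fun r F hF Y hY hr => by
    have : IsProbabilityMeasure (μ.map fun ω => (S ω, Y ω)) :=
      Measure.isProbabilityMeasure_map (hSm.prodMk hY).aemeasurable
    have := pnb_integrable_of_cont (μ.map fun ω => (S ω, Y ω)) (max (n * R) r) (by
      rw [ae_map_iff (hSm.prodMk hY).aemeasurable (measurableSet_le (by fun_prop) (by fun_prop))]
      refine Filter.Eventually.of_forall fun ω => ?_
      exact max_le_max (hSb ω) (hr ω)) hF
    exact this.comp_measurable (hSm.prodMk hY)
  have hF1 : ∀ F : E → ℝ, Continuous F → Integrable (fun ω => F (S ω)) μ := fun F hF =>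
    hFb 0 (fun p => F p.1) (by fun_prop) (fun _ => 0) measurable_const (by simp)
  refine ⟨hF1, ?_⟩
  set H : Fin n → E → ℝ := fun i s => (‖s‖ ^ 2 - α) ^ (2 * j) * ((∫ ω', ⟪s, X i ω'⟫ ^ 2 ∂μ) +
        ∫ ω', ‖X i ω'‖ ^ 4 ∂μ) + ((∫ ω', ⟪s, X i ω'⟫ ^ (2 * j + 2) ∂μ) +
        ∫ ω', ‖X i ω'‖ ^ (4 * j + 4) ∂μ) with hH
  have hidx : ∀ i, Integrable (fun ω => H i (S ω)) μ ∧
      ∫ ω, (‖S ω‖ ^ 2 - α) ^ (2 * j + 1) * ⟪S ω, X i ω⟫ ∂μ -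
      (∫ ω, ‖X i ω‖ ^ 2 ∂μ) * ∫ ω, (‖S ω‖ ^ 2 - α) ^ (2 * j + 1) ∂μ ≤ pnbC j * ∫ ω, H i (S ω) ∂μ := by
    intro i
    have hind := hi.indepFun_finsetSum_of_notMem hX (Finset.notMem_erase i Finset.univ)
    have hsum : ∀ ω, (∑ k ∈ Finset.univ.erase i, X k) ω + X i ω = S ω := fun ω => by
      rw [Finset.sum_apply]
      exact Finset.sum_erase_add Finset.univ (fun k => X k ω) (Finset.mem_univ i)
    have := pnb_index j μ (∑ k ∈ Finset.univ.erase i, X k) (X i)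
      (by have := Finset.measurable_sum (Finset.univ.erase i) (fun k _ => hX k); convert this using 1; ext ω; simp) (hX i) hind (n * R + R)
      (fun ω => by
        rw [eq_sub_of_add_eq (hsum ω)]
        exact (norm_sub_le _ _).trans (add_le_add (hSb ω) (hXb i ω)))
      (fun ω => (hXb i ω).trans (by nlinarith [mul_nonneg (Nat.cast_nonneg (α := ℝ) n) hR])) (hc i) α
    simp only [hsum] at this
    exact this
  have hsplit : ∫ ω, (‖S ω‖ ^ 2 - α) ^ (2 * j + 2) ∂μ = ∑ i,
      (∫ ω, (‖S ω‖ ^ 2 - α) ^ (2 * j + 1) * ⟪S ω, X i ω⟫ ∂μ -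
      (∫ ω, ‖X i ω‖ ^ 2 ∂μ) * ∫ ω, (‖S ω‖ ^ 2 - α) ^ (2 * j + 1) ∂μ) := by
    rw [Finset.sum_sub_distrib, ← Finset.sum_mul, ← hα, ← integral_finsetSum, ← integral_const_mul, ← integral_sub]
    · refine integral_congr_ae (Filter.Eventually.of_forall fun ω => ?_)
      simp only
      rw [← Finset.mul_sum, ← inner_sum]
      change _ = _ * ⟪S ω, S ω⟫ - _
      rw [real_inner_self_eq_norm_sq]
      ring
    · refine integrable_finsetSum _ fun i _ => ?_
      exact hFb R (fun p => (‖p.1‖ ^ 2 - α) ^ (2 * j + 1) * ⟪p.1, p.2⟫) (by fun_prop) (X i) (hX i) (hXb i)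
    · exact hF1 (fun s => α * (‖s‖ ^ 2 - α) ^ (2 * j + 1)) (by fun_prop)
    · intro i _
      exact hFb R (fun p => (‖p.1‖ ^ 2 - α) ^ (2 * j + 1) * ⟪p.1, p.2⟫) (by fun_prop) (X i) (hX i) (hXb i)
  rw [hsplit]
  refine (Finset.sum_le_sum fun i _ => (hidx i).2).trans ?_
  rw [← Finset.mul_sum, ← integral_finsetSum _ fun i _ => (hidx i).1]
  refine mul_le_mul_of_nonneg_left ?_ (pnbC_pos j).le
  refine integral_mono (integrable_finsetSum _ fun i _ => (hidx i).1)
    (hF1 (fun s => (‖s‖ ^ 2 - α) ^ (2 * j) * (w * ‖s‖ ^ 2 + V) + (B * ‖s‖ ^ (2 * j + 2) + G)) (by fun_prop)) ?_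
  intro ω
  simp only [hH]
  rw [Finset.sum_add_distrib, ← Finset.mul_sum, Finset.sum_add_distrib, Finset.sum_add_distrib]
  have : 0 ≤ (‖S ω‖ ^ 2 - α) ^ (2 * j) := by rw [pow_mul]; positivity
  gcongr
  · exact h2 _
  · exact h3 _
end


lemma pnb_absorb (j : ℕ) (Q c : ℝ) (hc : 0 ≤ c) :
    Q ^ (2 * j) * c ≤ Q ^ (2 * j + 2) / 8 + 8 ^ j * c ^ (j + 1) := by
  have h0 : 0 ≤ Q ^ (2 * j) := by rw [pow_mul]; positivity
  by_cases h : c ≤ Q ^ 2 / 8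
  · have : Q ^ (2 * j) * c ≤ Q ^ (2 * j) * (Q ^ 2 / 8) := by gcongr
    have h2 : 0 ≤ 8 ^ j * c ^ (j + 1) := by positivity
    have h3 : Q ^ (2 * j) * (Q ^ 2 / 8) = Q ^ (2 * j + 2) / 8 := by rw [pow_add]; ring
    linarith
  · push Not at h
    have h1 : Q ^ (2 * j) ≤ (8 * c) ^ j := by
      rw [pow_mul]; exact pow_le_pow_left₀ (by positivity) (by linarith) j
    have h2 : 0 ≤ Q ^ (2 * j + 2) / 8 := by
      rw [show 2 * j + 2 = 2 * (j + 1) by ring, pow_mul]; positivity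
    have : Q ^ (2 * j) * c ≤ (8 * c) ^ j * c := by gcongr
    rw [mul_pow] at this
    have h3 : 8 ^ j * c ^ j * c = 8 ^ j * c ^ (j + 1) := by ring
    linarith

noncomputable def pnbD (j : ℕ) : ℝ :=
  8 ^ j * pnbC j ^ (j + 1) + 8 ^ j * (2 * pnbC j ^ 2) ^ (j + 1) + 2 * (pnbC j * 4 ^ (j + 1)) ^ 2
    + pnbC j * 4 ^ (j + 1) + pnbC j

lemma pnbD_pos (j : ℕ) : 0 < pnbD j := by
  have := pnbC_pos j
  unfold pnbD; positivity

lemma pnb_absorb2 (j : ℕ) (Q α w V B G : ℝ) (hα : 0 ≤ α) (hw : 0 ≤ w) (hV : 0 ≤ V) (hB : 0 ≤ B)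
    (hG : 0 ≤ G) (hQ : 0 ≤ Q + α) :
    pnbC j * (Q ^ (2 * j) * (w * (Q + α) + V) + (B * (Q + α) ^ (j + 1) + G)) ≤
      5 / 8 * Q ^ (2 * j + 2) + pnbD j * (w ^ (2 * j + 2) + (w * α) ^ (j + 1) + V ^ (j + 1) + B ^ 2
        + B * α ^ (j + 1) + G) := by
  have hC := pnbC_pos j
  have hCD : pnbD j = 8 ^ j * pnbC j ^ (j + 1) + 8 ^ j * (2 * pnbC j ^ 2) ^ (j + 1) + 2 * (pnbC j * 4 ^ (j + 1)) ^ 2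
    + pnbC j * 4 ^ (j + 1) + pnbC j := rfl
  rw [hCD]
  generalize pnbC j = C at *
  have a1 := pnb_absorb j Q (C * (w * α)) (by positivity)
  have a2 := pnb_absorb j Q (C * V) (by positivity)
  have a3 := pnb_absorb j Q (2 * C ^ 2 * w ^ 2) (by positivity)
  have h0 : 0 ≤ Q ^ (2 * j) := by rw [pow_mul]; positivity
  have a4 : Q ^ (2 * j) * (C * w * Q) ≤ Q ^ (2 * j) * (Q ^ 2 / 8 + 2 * C ^ 2 * w ^ 2) := by
    gcongr
    nlinarith [sq_nonneg (Q / 2 - 2 * C * w), sq_nonneg (Q - 4 * C * w)]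
  have a4' : Q ^ (2 * j) * (Q ^ 2 / 8 + 2 * C ^ 2 * w ^ 2) = Q ^ (2 * j + 2) / 8 + Q ^ (2 * j) * (2 * C ^ 2 * w ^ 2) := by
    rw [pow_add]; ring
  have a5 : (Q + α) ^ (j + 1) ≤ 4 ^ (j + 1) * (|Q| ^ (j + 1) + α ^ (j + 1)) := by
    have := pnb_add4_pow |Q| α 0 0 (abs_nonneg _) hα le_rfl le_rfl (j + 1)
    simp only [zero_pow (Nat.succ_ne_zero j), add_zero] at this
    exact (pow_le_pow_left₀ hQ (by linarith [le_abs_self Q]) _).trans this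
  set F : ℝ := C * 4 ^ (j + 1) with hF
  have hF0 : 0 < F := by positivity
  have a6 : C * (B * (Q + α) ^ (j + 1)) ≤ F * B * |Q| ^ (j + 1) + F * (B * α ^ (j + 1)) := by
    calc C * (B * (Q + α) ^ (j + 1)) ≤ C * (B * (4 ^ (j + 1) * (|Q| ^ (j + 1) + α ^ (j + 1)))) := by gcongr
      _ = _ := by rw [hF]; ring
  have a7 : F * B * |Q| ^ (j + 1) ≤ Q ^ (2 * j + 2) / 8 + 2 * F ^ 2 * B ^ 2 := by
    have : Q ^ (2 * j + 2) = (|Q| ^ (j + 1)) ^ 2 := by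
      rw [← pow_mul, mul_comm (j + 1) 2, pow_mul |Q|, sq_abs, ← pow_mul]; ring_nf
    rw [this]
    nlinarith [sq_nonneg (|Q| ^ (j + 1) - 4 * F * B)]
  have e1 : (C * (w * α)) ^ (j + 1) = C ^ (j + 1) * (w * α) ^ (j + 1) := mul_pow _ _ _
  have e2 : (C * V) ^ (j + 1) = C ^ (j + 1) * V ^ (j + 1) := mul_pow _ _ _
  have e3 : (2 * C ^ 2 * w ^ 2) ^ (j + 1) = (2 * C ^ 2) ^ (j + 1) * w ^ (2 * j + 2) := by
    rw [mul_pow, ← pow_mul w]; ring_nf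
  rw [e1] at a1; rw [e2] at a2; rw [e3] at a3
  have n1 : 0 ≤ w ^ (2 * j + 2) := by positivity
  have n2 : 0 ≤ (w * α) ^ (j + 1) := by positivity
  have n3 : 0 ≤ V ^ (j + 1) := by positivity
  have n4 : 0 ≤ B * α ^ (j + 1) := by positivity
  set c1 : ℝ := 8 ^ j * C ^ (j + 1) with hc1
  set c2 : ℝ := 8 ^ j * (2 * C ^ 2) ^ (j + 1) with hc2
  have m1 : 0 < c1 := by positivity
  have m2 : 0 < c2 := by positivity
  set c3 : ℝ := 2 * F ^ 2 with hc3
  have m3 : 0 < c3 := by positivity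
  rw [← mul_assoc (8 ^ j), ← hc1] at a1 a2
  rw [← mul_assoc (8 ^ j), ← hc2] at a3
  have hexp : C * (Q ^ (2 * j) * (w * (Q + α) + V) + (B * (Q + α) ^ (j + 1) + G)) =
     Q ^ (2 * j) * (C * w * Q) + Q ^ (2 * j) * (C * (w * α)) + Q ^ (2 * j) * (C * V) +
      C * (B * (Q + α) ^ (j + 1)) + C * G := by ring
  rw [hexp]
  set K := w ^ (2 * j + 2) + (w * α) ^ (j + 1) + V ^ (j + 1) + B ^ 2 + B * α ^ (j + 1) + G with hK
  have b1 : c1 * ((w * α) ^ (j + 1) + V ^ (j + 1)) ≤ c1 * K := by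
    gcongr; rw [hK]; linarith [sq_nonneg B]
  have b2 : c2 * w ^ (2 * j + 2) ≤ c2 * K := by
    gcongr; rw [hK]; linarith [sq_nonneg B]
  have b3 : c3 * B ^ 2 ≤ c3 * K := by
    gcongr; rw [hK]; linarith [sq_nonneg B]
  have b4 : F * (B * α ^ (j + 1)) ≤ F * K := by
    gcongr; rw [hK]; linarith [sq_nonneg B]
  have b5 : C * G ≤ C * K := by
    gcongr; rw [hK]; linarith [sq_nonneg B]
  rw [a4'] at a4
  have hD : (c1 + c2 + c3 + F + C) * K = c1 * K + c2 * K + c3 * K + F * K + C * K := by ring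
  rw [mul_add] at b1
  rw [hD]
  clear_value K c1 c2 c3 F
  linarith

section
variable {E : Type*} [NormedAddCommGroup E] [InnerProductSpace ℝ E] [FiniteDimensional ℝ E]
  [MeasurableSpace E] [BorelSpace E] {Ω : Type*} [MeasurableSpace Ω]

lemma pnb_core2 (j n : ℕ) (μ : Measure Ω) [IsProbabilityMeasure μ] (X : Fin n → Ω → E)
    (hX : ∀ i, Measurable (X i)) (hi : iIndepFun X μ) (R : ℝ) (hR : 0 ≤ R)
    (hXb : ∀ i ω, ‖X i ω‖ ≤ R) (hc : ∀ i, ∫ ω, X i ω ∂μ = 0) (w V B G a t : ℝ)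
    (hw : 0 ≤ w) (hV : 0 ≤ V) (hB : 0 ≤ B) (hG : 0 ≤ G) (ht : 0 < t)
    (ha : ∑ i, ∫ ω, ‖X i ω‖ ^ 2 ∂μ ≤ a)
    (h2 : ∀ s : E, ∑ i, ∫ ω, ⟪s, X i ω⟫ ^ 2 ∂μ ≤ w * ‖s‖ ^ 2)
    (h3 : ∀ s : E, ∑ i, ∫ ω, ⟪s, X i ω⟫ ^ (2 * j + 2) ∂μ ≤ B * ‖s‖ ^ (2 * j + 2))
    (h4 : ∑ i, ∫ ω, ‖X i ω‖ ^ 4 ∂μ ≤ V)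
    (h5 : ∑ i, ∫ ω, ‖X i ω‖ ^ (4 * j + 4) ∂μ ≤ G) :
    μ.real {ω | a + t ≤ ‖∑ i, X i ω‖ ^ 2} * t ^ (2 * j + 2) ≤ 
      3 * pnbD j * (w ^ (2 * j + 2) + (w * a) ^ (j + 1) + V ^ (j + 1) + B ^ 2
        + B * a ^ (j + 1) + G) := by
  set α := ∑ i, ∫ ω, ‖X i ω‖ ^ 2 ∂μ with hα
  have hα0 : 0 ≤ α := Finset.sum_nonneg fun i _ => integral_nonneg fun ω => by positivity
  obtain ⟨hIntg, hU⟩ := pnb_core j n μ X hX hi R hR hXb hc w V B G α hα h2 h3 h4 h5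
  set U := ∫ ω, (‖∑ i, X i ω‖ ^ 2 - α) ^ (2 * j + 2) ∂μ with hUdef
  set K := w ^ (2 * j + 2) + (w * α) ^ (j + 1) + V ^ (j + 1) + B ^ 2 + B * α ^ (j + 1) + G with hK
  have h1 : U ≤ 5 / 8 * U + pnbD j * K := by
    rw [← integral_const_mul] at hU
    refine hU.trans ?_
    have : ∫ ω, (5 / 8 * (‖∑ i, X i ω‖ ^ 2 - α) ^ (2 * j + 2) + pnbD j * K) ∂μ = 5 / 8 * U + pnbD j * K := by
      rw [integral_add ((hIntg (fun s => (‖s‖ ^ 2 - α) ^ (2 * j + 2)) (by fun_prop)).const_mul _) (integrable_const _), integral_const_mul]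
      simp [hUdef]
    rw [← this]
    refine integral_mono (hIntg (fun s => pnbC j * ((‖s‖ ^ 2 - α) ^ (2 * j) * (w * ‖s‖ ^ 2 + V) +
        (B * ‖s‖ ^ (2 * j + 2) + G))) (by fun_prop))
      (hIntg (fun s => 5 / 8 * (‖s‖ ^ 2 - α) ^ (2 * j + 2) + pnbD j * K) (by fun_prop)) ?_
    intro ω
    have := pnb_absorb2 j (‖∑ i, X i ω‖ ^ 2 - α) α w V B G hα0 hw hV hB hG (by rw [sub_add_cancel]; positivity)
    rw [sub_add_cancel, ← pow_mul, show 2 * (j + 1) = 2 * j + 2 by ring] at this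
    exact this
  have hKle : K ≤ w ^ (2 * j + 2) + (w * a) ^ (j + 1) + V ^ (j + 1) + B ^ 2
        + B * a ^ (j + 1) + G := by
    rw [hK]; gcongr
  have hU2 : U ≤ 3 * pnbD j * K := by
    have : 0 ≤ pnbD j * K := mul_nonneg (pnbD_pos j).le (by rw [hK]; positivity)
    linarith
  have hmarkov := mul_meas_ge_le_integral_of_nonneg (μ := μ)
    (f := fun ω => (‖∑ i, X i ω‖ ^ 2 - α) ^ (2 * j + 2))
    (Filter.Eventually.of_forall fun ω => by
      simp only [Pi.zero_apply]
      rw [show 2 * j + 2 = 2 * (j + 1) by ring, pow_mul]; positivity)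
    (hIntg (fun s => (‖s‖ ^ 2 - α) ^ (2 * j + 2)) (by fun_prop)) (t ^ (2 * j + 2))
  have hsub : μ.real {ω | a + t ≤ ‖∑ i, X i ω‖ ^ 2} ≤ 
      μ.real {ω | t ^ (2 * j + 2) ≤ (‖∑ i, X i ω‖ ^ 2 - α) ^ (2 * j + 2)} := by
    refine measureReal_mono fun ω hω => ?_
    simp only [Set.mem_ofPred_eq] at hω ⊢
    exact pow_le_pow_left₀ ht.le (by linarith) _
  calc _ ≤ μ.real {ω | t ^ (2 * j + 2) ≤ (‖∑ i, X i ω‖ ^ 2 - α) ^ (2 * j + 2)} * t ^ (2 * j + 2) := by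
        gcongr
    _ ≤ U := by rw [mul_comm]; exact hmarkov
    _ ≤ _ := hU2
    _ ≤ _ := by have := pnbD_pos j; gcongr
end


lemma pnb_jensen {Ω : Type*} [MeasurableSpace Ω] (μ : Measure Ω) [IsProbabilityMeasure μ]
    (f : Ω → ℝ) (hf : ∀ ω, 0 ≤ f ω) (q : ℝ) (hq : 1 ≤ q) (h1 : Integrable f μ)
    (h2 : Integrable (fun ω => f ω ^ q) μ) : (∫ ω, f ω ∂μ) ^ q ≤ ∫ ω, f ω ^ q ∂μ :=
  (convexOn_rpow hq).map_integral_le (Real.continuous_rpow_const (by linarith)).continuousOn isClosed_Ici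
    (Filter.Eventually.of_forall hf) h1 h2

lemma pnb_add_rpow (p u v : ℝ) (hp : 1 ≤ p) (hu : 0 ≤ u) (hv : 0 ≤ v) :
    (u + v) ^ p ≤ 2 ^ (p - 1) * (u ^ p + v ^ p) := by
  lift u to NNReal using hu
  lift v to NNReal using hv
  exact_mod_cast NNReal.rpow_add_le_mul_rpow_add_rpow u v hp

/-- numeric lemma -/
lemma pnb_num1 (p a y ρ : ℝ) (q : ℕ) (hp : 2 ≤ p) (hq : p ≤ q + 2) (ha : 0 ≤ a) (ha1 : a ≤ 1)
    (hy : 0 ≤ y) (hρ : 0 < ρ) (hay : a * y ≤ ρ) :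
    a ^ q * y ^ (q + 2) ≤ ρ ^ ((q : ℝ) + 2 - p) * y ^ p := by
  rcases hy.eq_or_lt with rfl | hy
  · simp; positivity
  rcases ha.eq_or_lt with rfl | ha
  · rcases Nat.eq_zero_or_pos q with rfl | hq0
    · have : p = 2 := by norm_num at hq; linarith
      subst this; simp
    · rw [zero_pow hq0.ne']; simp; positivity
  have e1 : y ^ (q + 2) = y ^ ((q : ℝ) + 2 - p) * y ^ p := by
    rw [← Real.rpow_add hy, ← Real.rpow_natCast]; congr 1; push_cast; ring
  have e2 : a ^ q ≤ a ^ ((q : ℝ) + 2 - p) := by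
    rw [← Real.rpow_natCast]
    exact Real.rpow_le_rpow_of_exponent_ge ha ha1 (by linarith)
  calc a ^ q * y ^ (q + 2) ≤ a ^ ((q : ℝ) + 2 - p) * (y ^ ((q : ℝ) + 2 - p) * y ^ p) := by
        rw [e1]; gcongr
    _ = (a * y) ^ ((q : ℝ) + 2 - p) * y ^ p := by rw [Real.mul_rpow ha.le hy.le]; ring
    _ ≤ _ := by
        gcongr

lemma pnb_num2 (p a y lam : ℝ) (hp : 4 ≤ p) (ha : 0 ≤ a) (ha1 : a ≤ 1)
    (hy : 0 ≤ y) (hl : 0 < lam) :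
    a ^ 4 * y ^ 4 ≤ a ^ 2 * (lam * y ^ 2 + lam ^ ((4 - p) / 2) * y ^ p) := by
  have hyp : 0 ≤ y ^ p := by positivity
  have hlp : 0 < lam ^ ((4 - p) / 2) := by positivity
  by_cases h : (a * y) ^ 2 ≤ lam
  · have : (a * y) ^ 2 * (a ^ 2 * y ^ 2) ≤ lam * (a ^ 2 * y ^ 2) := by gcongr
    have : 0 ≤ a ^ 2 * (lam ^ ((4 - p) / 2) * y ^ p) := by positivity
    nlinarith
  · push Not at h
    have hay : 0 < a * y := by
      rcases (mul_nonneg ha hy).eq_or_lt with h0 | h0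
      · rw [← h0] at h; norm_num at h; linarith
      · exact h0
    have ha0 : 0 < a := by
      rcases ha.eq_or_lt with rfl | h; · simp at hay
      exact h
    have e1 : (a * y) ^ 4 = ((a * y) ^ 2) ^ ((4 - p) / 2) * (a * y) ^ p := by
      rw [← Real.rpow_natCast (a * y) 2, ← Real.rpow_mul hay.le, ← Real.rpow_add hay, ← Real.rpow_natCast]
      congr 1; push_cast; ring
    have e2 : ((a * y) ^ 2) ^ ((4 - p) / 2) ≤ lam ^ ((4 - p) / 2) :=
      Real.rpow_le_rpow_of_nonpos hl h.le (by linarith)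
    have e3 : a ^ p ≤ a ^ 2 := by
      rw [← Real.rpow_natCast]
      exact Real.rpow_le_rpow_of_exponent_ge ha0 ha1 (by push_cast; linarith)
    calc a ^ 4 * y ^ 4 = (a * y) ^ 4 := by ring
      _ ≤ lam ^ ((4 - p) / 2) * (a ^ 2 * y ^ p) := by
        rw [e1, Real.mul_rpow ha hy]; gcongr
      _ ≤ _ := by
        have : 0 ≤ a ^ 2 * (lam * y ^ 2) := by positivity
        nlinarith

noncomputable def pnbT {H : Type*} [NormedAddCommGroup H] (a R : ℝ) (h : H) : H :=
  open Classical in if a * ‖h‖ ≤ R then h else 0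

lemma pnb_trunc {H : Type*} [NormedAddCommGroup H] [InnerProductSpace ℝ H] [CompleteSpace H]
    [SecondCountableTopology H] [MeasurableSpace H] [BorelSpace H] {Ω : Type*} [MeasurableSpace Ω]
    (μ : Measure Ω) [IsProbabilityMeasure μ] (f : Ω → H) (hf : Measurable f) (p a R : ℝ)
    (hp : 2 ≤ p) (ha : 0 ≤ a) (ha1 : a ≤ 1) (hR : 0 < R)
    (hfp : Integrable (fun ω => ‖f ω‖ ^ p) μ) (hc : ∫ ω, f ω ∂μ = 0) :
    Measurable (pnbT a R : H → H) ∧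
    (∀ ω, a * ‖pnbT a R (f ω) - ∫ ω', pnbT a R (f ω') ∂μ‖ ≤ 2 * R) ∧
    Integrable (fun ω => ‖pnbT a R (f ω) - ∫ ω', pnbT a R (f ω') ∂μ‖ ^ 2) μ ∧
    ∫ ω, ‖pnbT a R (f ω) - ∫ ω', pnbT a R (f ω') ∂μ‖ ^ 2 ∂μ ≤ ∫ ω, ‖f ω‖ ^ 2 ∂μ ∧
    Integrable (fun ω => ‖pnbT a R (f ω) - ∫ ω', pnbT a R (f ω') ∂μ‖ ^ p) μ ∧
    ∫ ω, ‖pnbT a R (f ω) - ∫ ω', pnbT a R (f ω') ∂μ‖ ^ p ∂μ ≤ 2 ^ p * ∫ ω, ‖f ω‖ ^ p ∂μ ∧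
    ‖∫ ω', pnbT a R (f ω') ∂μ‖ ≤ a * (∫ ω, ‖f ω‖ ^ p ∂μ) / R ^ (p - 1) ∧
    μ.real {ω | R < a * ‖f ω‖} ≤ a ^ 2 * (∫ ω, ‖f ω‖ ^ p ∂μ) / R ^ p ∧
    Integrable (fun ω => pnbT a R (f ω)) μ := by
  have hTm : Measurable (pnbT a R : H → H) := by
    unfold pnbT
    exact Measurable.ite (measurableSet_le (by fun_prop) (by fun_prop)) measurable_id measurable_const
  have hT1 : ∀ h : H, ‖pnbT a R h‖ ≤ ‖h‖ := fun h => by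
    unfold pnbT; split_ifs <;> simp
  have hT2 : ∀ h : H, a * ‖pnbT a R h‖ ≤ R := fun h => by
    unfold pnbT; split_ifs with h1
    · exact h1
    · simpa using hR.le
  have hap : ∀ r : ℝ, 0 < r → ∀ q : ℝ, r ≤ q → a ^ q ≤ a ^ r := fun r hr q hq =>
    Real.rpow_le_rpow_of_exponent_ge' ha ha1 hr.le hq
  have hTf : Measurable fun ω => pnbT a R (f ω) := hTm.comp hf
  have hone : ∀ y : ℝ, 0 ≤ y → y ^ 2 ≤ 1 + y ^ p := fun y hy => by
    by_cases h : y ≤ 1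
    · have : 0 ≤ y ^ p := by positivity
      nlinarith
    · push Not at h
      have : y ^ (2 : ℝ) ≤ y ^ p := Real.rpow_le_rpow_of_exponent_le h.le hp
      rw [Real.rpow_two] at this
      linarith
  have hf2 : Integrable (fun ω => ‖f ω‖ ^ 2) μ := by
    refine Integrable.mono' ((integrable_const 1).add hfp) (by fun_prop) ?_
    refine Filter.Eventually.of_forall fun ω => ?_
    rw [Real.norm_of_nonneg (by positivity)]
    exact hone _ (norm_nonneg _)
  have hf1 : Integrable f μ := by
    refine Integrable.mono' ((integrable_const 1).add hf2) hf.aestronglyMeasurable ?_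
    refine Filter.Eventually.of_forall fun ω => ?_
    simp only [Pi.add_apply]
    nlinarith [sq_nonneg (‖f ω‖ - 1)]
  have hTi : Integrable (fun ω => pnbT a R (f ω)) μ :=
    hf1.mono hTf.aestronglyMeasurable (Filter.Eventually.of_forall fun ω => hT1 _)
  have hTp : Integrable (fun ω => ‖pnbT a R (f ω)‖ ^ p) μ := by
    refine Integrable.mono' hfp (hTf.norm.pow_const _).aestronglyMeasurable (Filter.Eventually.of_forall fun ω => ?_)
    rw [Real.norm_of_nonneg (by positivity)]
    exact Real.rpow_le_rpow (norm_nonneg _) (hT1 _) (by linarith)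
  have hT2i : Integrable (fun ω => ‖pnbT a R (f ω)‖ ^ 2) μ := by
    refine Integrable.mono' hf2 (hTf.norm.pow_const _).aestronglyMeasurable (Filter.Eventually.of_forall fun ω => ?_)
    rw [Real.norm_of_nonneg (by positivity)]
    exact pow_le_pow_left₀ (norm_nonneg _) (hT1 _) 2
  set b := ∫ ω', pnbT a R (f ω') ∂μ with hb
  have hbn : ‖b‖ ≤ ∫ ω, ‖pnbT a R (f ω)‖ ∂μ := norm_integral_le_integral_norm _
  have hab : a * ‖b‖ ≤ R := by
    calc a * ‖b‖ ≤ a * ∫ ω, ‖pnbT a R (f ω)‖ ∂μ := by gcongr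
      _ = ∫ ω, a * ‖pnbT a R (f ω)‖ ∂μ := by rw [integral_const_mul]
      _ ≤ ∫ ω, R ∂μ := integral_mono (hTi.norm.const_mul _) (integrable_const _) fun ω => hT2 _
      _ = R := by simp
  have hbp : ‖b‖ ^ p ≤ ∫ ω, ‖f ω‖ ^ p ∂μ := by
    refine (Real.rpow_le_rpow (norm_nonneg _) hbn (by linarith)).trans ?_
    refine (pnb_jensen μ _ (fun ω => norm_nonneg _) p (by linarith) hTi.norm hTp).trans ?_
    exact integral_mono hTp hfp fun ω => Real.rpow_le_rpow (norm_nonneg _) (hT1 _) (by linarith)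
  have hpt : ∀ ω, ‖pnbT a R (f ω) - b‖ ^ p ≤ 2 ^ (p - 1) * (‖f ω‖ ^ p + ‖b‖ ^ p) := fun ω => by
    refine (Real.rpow_le_rpow (norm_nonneg _) ((norm_sub_le _ _).trans (add_le_add_left (hT1 _) _)) (by linarith)).trans ?_
    exact pnb_add_rpow p _ _ (by linarith) (norm_nonneg _) (norm_nonneg _)
  have hi2 : Integrable (fun ω => 2 ^ (p - 1) * (‖f ω‖ ^ p + ‖b‖ ^ p)) μ :=
    (hfp.add (integrable_const _)).const_mul _
  have hi1 : Integrable (fun ω => ‖pnbT a R (f ω) - b‖ ^ p) μ := by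
    refine Integrable.mono' hi2 ((hTf.sub measurable_const).norm.pow_const _).aestronglyMeasurable (Filter.Eventually.of_forall fun ω => ?_)
    rw [Real.norm_of_nonneg (by positivity)]
    exact hpt ω
  have hexp : ∀ ω, ‖pnbT a R (f ω) - b‖ ^ 2 = ‖pnbT a R (f ω)‖ ^ 2 - 2 * ⟪b, pnbT a R (f ω)⟫ + ‖b‖ ^ 2 := fun ω => by
    rw [norm_sub_sq_real, real_inner_comm]
  have hin : Integrable (fun ω => (⟪b, pnbT a R (f ω)⟫ : ℝ)) μ := hTi.const_inner b
  refine ⟨hTm, ?_, ?_, ?_, hi1, ?_, ?_, ?_, hTi⟩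
  · intro ω
    calc a * ‖pnbT a R (f ω) - b‖ ≤ a * (‖pnbT a R (f ω)‖ + ‖b‖) := by gcongr; exact norm_sub_le _ _
      _ ≤ 2 * R := by linarith [hT2 (f ω)]
  · simp only [hexp]
    exact (hT2i.sub (hin.const_mul 2)).add (integrable_const _)
  · simp only [hexp]
    have hs : Integrable (fun ω => ‖pnbT a R (f ω)‖ ^ 2 - 2 * ⟪b, pnbT a R (f ω)⟫) μ := hT2i.sub (hin.const_mul 2)
    rw [integral_add hs (integrable_const _), integral_sub hT2i (hin.const_mul 2),
      integral_const_mul, integral_inner hTi, ← hb, real_inner_self_eq_norm_sq]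
    have : ∫ ω, ‖pnbT a R (f ω)‖ ^ 2 ∂μ ≤ ∫ ω, ‖f ω‖ ^ 2 ∂μ :=
      integral_mono hT2i hf2 fun ω => pow_le_pow_left₀ (norm_nonneg _) (hT1 _) 2
    simp
    nlinarith [sq_nonneg ‖b‖]
  · refine (integral_mono hi1 hi2 hpt).trans ?_
    rw [integral_const_mul, integral_add hfp (integrable_const _)]
    simp only [integral_const, probReal_univ, one_smul]
    have : (2 : ℝ) ^ p = 2 ^ (p - 1) * 2 := by
      rw [← Real.rpow_add_one (by norm_num)]; congr 1; ring
    rw [this, mul_assoc]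
    gcongr
    linarith
  · have hb' : b = - ∫ ω, (f ω - pnbT a R (f ω)) ∂μ := by
      rw [integral_sub hf1 hTi, hc, hb]; simp
    rw [hb', norm_neg]
    refine (norm_integral_le_integral_norm _).trans ?_
    rw [mul_div_assoc, ← integral_div, ← integral_const_mul]
    refine integral_mono (hf1.sub hTi).norm ((hfp.div_const _).const_mul _) fun ω => ?_
    simp only
    unfold pnbT
    split_ifs with h
    · simp; positivity
    · push Not at h
      rw [sub_zero, ← mul_div_assoc, le_div_iff₀ (by positivity)]
      have hy : 0 < ‖f ω‖ := by
        by_contra h0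
        have : ‖f ω‖ = 0 := le_antisymm (not_lt.mp h0) (norm_nonneg _)
        rw [this] at h; simp at h; linarith
      calc ‖f ω‖ * R ^ (p - 1) ≤ ‖f ω‖ * (a * ‖f ω‖) ^ (p - 1) := by
            gcongr; linarith
        _ = a ^ (p - 1) * ‖f ω‖ ^ p := by
            rw [Real.mul_rpow ha hy.le, Real.rpow_sub_one hy.ne']; field_simp
        _ ≤ a * ‖f ω‖ ^ p := by
            gcongr
            simpa using hap 1 one_pos (p - 1) (by linarith)
  · have hm := mul_meas_ge_le_integral_of_nonneg (μ := μ) (f := fun ω => a ^ 2 * ‖f ω‖ ^ p)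
      (Filter.Eventually.of_forall fun ω => by simp only [Pi.zero_apply]; positivity) (hfp.const_mul _) (R ^ p)
    rw [integral_const_mul] at hm
    rw [le_div_iff₀ (by positivity), mul_comm]
    refine le_trans ?_ hm
    refine mul_le_mul_of_nonneg_left (measureReal_mono fun ω hω => ?_) (by positivity)
    simp only [Set.mem_ofPred_eq] at hω ⊢
    calc R ^ p ≤ (a * ‖f ω‖) ^ p := Real.rpow_le_rpow hR.le hω.le (by linarith)
      _ = a ^ p * ‖f ω‖ ^ p := Real.mul_rpow ha (norm_nonneg _)
      _ ≤ a ^ 2 * ‖f ω‖ ^ p := by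
          gcongr
          simpa using hap 2 two_pos p hp


noncomputable def pnbF (p : ℝ) (j : ℕ) : ℝ :=
  2 + (1 + 16 * (16 * 2 ^ p)) ^ (j + 1) + 256 ^ (j + 1) + 4 ^ (j + 1) + 256 ^ (j + 1)

lemma pnbF_pos (p : ℝ) (j : ℕ) : 0 < pnbF p j := by unfold pnbF; positivity

lemma pnb_K (p : ℝ) (j : ℕ) (σ y r R D δ t : ℝ) (hσ : 0 < σ) (hy : 0 < y) (hr : 1 ≤ r)
    (hD : 0 ≤ D) (hD1 : D ≤ 1) (hδ : 0 ≤ δ) (hδD : δ ^ (j + 1) = D) (hyD : 1 ≤ D * (y ^ 2) ^ (j + 1))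
    (hR : R = σ * y) (ht : t = σ ^ 2 * (r * y + y ^ 2 / 4)) :
    (σ ^ 2) ^ (2 * j + 2) + (σ ^ 2 * (r ^ 2 * σ ^ 2)) ^ (j + 1)
      + ((r ^ 2 * σ ^ 2 * R ^ 2 + 16 * 2 ^ p * R ^ 4) * δ) ^ (j + 1) + ((4 * R ^ 2) ^ (j + 1) * D) ^ 2
      + ((4 * R ^ 2) ^ (j + 1) * D) * (r ^ 2 * σ ^ 2) ^ (j + 1) + (16 * R ^ 4) ^ (j + 1) * D
      ≤ pnbF p j * D * t ^ (2 * j + 2) := by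
  have ht1 : σ ^ 2 * (r * y) ≤ t := by rw [ht]; gcongr; linarith [sq_nonneg y]
  have ht2 : R ^ 2 ≤ 4 * t := by
    rw [ht, hR]
    have : 0 ≤ σ ^ 2 * (r * y) := by positivity
    nlinarith
  have htp : 0 < t := by rw [ht]; positivity
  have hT : t ^ (2 * j + 2) = (t ^ 2) ^ (j + 1) := by rw [← pow_mul]; ring_nf
  have hS : (σ ^ 2) ^ (2 * j + 2) = (σ ^ 4) ^ (j + 1) := by rw [← pow_mul, ← pow_mul]; ring_nf
  have hT1 : r ^ 2 * σ ^ 4 * y ^ 2 ≤ t ^ 2 := by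
    have := pow_le_pow_left₀ (by positivity) ht1 2
    calc _ = (σ ^ 2 * (r * y)) ^ 2 := by ring
      _ ≤ _ := this
  have hT2 : R ^ 4 ≤ 16 * t ^ 2 := by
    have := pow_le_pow_left₀ (by positivity) ht2 2
    calc _ = (R ^ 2) ^ 2 := by ring
      _ ≤ _ := this
      _ = _ := by ring
  set T := t ^ 2 with hTd
  rw [hT, hS]
  have hr2 : 1 ≤ r ^ 2 := by nlinarith
  have k2 : (σ ^ 2 * (r ^ 2 * σ ^ 2)) ^ (j + 1) ≤ D * T ^ (j + 1) := by
    calc (σ ^ 2 * (r ^ 2 * σ ^ 2)) ^ (j + 1) = 1 * (r ^ 2 * σ ^ 4) ^ (j + 1) := by ring_nf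
      _ ≤ (D * (y ^ 2) ^ (j + 1)) * (r ^ 2 * σ ^ 4) ^ (j + 1) := by gcongr
      _ = D * (r ^ 2 * σ ^ 4 * y ^ 2) ^ (j + 1) := by rw [mul_assoc, ← mul_pow]; ring_nf
      _ ≤ _ := by gcongr
  have k1 : (σ ^ 4) ^ (j + 1) ≤ D * T ^ (j + 1) := by
    refine le_trans ?_ k2
    gcongr
    have : 0 < σ ^ 4 := by positivity
    nlinarith
  have k3 : ((r ^ 2 * σ ^ 2 * R ^ 2 + 16 * 2 ^ p * R ^ 4) * δ) ^ (j + 1) ≤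
      (1 + 16 * (16 * 2 ^ p)) ^ (j + 1) * (D * T ^ (j + 1)) := by
    have e : r ^ 2 * σ ^ 2 * R ^ 2 + 16 * 2 ^ p * R ^ 4 ≤ (1 + 16 * (16 * 2 ^ p)) * T := by
      have e1 : r ^ 2 * σ ^ 2 * R ^ 2 ≤ T := by
        rw [hR]; calc _ = r ^ 2 * σ ^ 4 * y ^ 2 := by ring
          _ ≤ _ := hT1
      have e2 : 16 * 2 ^ p * R ^ 4 ≤ 16 * 2 ^ p * (16 * T) := by gcongr
      linarith
    calc _ ≤ ((1 + 16 * (16 * 2 ^ p)) * T * δ) ^ (j + 1) := by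
          have : 0 ≤ R ^ 4 := by positivity
          gcongr
      _ = _ := by rw [mul_pow, mul_pow, hδD]; ring
  have hg : (16 * R ^ 4) ^ (j + 1) ≤ (256 * T) ^ (j + 1) :=
    pow_le_pow_left₀ (by positivity) (by linarith) _
  have k4 : ((4 * R ^ 2) ^ (j + 1) * D) ^ 2 ≤ 256 ^ (j + 1) * (D * T ^ (j + 1)) := by
    calc _ = (16 * R ^ 4) ^ (j + 1) * (D * D) := by
          rw [mul_pow, ← pow_mul, mul_comm (j + 1) 2, pow_mul]; ring_nf
      _ ≤ (256 * T) ^ (j + 1) * (D * 1) := by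
          refine mul_le_mul hg ?_ (by positivity) (by positivity)
          gcongr
      _ = _ := by rw [mul_pow]; ring
  have k5 : ((4 * R ^ 2) ^ (j + 1) * D) * (r ^ 2 * σ ^ 2) ^ (j + 1) ≤ 4 ^ (j + 1) * (D * T ^ (j + 1)) := by
    calc _ = (4 * (r ^ 2 * σ ^ 4 * y ^ 2)) ^ (j + 1) * D := by
          rw [mul_assoc, mul_comm D, ← mul_assoc, ← mul_pow, hR]; ring_nf
      _ ≤ (4 * T) ^ (j + 1) * D := by gcongr
      _ = _ := by rw [mul_pow]; ring
  have k6 : (16 * R ^ 4) ^ (j + 1) * D ≤ 256 ^ (j + 1) * (D * T ^ (j + 1)) := by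
    calc _ ≤ (256 * T) ^ (j + 1) * D := mul_le_mul_of_nonneg_right hg hD
      _ = _ := by rw [mul_pow]; ring
  have hf : pnbF p j * D * T ^ (j + 1) = D * T ^ (j + 1) + D * T ^ (j + 1) +
     (1 + 16 * (16 * 2 ^ p)) ^ (j + 1) * (D * T ^ (j + 1)) + 256 ^ (j + 1) * (D * T ^ (j + 1)) +
     4 ^ (j + 1) * (D * T ^ (j + 1)) + 256 ^ (j + 1) * (D * T ^ (j + 1)) := by
    unfold pnbF; ring
  rw [hf]
  linarith

lemma pnb_kappa (p : ℝ) (j : ℕ) (hp : 2 ≤ p) (hpj : p ≤ 2 * j + 2) (R D δ : ℝ) (hR : 0 < R)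
    (hδ : 0 < δ) (hδ1 : δ ≤ 1) (hδD : δ ^ (j + 1) = D) :
    ∃ κ : ℝ, 0 ≤ κ ∧ κ * (R ^ p * D) ≤ 16 * R ^ 4 * δ ∧ ∀ a y : ℝ, 0 ≤ a → a ≤ 1 → 0 ≤ y →
      a * y ≤ 2 * R → a ^ 4 * y ^ 4 ≤ a ^ 2 * (R ^ 2 * δ * y ^ 2 + κ * y ^ p) := by
  rcases le_total p 4 with h | h
  · refine ⟨(2 * R) ^ (4 - p), by positivity, ?_, ?_⟩
    · have h1 : (2 * R) ^ (4 - p) * R ^ p = 2 ^ (4 - p) * R ^ 4 := by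
        rw [Real.mul_rpow (by norm_num) hR.le, mul_assoc, ← Real.rpow_add hR, ← Real.rpow_natCast R 4]
        norm_num
      rw [← mul_assoc, h1]
      have h2 : (2 : ℝ) ^ (4 - p) ≤ 16 := by
        have : (2 : ℝ) ^ (4 - p) ≤ 2 ^ ((4 : ℕ) : ℝ) := Real.rpow_le_rpow_of_exponent_le (by norm_num) (by push_cast; linarith)
        rw [Real.rpow_natCast] at this
        linarith
      have h3 : D ≤ δ := by
        rw [← hδD]; exact pow_le_of_le_one hδ.le hδ1 (by omega)
      have h4 : 0 ≤ D := by rw [← hδD]; positivity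
      gcongr
    · intro a y ha ha1 hy hay
      have := pnb_num1 p a y (2 * R) 2 hp (by push_cast; linarith) ha ha1 hy (by positivity) hay
      rw [show ((2 : ℕ) : ℝ) + 2 - p = 4 - p by push_cast; ring] at this
      calc a ^ 4 * y ^ 4 = a ^ 2 * (a ^ 2 * y ^ (2 + 2)) := by ring
        _ ≤ a ^ 2 * ((2 * R) ^ (4 - p) * y ^ p) := by gcongr
        _ ≤ _ := by
          have : 0 ≤ R ^ 2 * δ * y ^ 2 := by positivity
          gcongr; linarith
  · refine ⟨(R ^ 2 * δ) ^ ((4 - p) / 2), by positivity, ?_, ?_⟩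
    · have e1 : (R ^ 2 * δ) ^ ((4 - p) / 2) * (R ^ p * D) = R ^ 4 * δ ^ ((4 - p) / 2 + (j + 1)) := by
        rw [← hδD, Real.mul_rpow (by positivity) hδ.le, ← Real.rpow_natCast R 2, ← Real.rpow_mul hR.le,
          ← Real.rpow_natCast δ, mul_mul_mul_comm, ← Real.rpow_add hR, ← Real.rpow_add hδ, ← Real.rpow_natCast R 4]
        congr 2
        · push_cast; ring
        · push_cast; ring
      rw [e1]
      have e2 : δ ^ ((4 - p) / 2 + (j + 1)) ≤ δ := by
        have := Real.rpow_le_rpow_of_exponent_ge hδ hδ1 (show (1 : ℝ) ≤ (4 - p) / 2 + (j + 1) by linarith)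
        simpa using this
      have : 0 ≤ R ^ 4 * δ := by positivity
      calc _ ≤ R ^ 4 * δ := by gcongr
        _ ≤ _ := by linarith
    · intro a y ha ha1 hy hay
      exact pnb_num2 p a y (R ^ 2 * δ) h ha ha1 hy (by positivity)


section
variable {H : Type*} [NormedAddCommGroup H] [InnerProductSpace ℝ H] [CompleteSpace H]
    [SecondCountableTopology H] [MeasurableSpace H] [BorelSpace H]
  {E : Type*} [NormedAddCommGroup E] [InnerProductSpace ℝ E] [FiniteDimensional ℝ E]
  [MeasurableSpace E] [BorelSpace E] {Ω : Type*} [MeasurableSpace Ω]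

set_option linter.unusedSectionVars false

/-- moment bounds for one summand -/
lemma pnb_moments (μ : Measure Ω) [IsProbabilityMeasure μ] (p : ℝ) (j : ℕ) (hp : 2 ≤ p)
    (hpj : p ≤ 2 * j + 2) (ξ : Ω → H) (A : H →L[ℝ] E) (hA : ‖A‖ ≤ 1) (c : E → H)
    (hAc : ∀ s h, ⟪s, A h⟫ = ⟪c s, h⟫) (R : ℝ) (hR : 0 < R) (hb : ∀ ω, ‖A‖ * ‖ξ ω‖ ≤ 2 * R)
    (S τ : ℝ) (hi2 : Integrable (fun ω => ‖ξ ω‖ ^ 2) μ) (h2 : ∫ ω, ‖ξ ω‖ ^ 2 ∂μ ≤ S)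
    (hip : Integrable (fun ω => ‖ξ ω‖ ^ p) μ) (hpm : ∫ ω, ‖ξ ω‖ ^ p ∂μ ≤ 2 ^ p * τ)
    (lam κ : ℝ) (hlam : 0 ≤ lam) (hκ : 0 ≤ κ) (hk : ∀ a y : ℝ, 0 ≤ a → a ≤ 1 → 0 ≤ y →
      a * y ≤ 2 * R → a ^ 4 * y ^ 4 ≤ a ^ 2 * (lam * y ^ 2 + κ * y ^ p)) :
    (∫ ω, ‖A (ξ ω)‖ ^ 2 ∂μ ≤ ‖A‖ ^ 2 * S) ∧
    (∀ s, ∫ ω, ⟪s, A (ξ ω)⟫ ^ 2 ∂μ ≤ ‖c s‖ ^ 2 * S) ∧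
    (∀ s, ∫ ω, ⟪s, A (ξ ω)⟫ ^ (2 * j + 2) ∂μ ≤
      ‖c s‖ ^ 2 * ((2 * R) ^ ((2 * j : ℕ) + 2 - p) * (2 ^ p * τ) * ‖s‖ ^ (2 * j))) ∧
    (∫ ω, ‖A (ξ ω)‖ ^ 4 ∂μ ≤ ‖A‖ ^ 2 * (lam * S + κ * (2 ^ p * τ))) ∧
    (∫ ω, ‖A (ξ ω)‖ ^ (4 * j + 4) ∂μ ≤ ‖A‖ ^ 2 * ((2 * R) ^ ((4 * j + 2 : ℕ) + 2 - p) * (2 ^ p * τ))) := by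
  have hA0 := norm_nonneg A
  have hAn : ∀ ω, ‖A (ξ ω)‖ ≤ ‖A‖ * ‖ξ ω‖ := fun ω => A.le_opNorm _
  have heven : ∀ (x : ℝ) (q : ℕ), 0 ≤ x ^ (2 * q) := fun x q => by rw [pow_mul]; positivity
  have hcn : ∀ s ω, (⟪s, A (ξ ω)⟫ : ℝ) ^ 2 ≤ ‖c s‖ ^ 2 * ‖ξ ω‖ ^ 2 := fun s ω => by
    rw [hAc, ← mul_pow, sq_le_sq, abs_of_nonneg (by positivity : 0 ≤ ‖c s‖ * ‖ξ ω‖)]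
    exact abs_real_inner_le_norm _ _
  refine ⟨?_, fun s => ?_, fun s => ?_, ?_, ?_⟩
  · calc _ ≤ ∫ ω, ‖A‖ ^ 2 * ‖ξ ω‖ ^ 2 ∂μ := by
          refine integral_mono_of_nonneg (Filter.Eventually.of_forall fun ω => by simp only [Pi.zero_apply]; positivity)
            (hi2.const_mul _) (Filter.Eventually.of_forall fun ω => ?_)
          simp only
          rw [← mul_pow]
          exact pow_le_pow_left₀ (norm_nonneg _) (hAn ω) 2
      _ ≤ _ := by rw [integral_const_mul]; gcongr
  · calc _ ≤ ∫ ω, ‖c s‖ ^ 2 * ‖ξ ω‖ ^ 2 ∂μ := by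
          refine integral_mono_of_nonneg (Filter.Eventually.of_forall fun ω => by simp only [Pi.zero_apply]; positivity)
            (hi2.const_mul _) (Filter.Eventually.of_forall fun ω => hcn s ω)
      _ ≤ _ := by rw [integral_const_mul]; gcongr
  · calc _ ≤ ∫ ω, (‖c s‖ ^ 2 * ((2 * R) ^ ((2 * j : ℕ) + 2 - p) * ‖s‖ ^ (2 * j))) * ‖ξ ω‖ ^ p ∂μ := by
          refine integral_mono_of_nonneg (Filter.Eventually.of_forall fun ω => by
              simp only [Pi.zero_apply]; exact heven _ (j + 1))
            (hip.const_mul _) (Filter.Eventually.of_forall fun ω => ?_)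
          simp only
          have h1 := pnb_num1 p ‖A‖ ‖ξ ω‖ (2 * R) (2 * j) hp (by push_cast; linarith) hA0 hA (norm_nonneg _)
            (by positivity) (hb ω)
          have h3 : (⟪s, A (ξ ω)⟫ : ℝ) ^ (2 * j) ≤ (‖s‖ * (‖A‖ * ‖ξ ω‖)) ^ (2 * j) := by
            rw [← (even_two_mul j).pow_abs]
            refine pow_le_pow_left₀ (abs_nonneg _) ((abs_real_inner_le_norm _ _).trans ?_) _
            gcongr; exact hAn ω
          calc (⟪s, A (ξ ω)⟫ : ℝ) ^ (2 * j + 2) = ⟪s, A (ξ ω)⟫ ^ 2 * ⟪s, A (ξ ω)⟫ ^ (2 * j) := by ring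
            _ ≤ (‖c s‖ ^ 2 * ‖ξ ω‖ ^ 2) * (‖s‖ * (‖A‖ * ‖ξ ω‖)) ^ (2 * j) :=
                mul_le_mul (hcn s ω) h3 (heven _ _) (by positivity)
            _ = ‖c s‖ ^ 2 * ‖s‖ ^ (2 * j) * (‖A‖ ^ (2 * j) * ‖ξ ω‖ ^ (2 * j + 2)) := by
                rw [mul_pow, mul_pow]; ring
            _ ≤ ‖c s‖ ^ 2 * ‖s‖ ^ (2 * j) * ((2 * R) ^ ((2 * j : ℕ) + 2 - p) * ‖ξ ω‖ ^ p) := by gcongr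
            _ = _ := by ring
      _ = ‖c s‖ ^ 2 * ((2 * R) ^ ((2 * j : ℕ) + 2 - p) * (∫ ω, ‖ξ ω‖ ^ p ∂μ) * ‖s‖ ^ (2 * j)) := by
          rw [integral_const_mul]; ring
      _ ≤ _ := by gcongr
  · calc _ ≤ ∫ ω, ‖A‖ ^ 2 * (lam * ‖ξ ω‖ ^ 2 + κ * ‖ξ ω‖ ^ p) ∂μ := by
          refine integral_mono_of_nonneg (Filter.Eventually.of_forall fun ω => by simp only [Pi.zero_apply]; positivity)
            (((hi2.const_mul _).add (hip.const_mul _)).const_mul _) (Filter.Eventually.of_forall fun ω => ?_)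
          simp only
          refine (pow_le_pow_left₀ (norm_nonneg _) (hAn ω) 4).trans ?_
          rw [mul_pow]
          exact hk _ _ hA0 hA (norm_nonneg _) (hb ω)
      _ ≤ _ := by
          rw [integral_const_mul, integral_add (hi2.const_mul _) (hip.const_mul _), integral_const_mul,
            integral_const_mul]
          gcongr
  · calc _ ≤ ∫ ω, ‖A‖ ^ 2 * ((2 * R) ^ ((4 * j + 2 : ℕ) + 2 - p)) * ‖ξ ω‖ ^ p ∂μ := by
          refine integral_mono_of_nonneg (Filter.Eventually.of_forall fun ω => by
              simp only [Pi.zero_apply]; positivity)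
            (hip.const_mul _) (Filter.Eventually.of_forall fun ω => ?_)
          simp only
          have h1 := pnb_num1 p ‖A‖ ‖ξ ω‖ (2 * R) (4 * j + 2) hp (by push_cast; linarith) hA0 hA (norm_nonneg _)
            (by positivity) (hb ω)
          calc ‖A (ξ ω)‖ ^ (4 * j + 4) ≤ (‖A‖ * ‖ξ ω‖) ^ (4 * j + 4) :=
                pow_le_pow_left₀ (norm_nonneg _) (hAn ω) _
            _ = ‖A‖ ^ 2 * (‖A‖ ^ (4 * j + 2) * ‖ξ ω‖ ^ (4 * j + 2 + 2)) := by
                rw [mul_pow]; ring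
            _ ≤ ‖A‖ ^ 2 * ((2 * R) ^ ((4 * j + 2 : ℕ) + 2 - p) * ‖ξ ω‖ ^ p) := by gcongr
            _ = _ := by ring
      _ = ‖A‖ ^ 2 * ((2 * R) ^ ((4 * j + 2 : ℕ) + 2 - p) * (∫ ω, ‖ξ ω‖ ^ p ∂μ)) := by
          rw [integral_const_mul]; ring
      _ ≤ _ := by gcongr

end


section
variable {H : Type*} [NormedAddCommGroup H] [InnerProductSpace ℝ H] [CompleteSpace H]
    [SecondCountableTopology H] [MeasurableSpace H] [BorelSpace H]
  {E : Type*} [NormedAddCommGroup E] [InnerProductSpace ℝ E] [FiniteDimensional ℝ E]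
  [MeasurableSpace E] [BorelSpace E] {Ω : Type*} [MeasurableSpace Ω]

lemma pnb_rpow_split (p R D τ M : ℝ) (q : ℕ) (hR : 0 < R) (hM : M * τ = D * R ^ p) :
    M * ((2 * R) ^ ((q : ℝ) + 2 - p) * (2 ^ p * τ)) = (2 * R) ^ (q + 2) * D := by
  have h1 : (2 * R) ^ (q + 2) = (2 * R) ^ ((q : ℝ) + 2 - p) * (2 * R) ^ p := by
    rw [← Real.rpow_add (by positivity), ← Real.rpow_natCast]
    congr 1; push_cast; ring
  rw [h1, Real.mul_rpow (z := p) (by norm_num) hR.le]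
  calc _ = (2 * R) ^ ((q : ℝ) + 2 - p) * 2 ^ p * (M * τ) := by ring
    _ = _ := by rw [hM]; ring

set_option maxHeartbeats 1000000 in
lemma pnb_main (μ : Measure Ω) [IsProbabilityMeasure μ] (p : ℝ) (j n : ℕ) (hp : 2 ≤ p)
    (hpj : p ≤ 2 * j + 2) (ε : Fin n → Ω → H) (hm : ∀ i, Measurable (ε i)) (hind : iIndepFun ε μ)
    (hc : ∀ i, ∫ ω, ε i ω ∂μ = 0) (hip : ∀ i, Integrable (fun ω => ‖ε i ω‖ ^ p) μ)
    (σ τ : ℝ) (hσ : 0 < σ) (h2m : ∀ i, ∫ ω, ‖ε i ω‖ ^ 2 ∂μ = σ ^ 2)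
    (hpm : ∀ i, ∫ ω, ‖ε i ω‖ ^ p ∂μ = τ) (hτσ : σ ^ p ≤ τ) (A : Fin n → H →L[ℝ] E)
    (c : Fin n → E → H) (hAc : ∀ i s h, ⟪s, A i h⟫ = ⟪c i s, h⟫) (hA1 : ∀ i, ‖A i‖ ≤ 1)
    (r : ℝ) (hr : 1 ≤ r) (hAM : ∑ i, ‖A i‖ ^ 2 ≤ r ^ 2) (hcs : ∀ s, ∑ i, ‖c i s‖ ^ 2 ≤ ‖s‖ ^ 2)
    (y : ℝ) (hy : 0 < y) :
    μ.real {ω | (σ * (r + y)) ^ 2 ≤ ‖∑ i, A i (ε i ω)‖ ^ 2} ≤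
      (4 + (1 + 3 * pnbD j * pnbF p j)) * (r ^ 2 * τ / (σ * y) ^ p) := by
  have hD0 := pnbD_pos j
  have hF0 := pnbF_pos p j
  have hτ : 0 < τ := lt_of_lt_of_le (by positivity) hτσ
  set R := σ * y with hR
  have hR0 : 0 < R := by positivity
  set D := r ^ 2 * τ / R ^ p with hD
  have hDp : 0 < D := by positivity
  have hMτ : r ^ 2 * τ = D * R ^ p := by rw [hD]; field_simp
  by_cases hD4 : 1 / 4 < D
  · calc _ ≤ (1 : ℝ) := measureReal_le_one
      _ ≤ 4 * D := by linarith
      _ ≤ _ := by gcongr; linarith [mul_pos (mul_pos three_pos hD0) hF0]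
  push Not at hD4
  set δ := D ^ (1 / ((j : ℝ) + 1)) with hδ
  have hδ0 : 0 < δ := by positivity
  have hδ1 : δ ≤ 1 := Real.rpow_le_one hDp.le (by linarith) (by positivity)
  have hδD : δ ^ (j + 1) = D := by
    rw [hδ, ← Real.rpow_natCast, ← Real.rpow_mul hDp.le]
    push_cast
    rw [one_div_mul_cancel (by positivity), Real.rpow_one]
  have hr2 : 1 ≤ r ^ 2 := by nlinarith
  have hyp : 1 ≤ D * y ^ p := by
    have : σ ^ p ≤ D * y ^ p * σ ^ p := by
      calc σ ^ p ≤ τ := hτσ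
        _ ≤ r ^ 2 * τ := by nlinarith
        _ = _ := by rw [hMτ, hR, Real.mul_rpow hσ.le hy.le]; ring
    have h0 : 0 < σ ^ p := by positivity
    by_contra h
    push Not at h
    nlinarith
  have hy1 : 1 ≤ y := by
    by_contra h
    push Not at h
    have : y ^ p ≤ 1 := Real.rpow_le_one hy.le h.le (by linarith)
    nlinarith
  have hyD : 1 ≤ D * (y ^ 2) ^ (j + 1) := by
    refine hyp.trans ?_
    gcongr
    rw [← pow_mul, ← Real.rpow_natCast]
    exact Real.rpow_le_rpow_of_exponent_le hy1 (by push_cast; linarith)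
  obtain ⟨κ, hκ0, hκ, hk⟩ := pnb_kappa p j hp hpj R D δ hR0 hδ0 hδ1 hδD
  have htr := fun i => pnb_trunc μ (ε i) (hm i) p ‖A i‖ R hp (norm_nonneg _) (hA1 i) hR0 (hip i) (hc i)
  choose hTm hTb hTi2 hT2 hTip hTp hTbn hTP hTi using htr
  set b : Fin n → H := fun i => ∫ ω', pnbT ‖A i‖ R (ε i ω') ∂μ with hb
  set ξ : Fin n → Ω → H := fun i ω => pnbT ‖A i‖ R (ε i ω) - b i with hξ
  have hmom := fun i => pnb_moments μ p j hp hpj (ξ i) (A i) (hA1 i) (c i) (hAc i) R hR0 (hTb i)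
    (σ ^ 2) τ (hTi2 i) ((hT2 i).trans_eq (h2m i)) (hTip i) ((hTp i).trans_eq (by rw [hpm i]))
    (R ^ 2 * δ) κ (by positivity) hκ0 hk
  choose M1 M2 M3 M4 M5 using hmom
  set t := σ ^ 2 * (r * y + y ^ 2 / 4) with ht
  have ht0 : 0 < t := by positivity
  have hcore := pnb_core2 j n μ (fun i ω => A i (ξ i ω))
    (fun i => (A i).measurable.comp (((hTm i).comp (hm i)).sub_const _))
    (hind.comp (fun i h => A i (pnbT ‖A i‖ R h - b i))
      (fun i => (A i).measurable.comp ((hTm i).sub_const _)))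
    (2 * R) (by positivity) (fun i ω => ((A i).le_opNorm _).trans (hTb i ω))
    (fun i => by
      have hs : Integrable (ξ i) μ := (hTi i).sub (integrable_const _)
      rw [(A i).integral_comp_comm hs]
      have : ∫ ω, ξ i ω ∂μ = 0 := by
        simp only [hξ]
        rw [integral_sub (hTi i) (integrable_const _)]
        simp [hb]
      rw [this, map_zero])
    (σ ^ 2) ((r ^ 2 * σ ^ 2 * R ^ 2 + 16 * 2 ^ p * R ^ 4) * δ) ((4 * R ^ 2) ^ (j + 1) * D)
    ((16 * R ^ 4) ^ (j + 1) * D) (r ^ 2 * σ ^ 2) t (by positivity) (by positivity) (by positivity)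
    (by positivity) ht0
    (by
      calc _ ≤ ∑ i, ‖A i‖ ^ 2 * σ ^ 2 := Finset.sum_le_sum fun i _ => M1 i
        _ ≤ _ := by rw [← Finset.sum_mul]; gcongr)
    (fun s => by
      calc _ ≤ ∑ i, ‖c i s‖ ^ 2 * σ ^ 2 := Finset.sum_le_sum fun i _ => M2 i s
        _ ≤ ‖s‖ ^ 2 * σ ^ 2 := by rw [← Finset.sum_mul]; gcongr; exact hcs s
        _ = _ := by ring)
    (fun s => by
      have h1 := pnb_rpow_split p R D τ (r ^ 2) (2 * j) hR0 hMτ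
      have h2 : (2 * R) ^ (2 * j + 2) = (4 * R ^ 2) ^ (j + 1) := by
        rw [show 2 * j + 2 = 2 * (j + 1) by ring, pow_mul]; ring
      have h3 : (2 * R) ^ ((2 * j : ℕ) + 2 - p) * (2 ^ p * τ) ≤ (4 * R ^ 2) ^ (j + 1) * D := by
        rw [← h2, ← h1]
        exact le_mul_of_one_le_left (by positivity) hr2
      calc _ ≤ ∑ i, ‖c i s‖ ^ 2 * ((2 * R) ^ ((2 * j : ℕ) + 2 - p) * (2 ^ p * τ) * ‖s‖ ^ (2 * j)) :=
            Finset.sum_le_sum fun i _ => M3 i s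
        _ ≤ ‖s‖ ^ 2 * ((4 * R ^ 2) ^ (j + 1) * D * ‖s‖ ^ (2 * j)) := by
            rw [← Finset.sum_mul]
            refine mul_le_mul (hcs s) ?_ (by positivity) (by positivity)
            exact mul_le_mul_of_nonneg_right h3 (by positivity)
        _ = _ := by ring)
    (by
      calc _ ≤ ∑ i, ‖A i‖ ^ 2 * (R ^ 2 * δ * σ ^ 2 + κ * (2 ^ p * τ)) := Finset.sum_le_sum fun i _ => M4 i
        _ ≤ r ^ 2 * (R ^ 2 * δ * σ ^ 2 + κ * (2 ^ p * τ)) := by rw [← Finset.sum_mul]; gcongr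
        _ = r ^ 2 * σ ^ 2 * R ^ 2 * δ + 2 ^ p * (κ * (r ^ 2 * τ)) := by ring
        _ = r ^ 2 * σ ^ 2 * R ^ 2 * δ + 2 ^ p * (κ * (R ^ p * D)) := by rw [hMτ, mul_comm D]
        _ ≤ r ^ 2 * σ ^ 2 * R ^ 2 * δ + 2 ^ p * (16 * R ^ 4 * δ) := by gcongr
        _ = _ := by ring)
    (by
      have h1 := pnb_rpow_split p R D τ (r ^ 2) (4 * j + 2) hR0 hMτ
      have h2 : (2 * R) ^ (4 * j + 2 + 2) = (16 * R ^ 4) ^ (j + 1) := by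
        rw [show 4 * j + 2 + 2 = 4 * (j + 1) by ring, pow_mul]; ring
      calc _ ≤ ∑ i, ‖A i‖ ^ 2 * ((2 * R) ^ ((4 * j + 2 : ℕ) + 2 - p) * (2 ^ p * τ)) :=
            Finset.sum_le_sum fun i _ => M5 i
        _ ≤ r ^ 2 * ((2 * R) ^ ((4 * j + 2 : ℕ) + 2 - p) * (2 ^ p * τ)) := by
            rw [← Finset.sum_mul]
            exact mul_le_mul_of_nonneg_right hAM (by positivity)
        _ = _ := by rw [h1, h2])
  have hK := pnb_K p j σ y r R D δ t hσ hy hr hDp.le (by linarith) hδ0.le hδD hyD hR ht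
  have hP1 : μ.real {ω | r ^ 2 * σ ^ 2 + t ≤ ‖∑ i, A i (ξ i ω)‖ ^ 2} ≤ 3 * pnbD j * pnbF p j * D := by
    have htk : 0 < t ^ (2 * j + 2) := by positivity
    refine le_of_mul_le_mul_right ?_ htk
    refine hcore.trans ?_
    calc _ ≤ 3 * pnbD j * (pnbF p j * D * t ^ (2 * j + 2)) := by gcongr
      _ = _ := by ring
  have hP2 : μ.real (⋃ i, {ω | R < ‖A i‖ * ‖ε i ω‖}) ≤ D := by
    refine (measureReal_iUnion_fintype_le _).trans ?_
    calc _ ≤ ∑ i, ‖A i‖ ^ 2 * (τ / R ^ p) := Finset.sum_le_sum fun i _ => by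
            have := hTP i
            rwa [hpm i, mul_div_assoc] at this
      _ ≤ r ^ 2 * (τ / R ^ p) := by rw [← Finset.sum_mul]; gcongr
      _ = D := by rw [hD]; ring
  have hβ : ‖∑ i, A i (b i)‖ ≤ R / 4 := by
    calc _ ≤ ∑ i, ‖A i‖ ^ 2 * (τ / R ^ (p - 1)) := by
          refine norm_sum_le_of_le _ fun i _ => ((A i).le_opNorm _).trans ?_
          have := hTbn i
          rw [hpm i, mul_div_assoc] at this
          calc _ ≤ ‖A i‖ * (‖A i‖ * (τ / R ^ (p - 1))) := by gcongr
            _ = _ := by ring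
      _ ≤ r ^ 2 * (τ / R ^ (p - 1)) := by rw [← Finset.sum_mul]; gcongr
      _ = R * D := by
          rw [hD, Real.rpow_sub_one hR0.ne']; field_simp
      _ ≤ R / 4 := by nlinarith only [hD4, hR0]
  have hsub : {ω | (σ * (r + y)) ^ 2 ≤ ‖∑ i, A i (ε i ω)‖ ^ 2} ⊆
      (⋃ i, {ω | R < ‖A i‖ * ‖ε i ω‖}) ∪ {ω | r ^ 2 * σ ^ 2 + t ≤ ‖∑ i, A i (ξ i ω)‖ ^ 2} := by
    intro ω hω
    by_cases hu : ω ∈ ⋃ i, {ω | R < ‖A i‖ * ‖ε i ω‖}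
    · exact Or.inl hu
    right
    simp only [Set.mem_iUnion, Set.mem_ofPred_eq, not_exists, not_lt] at hu hω ⊢
    have he : ∑ i, A i (ε i ω) = ∑ i, A i (ξ i ω) + ∑ i, A i (b i) := by
      rw [← Finset.sum_add_distrib]
      refine Finset.sum_congr rfl fun i _ => ?_
      rw [← map_add]
      simp only [hξ, sub_add_cancel]
      unfold pnbT
      rw [if_pos (hu i)]
    have h1 : σ * (r + y) ≤ ‖∑ i, A i (ε i ω)‖ := by
      exact le_of_sq_le_sq hω (norm_nonneg _)
    rw [he] at h1
    have h2 : σ * (r + 3 / 4 * y) ≤ ‖∑ i, A i (ξ i ω)‖ := by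
      have := norm_add_le (∑ i, A i (ξ i ω)) (∑ i, A i (b i))
      rw [hR] at hβ
      linarith
    refine le_trans ?_ (pow_le_pow_left₀ (by positivity) h2 2)
    rw [ht]
    have q1 : 0 ≤ σ ^ 2 * (r * y) := by positivity
    have q2 : 0 ≤ σ ^ 2 * y ^ 2 := by positivity
    have q3 : (σ * (r + 3 / 4 * y)) ^ 2 = r ^ 2 * σ ^ 2 + σ ^ 2 * (r * y + y ^ 2 / 4) +
      (1 / 2 * (σ ^ 2 * (r * y)) + 5 / 16 * (σ ^ 2 * y ^ 2)) := by ring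
    rw [q3]
    linarith only [q1, q2]
  calc _ ≤ μ.real ((⋃ i, {ω | R < ‖A i‖ * ‖ε i ω‖}) ∪ {ω | r ^ 2 * σ ^ 2 + t ≤ ‖∑ i, A i (ξ i ω)‖ ^ 2}) :=
        measureReal_mono hsub
    _ ≤ D + 3 * pnbD j * pnbF p j * D := (measureReal_union_le _ _).trans (add_le_add hP2 hP1)
    _ ≤ _ := by
        rw [add_mul 4, add_mul 1, one_mul]
        linarith only [hDp]

end


lemma pnb_opnorm_sum {H E : Type*} [NormedAddCommGroup H] [InnerProductSpace ℝ H] [CompleteSpace H]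
    [NormedAddCommGroup E] [InnerProductSpace ℝ E] [FiniteDimensional ℝ E] (n : ℕ)
    (A : Fin n → H →L[ℝ] E) (c : Fin n → E → H) (hAc : ∀ i s h, ⟪s, A i h⟫ = ⟪c i s, h⟫)
    (hcs : ∀ s, ∑ i, ‖c i s‖ ^ 2 ≤ ‖s‖ ^ 2) :
    (∀ i, ‖A i‖ ≤ 1) ∧ ∑ i, ‖A i‖ ^ 2 ≤ Module.finrank ℝ E := by
  have hle : ∀ i s, ‖c i s‖ ≤ ‖s‖ := fun i s => by
    refine le_of_sq_le_sq ?_ (norm_nonneg _)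
    exact (Finset.single_le_sum (f := fun i => ‖c i s‖ ^ 2) (fun i _ => by positivity)
      (Finset.mem_univ i)).trans (hcs s)
  set e := stdOrthonormalBasis ℝ E with he
  have hb : ∀ i, ‖A i‖ ^ 2 ≤ ∑ k, ‖c i (e k)‖ ^ 2 := fun i => by
    have h0 : 0 ≤ ∑ k, ‖c i (e k)‖ ^ 2 := Finset.sum_nonneg fun k _ => by positivity
    have : ‖A i‖ ≤ √(∑ k, ‖c i (e k)‖ ^ 2) := by
      refine ContinuousLinearMap.opNorm_le_bound _ (Real.sqrt_nonneg _) fun h => ?_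
      refine le_of_sq_le_sq ?_ (by positivity)
      rw [mul_pow, Real.sq_sqrt h0, ← e.sum_sq_norm_inner_right (A i h), Finset.sum_mul]
      refine Finset.sum_le_sum fun k _ => ?_
      rw [hAc, ← mul_pow]
      exact pow_le_pow_left₀ (norm_nonneg _) (norm_inner_le_norm _ _) 2
    calc _ ≤ _ := pow_le_pow_left₀ (norm_nonneg _) this 2
      _ = _ := Real.sq_sqrt h0
  constructor
  · intro i
    refine ContinuousLinearMap.opNorm_le_bound _ zero_le_one fun h => ?_
    have h1 : ‖A i h‖ * ‖A i h‖ ≤ ‖A i h‖ * ‖h‖ := by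
      rw [← real_inner_self_eq_norm_mul_norm, hAc]
      refine (real_inner_le_norm _ _).trans ?_
      gcongr
      exact hle _ _
    rw [one_mul]
    rcases (norm_nonneg (A i h)).eq_or_lt with h0 | h0
    · rw [← h0]; positivity
    · exact le_of_mul_le_mul_left h1 h0
  · calc _ ≤ ∑ i, ∑ k, ‖c i (e k)‖ ^ 2 := Finset.sum_le_sum fun i _ => hb i
      _ = ∑ k, ∑ i, ‖c i (e k)‖ ^ 2 := Finset.sum_comm
      _ ≤ ∑ k, ‖e k‖ ^ 2 := Finset.sum_le_sum fun k _ => hcs _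
      _ = _ := by simp

/-- Moment bound for the squared norm of the projection of the noise
vector `ε̄ = (ε_1, …, ε_n) ∈ H^n` onto a linear subspace `L` of dimension at most `m`:
there is a constant `C` depending only on `p ≥ 2` such that for all `x > 0`,
`P(ζ²(ε̄) ≥ mσ² + 2σ²√(mx) + σ²x) ≤ C m τ_p σ^{−p} x^{−p/2}`,
where `ζ(s) = ‖Π_L s‖`, `σ² = E‖ε_1‖²` and `τ_p = E‖ε_1‖^p`. -/
theorem projection_noise_moment_bound :
    ∀ (p : ℝ), 2 ≤ p →
    ∃ C : ℝ, 0 < C ∧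
      ∀ (H : Type u) [NormedAddCommGroup H] [InnerProductSpace ℝ H] [CompleteSpace H]
        [SecondCountableTopology H] [MeasurableSpace H] [BorelSpace H]
        (Ω : Type v) [MeasurableSpace Ω] (μ : Measure Ω) [IsProbabilityMeasure μ]
        (n : ℕ), 1 ≤ n →
      ∀ (ε : Fin n → Ω → H) (ε₀ : Ω → H),
        (∀ i, Measurable (ε i)) → Measurable ε₀ →
        iIndepFun ε μ →
        (∀ i, IdentDistrib (ε i) ε₀ μ μ) →
        (∫ ω, ε₀ ω ∂μ) = 0 →
        Integrable (fun ω => ‖ε₀ ω‖ ^ p) μ →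
      ∀ (σsq τp : ℝ), σsq = ∫ ω, ‖ε₀ ω‖ ^ 2 ∂μ → 0 < σsq →
        τp = ∫ ω, ‖ε₀ ω‖ ^ p ∂μ →
      ∀ (m : ℕ), 1 ≤ m →
      ∀ (L : Submodule ℝ (PiLp 2 fun _ : Fin n => H)) [FiniteDimensional ℝ L],
        Module.finrank ℝ L ≤ m →
      ∀ x : ℝ, 0 < x →
        μ {ω | (m : ℝ) * σsq + 2 * σsq * Real.sqrt (m * x) + σsq * x ≤
            ‖(Submodule.orthogonalProjection L
                ((WithLp.equiv 2 (∀ _ : Fin n, H)).symm fun i => ε i ω) : PiLp 2 fun _ : Fin n => H)‖ ^ 2} ≤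
          ENNReal.ofReal (C * m * τp * Real.sqrt σsq ^ (-p) * x ^ (-(p / 2))) := by
  intro p hp
  obtain ⟨j, hj⟩ := exists_nat_ge p
  have hj0 : (0 : ℝ) ≤ j := Nat.cast_nonneg j
  have hDp := pnbD_pos j
  have hFp := pnbF_pos p j
  refine ⟨4 + (1 + 3 * pnbD j * pnbF p j), by positivity, ?_⟩
  intro H _ _ _ _ _ _ Ω _ μ _ n hn ε ε₀ hm hm0 hind hid hc hip σsq τ hσ hσ0 hτ m hm1 L _ hL x hx
  let iL : MeasurableSpace ↥L := borel ↥L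
  have iB : BorelSpace ↥L := ⟨rfl⟩
  set σ := √σsq with hσd
  have hσp : 0 < σ := Real.sqrt_pos.mpr hσ0
  have hσ2 : σ ^ 2 = σsq := Real.sq_sqrt hσ0.le
  set r := √(m : ℝ) with hr
  have hm1' : (1 : ℝ) ≤ m := by exact_mod_cast hm1
  have hr2 : r ^ 2 = m := Real.sq_sqrt (by positivity)
  have hr1 : 1 ≤ r := Real.one_le_sqrt.mpr hm1'
  set y := √x with hy
  have hyp : 0 < y := Real.sqrt_pos.mpr hx
  have hy2 : y ^ 2 = x := Real.sq_sqrt hx.le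
  let c : Fin n → L →L[ℝ] H := fun i => (PiLp.proj 2 (fun _ : Fin n => H) i).comp L.subtypeL
  let A : Fin n → H →L[ℝ] L := fun i => ContinuousLinearMap.adjoint (c i)
  have hAc : ∀ i s h, (⟪s, A i h⟫ : ℝ) = ⟪c i s, h⟫ := fun i s h =>
    ContinuousLinearMap.adjoint_inner_right (c i) s h
  have hcs : ∀ s, ∑ i, ‖c i s‖ ^ 2 ≤ ‖s‖ ^ 2 := fun s => by
    rw [Submodule.coe_norm s, PiLp.norm_sq_eq_of_L2]
    exact le_rfl
  obtain ⟨hA1, hA2⟩ := pnb_opnorm_sum n A (fun i s => c i s) hAc hcs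
  have hproj : ∀ v : PiLp 2 fun _ : Fin n => H, L.orthogonalProjectionOnto v = ∑ i, A i (v i) := fun v => by
    refine ext_inner_left ℝ fun s => ?_
    rw [inner_sum]
    simp only [hAc]
    rw [Submodule.inner_orthogonalProjectionOnto_eq_of_mem_left, PiLp.inner_apply]
    rfl
  have hp2 : ∀ i, IdentDistrib (fun ω => ‖ε i ω‖ ^ p) (fun ω => ‖ε₀ ω‖ ^ p) μ μ := fun i =>
    (hid i).comp (u := fun h : H => ‖h‖ ^ p) (by fun_prop)
  have h22 : ∀ i, IdentDistrib (fun ω => ‖ε i ω‖ ^ 2) (fun ω => ‖ε₀ ω‖ ^ 2) μ μ := fun i =>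
    (hid i).comp (u := fun h : H => ‖h‖ ^ 2) (by fun_prop)
  have hi2 : Integrable (fun ω => ‖ε₀ ω‖ ^ 2) μ := by
    by_contra h
    rw [integral_undef h] at hσ
    linarith
  have hpe : ∀ ω, (‖ε₀ ω‖ ^ 2) ^ (p / 2) = ‖ε₀ ω‖ ^ p := fun ω => by
    rw [← Real.rpow_natCast, ← Real.rpow_mul (norm_nonneg _)]
    congr 1; push_cast; ring
  have hτσ : σ ^ p ≤ τ := by
    have := pnb_jensen μ (fun ω => ‖ε₀ ω‖ ^ 2) (fun ω => by positivity) (p / 2) (by linarith) hi2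
      (by simpa only [hpe] using hip)
    simp only [hpe] at this
    rw [← hσ, ← hτ, ← hσ2, ← Real.rpow_natCast, ← Real.rpow_mul hσp.le] at this
    convert this using 2
    push_cast; ring
  have hmain := pnb_main μ p j n hp (by linarith) ε hm hind
    (fun i => by rw [(hid i).integral_eq, hc]) (fun i => (hp2 i).integrable_iff.mpr hip) σ τ hσp
    (fun i => by rw [(h22 i).integral_eq, ← hσ, hσ2]) (fun i => by rw [(hp2 i).integral_eq, ← hτ])
    hτσ A (fun i s => c i s) hAc hA1 r hr1 (hA2.trans (by rw [hr2]; exact_mod_cast hL)) hcs y hyp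
  have hset : {ω | (m : ℝ) * σsq + 2 * σsq * Real.sqrt (m * x) + σsq * x ≤
            ‖(Submodule.orthogonalProjection L
                ((WithLp.equiv 2 (∀ _ : Fin n, H)).symm fun i => ε i ω) : PiLp 2 fun _ : Fin n => H)‖ ^ 2} =
      {ω | (σ * (r + y)) ^ 2 ≤ ‖∑ i, A i (ε i ω)‖ ^ 2} := by
    ext ω
    have e1 : (m : ℝ) * σsq + 2 * σsq * Real.sqrt (m * x) + σsq * x = (σ * (r + y)) ^ 2 := by
      rw [Real.sqrt_mul (by positivity), ← hr, ← hy, ← hσ2, ← hr2, ← hy2]; ring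
    simp only [Set.mem_ofPred_eq]
    rw [e1, ← Submodule.coe_norm, hproj]
    rfl
  rw [hset, ← ofReal_measureReal]
  refine ENNReal.ofReal_le_ofReal (hmain.trans_eq ?_)
  have e2 : (σ * y) ^ p = σ ^ p * x ^ (p / 2) := by
    rw [Real.mul_rpow hσp.le hyp.le, ← hy2, ← Real.rpow_natCast, ← Real.rpow_mul hyp.le]
    congr 2; push_cast; ring
  rw [e2, hr2, Real.rpow_neg hσp.le, Real.rpow_neg hx.le]
  field_simp
end

section
/- Let H be a separable real Hilbert space, let n ≥ 1 be an integer, and let ε_1,…,ε_n be i.i.d. centered H-valued random variables with σ² = E‖ε_1‖² > 0 and τ_p = E‖ε_1‖^p < ∞ for some real p > 6. Equip H^n with the inner product ⟨x, y⟩^{⊗n} = Σ_{i=1}^n ⟨x_i, y_i⟩, set ε̄ = (ε_1,…,ε_n), and for a linear subspace L of H^n let Π_L^{⊗n} denote the orthogonal projection onto L. Fix δ > 0 and set p(k) = 2(1+δ) σ² k / n for integers k ≥ 1. Then there exists a constant C, depending only on δ, p, σ and τ_p, such that for every integer m ≥ 1, every integer N ≥ 1, and every family (L_k)_{1≤k≤N∨m}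 of linear subspaces of H^n with dim(L_k) ≤ k for each k: Σ_{m'=1}^{N} E[ ( (1/n) ‖Π_{L_{m∨m'}}^{⊗n}(ε̄)‖² − p(m∨m') )_+ ] ≤ C / n, where x_+ = max(x, 0) and m∨m' = max(m, m'). -/
open MeasureTheory ProbabilityTheory RealInnerProductSpace

universe u v


lemma es_scalar (a b : ENNReal) (ha : a ≠ ⊤) : b^2 + a^2 ≤ 2 * a * b + ((b - a) + (a - b))^2 := by
  rcases eq_or_ne b ⊤ with rfl | hb
  · simp [ha]
  lift a to NNReal using ha
  lift b to NNReal using hb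
  norm_cast
  rcases le_total a b with h | h
  · obtain ⟨d, rfl⟩ := exists_add_of_le h
    have : a - (a+d) = 0 := tsub_eq_zero_of_le h
    rw [this, add_tsub_cancel_left]
    apply le_of_eq; ring
  · obtain ⟨d, rfl⟩ := exists_add_of_le h
    have : b - (b+d) = 0 := tsub_eq_zero_of_le h
    rw [this, add_tsub_cancel_left]
    apply le_of_eq; ring

lemma es_young (a b : ENNReal) : 2 * a * b ≤ a^2 + b^2 := by
  rcases eq_or_ne b ⊤ with rfl | hb
  · simp
  rcases eq_or_ne a ⊤ with rfl | ha
  · simp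
  lift a to NNReal using ha
  lift b to NNReal using hb
  norm_cast
  exact two_mul_le_add_sq a b

lemma es_one {X : Type*} [MeasurableSpace X] (ν : Measure X) [IsProbabilityMeasure ν]
    (h : X → ENNReal) (hm : Measurable h) (a : ENNReal) :
    ∫⁻ y, h y ^ 2 ∂ν ≤ (∫⁻ y, h y ∂ν)^2 + ∫⁻ y, ((h y - a) + (a - h y))^2 ∂ν := by
  rcases eq_or_ne a ⊤ with rfl | ha
  · by_cases hh : ∀ᵐ y ∂ν, h y = ⊤
    · have : ∫⁻ y, h y ∂ν = ⊤ := by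
        rw [lintegral_congr_ae hh]; simp
      simp [this]
    · have : ∫⁻ y, ((h y - ⊤) + (⊤ - h y))^2 ∂ν = ⊤ := by
        by_contra hne
        apply hh
        have := ae_lt_top (by fun_prop) hne
        filter_upwards [this] with y hy
        by_contra h'
        simp [ENNReal.top_sub h'] at hy
      rw [this]; simp
  · have h1 : ∫⁻ y, (h y ^2 + a^2) ∂ν ≤ ∫⁻ y, (2 * a * h y + ((h y - a) + (a - h y))^2) ∂ν :=
      lintegral_mono fun y => es_scalar a (h y) ha
    rw [lintegral_add_right _ measurable_const, lintegral_add_left (by fun_prop),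
      lintegral_const_mul _ hm] at h1
    simp only [lintegral_const, measure_univ, mul_one] at h1
    have h2 := h1.trans (add_le_add_left (es_young a (∫⁻ y, h y ∂ν)) _)
    rw [add_comm, add_assoc] at h2
    exact (ENNReal.add_le_add_iff_left (by simp [ha])).1 h2

lemma lint_cs2 {X : Type*} [MeasurableSpace X] (ν : Measure X)
    (f g : X → ENNReal) (hf : Measurable f) (hg : Measurable g) :
    (∫⁻ y, f y * g y ∂ν)^2 ≤ (∫⁻ y, f y ^ 2 ∂ν) * ∫⁻ y, g y ^ 2 ∂ν := by
  have h := ENNReal.lintegral_mul_le_Lp_mul_Lq ν (p := 2) (q := 2) (by constructor <;> norm_num) hf.aemeasurable hg.aemeasurable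
  simp at h
  calc _ ≤ ((∫⁻ a, f a ^ 2 ∂ν) ^ (2:ℝ)⁻¹ * (∫⁻ a, g a ^ 2 ∂ν) ^ (2:ℝ)⁻¹)^2 := by gcongr
    _ = _ := by
      rw [mul_pow, ← ENNReal.rpow_natCast, ← ENNReal.rpow_mul, ← ENNReal.rpow_natCast, ← ENNReal.rpow_mul]; simp

lemma lint_cs {X : Type*} [MeasurableSpace X] (ν : Measure X) [IsProbabilityMeasure ν]
    (h : X → ENNReal) (hm : Measurable h) : (∫⁻ y, h y ∂ν)^2 ≤ ∫⁻ y, h y ^ 2 ∂ν := by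
  simpa using lint_cs2 ν h (fun _ => 1) hm measurable_const

/-- symmetric difference -/
noncomputable def sd (a b : ENNReal) : ENNReal := (a - b) + (b - a)

lemma sd_meas {X : Type*} [MeasurableSpace X] {f g : X → ENNReal} (hf : Measurable f) (hg : Measurable g) :
    Measurable fun x => sd (f x) (g x) := by unfold sd; fun_prop

lemma sd_lint {X : Type*} [MeasurableSpace X] (ν : Measure X)
    (f g : X → ENNReal) (hf : Measurable f) (hg : Measurable g) :
    sd (∫⁻ x, f x ∂ν) (∫⁻ x, g x ∂ν) ≤ ∫⁻ x, sd (f x) (g x) ∂ν := by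
  unfold sd
  rw [lintegral_add_left (by fun_prop)]
  exact add_le_add (lintegral_sub_le _ _ hg) (lintegral_sub_le _ _ hf)

lemma efron_stein {X : Type*} [MeasurableSpace X] (ν : Measure X) [IsProbabilityMeasure ν] (z : X) :
    ∀ (n : ℕ) (f : (Fin n → X) → ENNReal), Measurable f →
    ∫⁻ x, f x ^ 2 ∂(Measure.pi fun _ => ν) ≤ (∫⁻ x, f x ∂(Measure.pi fun _ => ν))^2 +
      ∑ i, ∫⁻ x, sd (f x) (f (Function.update x i z)) ^ 2 ∂(Measure.pi fun _ => ν) := by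
  intro n
  induction n with
  | zero =>
    intro f hf
    rw [Measure.pi_of_empty (fun _ => ν), lintegral_dirac' _ hf, lintegral_dirac' _ (hf.pow_const 2)]
    simp
  | succ n ih =>
    intro f hf
    have key : ∀ g : (Fin (n+1) → X) → ENNReal, Measurable g →
        ∫⁻ x, g x ∂(Measure.pi fun _ => ν) =
          ∫⁻ y, ∫⁻ x, g (Fin.cons y x) ∂(Measure.pi fun _ => ν) ∂ν := by
      intro g hg
      have mp := (measurePreserving_piFinSuccAbove (fun _ : Fin (n+1) => ν) 0).symm
      rw [← mp.lintegral_comp hg, lintegral_prod]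
      · simp [MeasurableEquiv.piFinSuccAbove, Fin.insertNthEquiv]
      · exact (hg.comp (MeasurableEquiv.measurable _)).aemeasurable
    have mcons : Measurable fun q : X × (Fin n → X) => (Fin.cons q.1 q.2 : Fin (n+1) → X) := by
      refine measurable_pi_iff.2 fun i => ?_
      refine Fin.cases ?_ (fun j => ?_) i
      · simpa using measurable_fst
      · simp; fun_prop
    have mcons' : ∀ y, Measurable fun q : (Fin n → X) => (Fin.cons y q : Fin (n+1) → X) := fun y =>
      mcons.comp (measurable_const.prodMk measurable_id)
    have mF : ∀ y, Measurable fun x : Fin n → X => f (Fin.cons y x) := fun y => hf.comp (mcons' y)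
    have mup : ∀ i, Measurable fun x : Fin (n+1) → X => Function.update x i z := fun i => by
      fun_prop
    have msd : ∀ i, Measurable fun x => sd (f x) (f (Function.update x i z)) := fun i =>
      sd_meas hf (hf.comp (mup i))
    rw [key _ (hf.pow_const 2), key _ hf, Fin.sum_univ_succ]
    rw [key _ ((msd 0).pow_const 2)]
    have hrw : ∀ i : Fin n, ∫⁻ x, sd (f x) (f (Function.update x i.succ z)) ^ 2 ∂(Measure.pi fun _ => ν)
       = ∫⁻ y, ∫⁻ x, sd (f (Fin.cons y x)) (f (Fin.cons y (Function.update x i z))) ^ 2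
          ∂(Measure.pi fun _ => ν) ∂ν := by
      intro i
      rw [key _ ((msd _).pow_const 2)]
      simp only [Fin.cons_update]
    simp only [hrw, Fin.update_cons_zero]
    set h : X → ENNReal := fun y => ∫⁻ x, f (Fin.cons y x) ∂(Measure.pi fun _ => ν) with hh
    have mh : Measurable h := Measurable.lintegral_prod_right (hf.comp mcons)
    have m2 : ∀ i : Fin n, Measurable fun y => ∫⁻ x, sd (f (Fin.cons y x)) (f (Fin.cons y (Function.update x i z))) ^ 2
          ∂(Measure.pi fun _ => ν) := by
      intro i
      have := (((msd i.succ).comp mcons).pow_const 2).lintegral_prod_right' (ν := Measure.pi fun _ : Fin n => ν)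
      simpa only [Function.comp_def, Fin.cons_update] using this
    calc ∫⁻ y, ∫⁻ x, f (Fin.cons y x) ^ 2 ∂(Measure.pi fun _ => ν) ∂ν
        ≤ ∫⁻ y, (h y ^ 2 + ∑ i, ∫⁻ x, sd (f (Fin.cons y x)) (f (Fin.cons y (Function.update x i z))) ^ 2
          ∂(Measure.pi fun _ => ν)) ∂ν := lintegral_mono fun y => ih _ (mF y)
      _ = ∫⁻ y, h y ^ 2 ∂ν + ∑ i, ∫⁻ y, ∫⁻ x, sd (f (Fin.cons y x)) (f (Fin.cons y (Function.update x i z))) ^ 2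
          ∂(Measure.pi fun _ => ν) ∂ν := by
          rw [lintegral_add_left (mh.pow_const 2), lintegral_finsetSum]
          intro i _; exact m2 i
      _ ≤ _ := by
        rw [← add_assoc]
        gcongr
        refine (es_one ν h mh (h z)).trans ?_
        gcongr with y
        refine le_trans ?_ (lint_cs _ _ (sd_meas (mF y) (mF z)))
        gcongr
        exact sd_lint _ _ _ (mF y) (mF z)

lemma fub {X : Type*} [MeasurableSpace X] (ν : Measure X) [IsProbabilityMeasure ν] 
    (n : ℕ) (i : Fin n) (f : (Fin n → X) → ENNReal) (hf : Measurable f) :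
    ∫⁻ x, f x ∂(Measure.pi fun _ => ν) =
      ∫⁻ x, ∫⁻ y, f (Function.update x i y) ∂ν ∂(Measure.pi fun _ => ν) := by
  have mu : Measurable fun q : (Fin n → X) × X => f (Function.update q.1 i q.2) := by
    refine hf.comp (measurable_pi_iff.2 fun j => ?_)
    rcases eq_or_ne j i with rfl | h
    · simpa using measurable_snd
    · simp [h]; fun_prop
  refine lintegral_eq_of_lmarginal_eq {i} hf mu.lintegral_prod_right' ?_
  rw [lmarginal_singleton, lmarginal_singleton]
  ext x
  simp

/-- independence of coordinate `i` and the others -/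
lemma fub_mul {X : Type*} [MeasurableSpace X] (ν : Measure X) [IsProbabilityMeasure ν] (z : X)
    (n : ℕ) (i : Fin n) (Φ : (Fin n → X) → ENNReal)
    (hΦ : Measurable Φ) (ψ : X → ENNReal) (hψ : Measurable ψ) :
    ∫⁻ x, Φ (Function.update x i z) * ψ (x i) ∂(Measure.pi fun _ => ν) =
      (∫⁻ x, Φ (Function.update x i z) ∂(Measure.pi fun _ => ν)) * ∫⁻ y, ψ y ∂ν := by
  have m1 : Measurable fun x => Φ (Function.update x i z) := hΦ.comp (by fun_prop)
  rw [fub ν n i (fun x => Φ (Function.update x i z) * ψ (x i))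
    (m1.mul (hψ.comp (measurable_pi_apply i)))]
  simp only [Function.update_idem, Function.update_self]
  rw [← lintegral_mul_const _ m1]
  congr 1
  ext x
  rw [lintegral_const_mul _ hψ]

lemma det1 (Z Z0 s v : ℝ) (h : |Z - Z0| ≤ v) : |max Z s - max Z0 s| ≤ v :=
  (abs_max_sub_max_le_abs Z Z0 s).trans h

lemma det2 (Z Z0 s v a0 t : ℝ) (hs : 0 < s) (hZ : 0 ≤ Z) (hZ0 : 0 ≤ Z0) (ha : 0 ≤ a0) (ht : 0 ≤ t)
    (h : |Z^2 - Z0^2| ≤ 2 * a0 * t + v^2) :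
    (max Z s - max Z0 s)^2 ≤ 8 * (a0 / max Z0 s)^2 * t^2 + 2 * v^4 / s^2 := by
  set G := max Z s with hG
  set G0 := max Z0 s with hG0
  have g1 : s ≤ G := le_max_right _ _
  have g2 : s ≤ G0 := le_max_right _ _
  have e1 : |G^2 - G0^2| ≤ |Z^2 - Z0^2| := by
    have u1 : G^2 = max (Z^2) (s^2) := by
      rcases le_total Z s with h | h
      · rw [hG, max_eq_right h, max_eq_right (by gcongr)]
      · rw [hG, max_eq_left h, max_eq_left (by gcongr)]
    have u2 : G0^2 = max (Z0^2) (s^2) := by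
      rcases le_total Z0 s with h | h
      · rw [hG0, max_eq_right h, max_eq_right (by gcongr)]
      · rw [hG0, max_eq_left h, max_eq_left (by gcongr)]
    rw [u1, u2]
    exact abs_max_sub_max_le_abs _ _ _
  have e2 : |G - G0| * (G + G0) ≤ 2 * a0 * t + v^2 := by
    refine le_trans (le_of_eq ?_) (e1.trans h)
    rw [← abs_of_nonneg (by linarith : 0 ≤ G + G0), ← abs_mul]
    congr 1; ring
  have hG0p : 0 < G0 := by linarith
  have e3 : |G - G0| ≤ 2 * (a0 / G0) * t + v^2 / s := by
    have : |G - G0| ≤ (2 * a0 * t + v^2) / (G + G0) := by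
      rw [le_div_iff₀ (by linarith)]; exact e2
    refine this.trans ?_
    rw [add_div]
    have q1 : 2 * a0 * t / (G + G0) ≤ 2 * a0 * t / G0 := by
      gcongr; linarith
    have q2 : v^2 / (G + G0) ≤ v^2 / s := by
      gcongr; linarith
    have q3 : 2 * a0 * t / G0 = 2 * (a0 / G0) * t := by ring
    linarith
  have e4 : (G - G0)^2 ≤ (2 * (a0 / G0) * t + v^2 / s)^2 := by
    rw [← sq_abs]; gcongr
  refine e4.trans ?_
  have : 2 * v^4 / s^2 = 2 * (v^2/s)^2 := by ring
  rw [this]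
  nlinarith [sq_nonneg (2 * (a0 / G0) * t - v^2 / s)]

lemma det3 (Z Z0 s v a a0 : ℝ) (hs : 0 < s) (ha : 0 ≤ a) (ha0 : 0 ≤ a0) (hv : 0 ≤ v)
    (haZ : a ≤ Z) (h : |Z - Z0| ≤ v) (h2 : a0 ≤ a + v) :
    (a0 / max Z0 s)^2 ≤ 2 * (a / max Z s)^2 + 8 * v^2 / s^2 := by
  have d := det1 Z Z0 s v h
  set G := max Z s with hG
  set G0 := max Z0 s with hG0
  have g1 : s ≤ G := le_max_right _ _
  have g2 : s ≤ G0 := le_max_right _ _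
  have g3 : Z ≤ G := le_max_left _ _
  have p1 : 0 < G := by linarith
  have p2 : 0 < G0 := by linarith
  have e1 : a / G0 ≤ a / G + v / s := by
    have : a / G0 - a / G = (a / G) * ((G - G0) / G0) := by field_simp
    have q1 : a / G ≤ 1 := by rw [div_le_one p1]; linarith
    have q2 : (G - G0) / G0 ≤ v / s := by
      have := (abs_le.1 d).2
      calc (G - G0) / G0 ≤ v / G0 := by gcongr
        _ ≤ v / s := by gcongr
    have q3 : (a / G) * ((G - G0) / G0) ≤ (a/G) * (v / s) := by gcongr
    have q4 : (a/G) * (v / s) ≤ 1 * (v / s) := by gcongr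
    linarith
  have e2 : a0 / G0 ≤ a / G + 2 * (v / s) := by
    have q1 : a0 / G0 ≤ (a + v) / G0 := by gcongr
    have q2 : v / G0 ≤ v / s := by gcongr
    rw [add_div] at q1
    linarith
  have e3 : (a0/G0)^2 ≤ (a / G + 2 * (v / s))^2 := by gcongr
  have : 8 * v^2 / s^2 = 8 * (v/s)^2 := by ring
  rw [this]
  nlinarith [sq_nonneg (a / G - 2 * (v / s))]

lemma pow_add_le (B d q : ℝ) (hB : 0 ≤ B) (hd : 0 ≤ d) (hq : 0 ≤ q) :
    (B + d)^q ≤ 2^q * (B^q + d^q) := by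
  have h1 : (B + d) ≤ 2 * max B d := by
    have := le_max_left B d; have := le_max_right B d; linarith
  calc (B+d)^q ≤ (2 * max B d)^q := by gcongr
    _ = 2^q * (max B d)^q := by rw [Real.mul_rpow (by norm_num) (by positivity)]
    _ ≤ _ := by
      gcongr
      have := Real.rpow_nonneg hB q; have := Real.rpow_nonneg hd q
      rcases le_total B d with h | h
      · rw [max_eq_right h]; linarith
      · rw [max_eq_left h]; linarith

lemma rpow_diff1 (A B r : ℝ) (hB : 0 ≤ B) (hAB : B ≤ A) (hr : 1 ≤ r) :
    A^r - B^r ≤ r * (A - B) * A^(r-1) := by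
  rcases eq_or_lt_of_le (hB.trans hAB) with h | h
  · have : B = 0 := by linarith
    subst this; subst h; simp
  · have hBA : 0 ≤ B/A := by positivity
    have := one_add_mul_self_le_rpow_one_add (s := B/A - 1) (by linarith) hr
    have e : 1 + (B/A - 1) = B / A := by ring
    rw [e, Real.div_rpow hB h.le, le_div_iff₀ (by positivity)] at this
    have e2 : A^r = A * A^(r-1) := by
      rw [← Real.rpow_one_add' h.le (by linarith)]; congr 1; ring
    have e3 : (1 + r * (B / A - 1)) * A ^ r = A^r - r * (A - B) * A^(r-1) := by
      rw [e2]; field_simp; ring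
    linarith

lemma rpow_diff2 (A B d r : ℝ) (hA : 0 ≤ A) (hB : 0 ≤ B) (hd : |A - B| ≤ d) (hr : 1 ≤ r) :
    |A^r - B^r| ≤ r * |A - B| * (B + d)^(r-1) := by
  have hd0 : 0 ≤ d := (abs_nonneg _).trans hd
  rcases le_total B A with h | h
  · rw [abs_of_nonneg (sub_nonneg.2 (by gcongr)), abs_of_nonneg (sub_nonneg.2 h)]
    refine (rpow_diff1 A B r hB h hr).trans ?_
    have : A ≤ B + d := by have := (abs_le.1 hd).2; linarith
    have h1 : 0 ≤ A - B := by linarith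
    have h2 : 0 ≤ r - 1 := by linarith
    gcongr
  · rw [abs_sub_comm, abs_sub_comm A, abs_of_nonneg (sub_nonneg.2 (by gcongr)), abs_of_nonneg (sub_nonneg.2 h)]
    refine (rpow_diff1 B A r hA h hr).trans ?_
    have h1 : 0 ≤ B - A := by linarith
    have h2 : 0 ≤ r - 1 := by linarith
    gcongr
    linarith

/-- main power lemma; `e = |G - G0|` real difference, `v ≥ e` -/
lemma rpow_diff3 (A B e v p : ℝ) (hA : 0 ≤ A) (hB : 0 ≤ B) (hd : |A - B| ≤ e) (hev : e ≤ v) (hp : 2 ≤ p) :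
    |A^(p/2) - B^(p/2)|^2 ≤ (p/2)^2 * 2^(p-2) * (e^2 * B^(p-2) + v^p) := by
  have he : 0 ≤ e := (abs_nonneg _).trans hd
  have hv : 0 ≤ v := he.trans hev
  have h := rpow_diff2 A B e (p/2) hA hB hd (by linarith)
  have hq : 0 ≤ p - 2 := by linarith
  calc |A^(p/2) - B^(p/2)|^2 ≤ (p/2 * |A - B| * (B+e)^(p/2-1))^2 := by gcongr
    _ ≤ (p/2 * e * (B+e)^(p/2-1))^2 := by gcongr
    _ = (p/2)^2 * e^2 * (B+e)^(p-2) := by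
      rw [mul_pow, mul_pow, ← Real.rpow_natCast ((B+e)^(p/2-1)), ← Real.rpow_mul (by positivity)]
      congr 2; push_cast; ring
    _ ≤ (p/2)^2 * e^2 * (2^(p-2) * (B^(p-2) + e^(p-2))) := by
      gcongr; exact pow_add_le _ _ _ hB he hq
    _ = (p/2)^2 * 2^(p-2) * (e^2 * B^(p-2) + e^2 * e^(p-2)) := by ring
    _ ≤ _ := by
      gcongr
      calc e^2 * e^(p-2) ≤ v^2 * v^(p-2) := by gcongr
        _ = v^p := by
          rw [← Real.rpow_natCast v 2, ← Real.rpow_add' hv (by push_cast; linarith)]; congr 1; push_cast; ring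

lemma v_pow (v w N q : ℝ) (hv : 0 ≤ v) (hw : 0 ≤ w) (hw1 : w ≤ 1) (hN : 0 ≤ N) (h : v^2 ≤ w * N^2) (hq : 2 ≤ q) :
    v^q ≤ w * N^q := by
  have e : ∀ y : ℝ, 0 ≤ y → y^q = (y^2)^(q/2) := by
    intro y hy
    rw [← Real.rpow_natCast y 2, ← Real.rpow_mul hy]; congr 1; push_cast; ring
  rw [e v hv, e N hN]
  calc (v^2)^(q/2) ≤ (w * N^2)^(q/2) := by gcongr
    _ = w^(q/2) * (N^2)^(q/2) := Real.mul_rpow hw (by positivity)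
    _ ≤ w * (N^2)^(q/2) := by
      gcongr
      exact Real.rpow_le_self_of_le_one hw hw1 (by linarith)

lemma young_q (T η p : ℝ) (hT : 0 ≤ T) (hη : 0 < η) (hp : 2 < p) :
    T^(p-2) ≤ η * T^p + (η⁻¹)^((p-2)/2) := by
  have e : T^(p-2) = (T^2)^((p-2)/2) := by
    rw [← Real.rpow_natCast T 2, ← Real.rpow_mul hT]; congr 1; push_cast; ring
  rcases le_total (T^2) η⁻¹ with h | h
  · have : T^(p-2) ≤ (η⁻¹)^((p-2)/2) := by rw [e]; gcongr
    have : 0 ≤ η * T^p := by positivity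
    linarith
  · have e2 : T^p = T^2 * T^(p-2) := by
      rw [← Real.rpow_natCast T 2, ← Real.rpow_add' hT (by push_cast; linarith)]; congr 1; push_cast; ring
    have h1 : 1 ≤ η * T^2 := by
      calc 1 = η * η⁻¹ := by field_simp
        _ ≤ _ := by gcongr
    have : 0 ≤ (η⁻¹)^((p-2)/2) := by positivity
    rw [e2]
    have h3 : 1 * T^(p-2) ≤ (η * T^2) * T^(p-2) := by gcongr
    linarith

lemma sd_ofReal (a b : ℝ) (ha : 0 ≤ a) (hb : 0 ≤ b) : sd (ENNReal.ofReal a) (ENNReal.ofReal b) = ENNReal.ofReal |a - b| := by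
  unfold sd
  rw [← ENNReal.ofReal_sub _ hb, ← ENNReal.ofReal_sub _ ha]
  rcases le_total a b with h | h
  · rw [abs_of_nonpos (by linarith), ENNReal.ofReal_of_nonpos (by linarith)]; simp
  · rw [abs_of_nonneg (by linarith), ENNReal.ofReal_of_nonpos (p := b - a) (by linarith)]; simp

lemma lint_lin {Y : Type*} [MeasurableSpace Y] (P : Measure Y) (c d : ENNReal) (f g : Y → ENNReal)
    (hf : Measurable f) (hg : Measurable g) :
    ∫⁻ x, (c * f x + d * g x) ∂P = c * ∫⁻ x, f x ∂P + d * ∫⁻ x, g x ∂P := by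
  rw [lintegral_add_left (hf.const_mul _), lintegral_const_mul _ hf, lintegral_const_mul _ hg]

structure Su {X : Type*} [MeasurableSpace X] (ν : Measure X) (n : ℕ) (p σ t k : ℝ) where
  z : X
  N : X → ℝ
  Z : (Fin n → X) → ℝ
  a : Fin n → (Fin n → X) → ℝ
  v : Fin n → (Fin n → X) → ℝ
  w : Fin n → ℝ
  mN : Measurable N
  mZ : Measurable Z
  ma : ∀ i, Measurable (a i)
  N0 : ∀ x, 0 ≤ N x
  Z0 : ∀ x, 0 ≤ Z x
  a0 : ∀ i x, 0 ≤ a i x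
  v0 : ∀ i x, 0 ≤ v i x
  w0 : ∀ i, 0 ≤ w i
  w1 : ∀ i, w i ≤ 1
  wk : ∑ i, w i ≤ k
  hp : 6 < p
  hσ : 0 < σ
  ht : 0 < t
  hk : 1 ≤ k
  h1 : ∀ i x, |Z x - Z (Function.update x i z)| ≤ v i x
  h2 : ∀ i x, |Z x ^ 2 - Z (Function.update x i z) ^ 2| ≤
    2 * a i (Function.update x i z) * N (x i) + v i x ^ 2
  h3 : ∀ i x, a i (Function.update x i z) ≤ a i x + v i x
  h4 : ∀ x, ∑ i, a i x ^ 2 ≤ Z x ^ 2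
  h5 : ∀ i x, v i x ^ 2 ≤ w i * N (x i) ^ 2
  n2 : ∫⁻ y, ENNReal.ofReal (N y ^ 2) ∂ν ≤ ENNReal.ofReal σ
  n4 : ∫⁻ y, ENNReal.ofReal (N y ^ 4) ∂ν ≤ ENNReal.ofReal t
  nq : ∫⁻ y, ENNReal.ofReal (N y ^ (p-2)) ∂ν ≤ ENNReal.ofReal t
  np : ∫⁻ y, ENNReal.ofReal (N y ^ p) ∂ν ≤ ENNReal.ofReal t
  z2 : ∫⁻ x, ENNReal.ofReal (Z x ^ 2) ∂(Measure.pi fun _ => ν) ≤ ENNReal.ofReal (σ * k)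
  zp : ∫⁻ x, ENNReal.ofReal (Z x ^ p) ∂(Measure.pi fun _ => ν) ≠ ⊤

set_option linter.unusedSectionVars false
namespace Su
variable {X : Type*} [MeasurableSpace X] {ν : Measure X} [IsProbabilityMeasure ν] {n : ℕ} {p σ t k : ℝ}
  (S : Su ν n p σ t k)

noncomputable def s (_S : Su ν n p σ t k) : ℝ := √(σ * k)
noncomputable def G (x : Fin n → X) : ℝ := max (S.Z x) S.s

lemma ck (S : Su ν n p σ t k) : 0 < σ * k := mul_pos S.hσ (by linarith [S.hk])
lemma s_pos : 0 < S.s := Real.sqrt_pos.2 S.ck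
lemma s_sq : S.s ^ 2 = σ * k := Real.sq_sqrt S.ck.le
lemma G_pos (x) : 0 < S.G x := S.s_pos.trans_le (le_max_right _ _)
lemma mG : Measurable S.G := S.mZ.max measurable_const
lemma mup (i : Fin n) : Measurable fun x : Fin n → X => Function.update x i S.z := by fun_prop
lemma a_le (i x) : S.a i x ≤ S.Z x := by
  refine (sq_le_sq₀ (S.a0 i x) (S.Z0 x)).1 (le_trans ?_ (S.h4 x))
  exact Finset.single_le_sum (f := fun i => S.a i x ^ 2) (fun j _ => sq_nonneg _) (Finset.mem_univ i)

lemma G_diff (i x) : |S.G x - S.G (Function.update x i S.z)| ≤ S.v i x := det1 _ _ _ _ (S.h1 i x)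

lemma v4 (i x) : S.v i x ^ 4 ≤ S.w i * S.N (x i) ^ 4 := by
  have := v_pow (S.v i x) (S.w i) (S.N (x i)) 4 (S.v0 i x) (S.w0 i) (S.w1 i) (S.N0 _) (S.h5 i x) (by norm_num)
  exact_mod_cast this

lemma int_coord (S : Su ν n p σ t k) (i : Fin n) (ψ : X → ENNReal) (hψ : Measurable ψ) :
    ∫⁻ x, ψ (x i) ∂(Measure.pi fun _ : Fin n => ν) = ∫⁻ y, ψ y ∂ν := by
  have := fub_mul ν S.z n i (fun _ => 1) measurable_const ψ hψ
  simpa using this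

lemma weights (i : Fin n) (Φ : (Fin n → X) → ENNReal) (hΦ : Measurable Φ) :
    ∫⁻ x, ENNReal.ofReal ((S.G x - S.G (Function.update x i S.z))^2) * Φ (Function.update x i S.z)
      ∂(Measure.pi fun _ => ν) ≤
    ENNReal.ofReal (16 * σ) * ∫⁻ x, ENNReal.ofReal ((S.a i x / S.G x)^2) * Φ (Function.update x i S.z)
      ∂(Measure.pi fun _ => ν) +
    ENNReal.ofReal ((64 * σ + 2 * t / σ) / k * S.w i) * ∫⁻ x, Φ (Function.update x i S.z)
      ∂(Measure.pi fun _ => ν) := by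
  set P : Measure (Fin n → X) := Measure.pi fun _ => ν with hP
  set U : (Fin n → X) → (Fin n → X) := fun x => Function.update x i S.z with hU
  have mU : Measurable U := S.mup i
  have hc := S.ck
  have hk0 : 0 < k := by linarith [S.hk]
  have hσ := S.hσ
  have ht := S.ht
  have hw := S.w0 i
  have mag : Measurable fun x => ENNReal.ofReal ((S.a i x / S.G x)^2) :=
    (((S.ma i).div S.mG).pow_const 2).ennreal_ofReal
  have mΦU : Measurable fun x => Φ (U x) := hΦ.comp mU
  have mN2 : Measurable fun y => ENNReal.ofReal (S.N y ^ 2) := (S.mN.pow_const 2).ennreal_ofReal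
  have mN4 : Measurable fun y => ENNReal.ofReal (S.N y ^ 4) := (S.mN.pow_const 4).ennreal_ofReal
  have mN2' : Measurable fun x : Fin n → X => ENNReal.ofReal (S.N (x i) ^ 2) := mN2.comp (measurable_pi_apply i)
  have mN4' : Measurable fun x : Fin n → X => ENNReal.ofReal (S.N (x i) ^ 4) := mN4.comp (measurable_pi_apply i)
  have b2 : ∀ x, ENNReal.ofReal ((S.G x - S.G (U x))^2) ≤
      8 * ENNReal.ofReal ((S.a i (U x) / S.G (U x))^2) * ENNReal.ofReal (S.N (x i) ^ 2) +
      ENNReal.ofReal (2 / (σ * k) * S.w i) * ENNReal.ofReal (S.N (x i)^4) := by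
    intro x
    have h := det2 _ _ S.s _ _ _ S.s_pos (S.Z0 x) (S.Z0 (U x)) (S.a0 i (U x)) (S.N0 (x i)) (S.h2 i x)
    rw [S.s_sq] at h
    have h' : (S.G x - S.G (U x))^2 ≤ 8 * (S.a i (U x) / S.G (U x))^2 * S.N (x i) ^ 2 +
      (2 / (σ * k) * S.w i) * S.N (x i)^4 := by
      refine h.trans ?_
      refine add_le_add le_rfl ?_
      calc 2 * S.v i x ^ 4 / (σ * k) ≤ 2 * (S.w i * S.N (x i) ^ 4) / (σ * k) := by
            gcongr; exact S.v4 i x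
        _ = _ := by ring
    refine (ENNReal.ofReal_le_ofReal h').trans (le_of_eq ?_)
    rw [ENNReal.ofReal_add (by positivity) (by have := S.N0 (x i); positivity),
      ENNReal.ofReal_mul (by positivity), ENNReal.ofReal_mul (by norm_num),
      ENNReal.ofReal_mul (by positivity)]
    norm_num
  have b3 : ∀ x, ENNReal.ofReal ((S.a i (U x) / S.G (U x))^2) ≤ 2 * ENNReal.ofReal ((S.a i x / S.G x)^2) +
      ENNReal.ofReal (8 / (σ * k) * S.w i) * ENNReal.ofReal (S.N (x i) ^ 2) := by
    intro x
    have h := det3 _ _ S.s _ _ _ S.s_pos (S.a0 i x) (S.a0 i (U x)) (S.v0 i x) (S.a_le i x) (S.h1 i x) (S.h3 i x)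
    rw [S.s_sq] at h
    have h' : (S.a i (U x) / S.G (U x))^2 ≤ 2 * (S.a i x / S.G x)^2 +
      (8 / (σ * k) * S.w i) * S.N (x i) ^ 2 := by
      refine h.trans ?_
      refine add_le_add le_rfl ?_
      calc 8 * S.v i x ^ 2 / (σ * k) ≤ 8 * (S.w i * S.N (x i) ^ 2) / (σ * k) := by
            gcongr; exact S.h5 i x
        _ = _ := by ring
    refine (ENNReal.ofReal_le_ofReal h').trans (le_of_eq ?_)
    rw [ENNReal.ofReal_add (by positivity) (by positivity),
      ENNReal.ofReal_mul (by norm_num),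
      ENNReal.ofReal_mul (by positivity)]
    norm_num
  set I := ∫⁻ x, ENNReal.ofReal ((S.a i x / S.G x)^2) * Φ (U x) ∂P with hI
  set J := ∫⁻ x, Φ (U x) ∂P with hJ
  have c1 : ∫⁻ x, Φ (U x) * ENNReal.ofReal (S.N (x i) ^ 2) ∂P ≤ J * ENNReal.ofReal σ := by
    rw [fub_mul ν S.z n i Φ hΦ _ mN2]; gcongr; exact S.n2
  have c2 : ∫⁻ x, Φ (U x) * ENNReal.ofReal (S.N (x i) ^ 4) ∂P ≤ J * ENNReal.ofReal t := by
    rw [fub_mul ν S.z n i Φ hΦ _ mN4]; gcongr; exact S.n4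
  have c3 : ∫⁻ x, ENNReal.ofReal ((S.a i (U x) / S.G (U x))^2) * Φ (U x) ∂P ≤
      2 * I + ENNReal.ofReal (8 / (σ * k) * S.w i) * (J * ENNReal.ofReal σ) := by
    calc _ ≤ ∫⁻ x, (2 * (ENNReal.ofReal ((S.a i x / S.G x)^2) * Φ (U x)) +
          ENNReal.ofReal (8 / (σ * k) * S.w i) * (Φ (U x) * ENNReal.ofReal (S.N (x i) ^ 2))) ∂P := by
          refine lintegral_mono fun x => ?_
          refine (mul_le_mul_left (b3 x) (Φ (U x))).trans (le_of_eq ?_)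
          ring
      _ = 2 * I + ENNReal.ofReal (8 / (σ * k) * S.w i) * ∫⁻ x, Φ (U x) * ENNReal.ofReal (S.N (x i) ^ 2) ∂P := by
          exact lint_lin P _ _ _ _ (mag.mul mΦU) (mΦU.mul mN2')
      _ ≤ _ := by gcongr
  have mR : Measurable fun x => ENNReal.ofReal ((S.a i x / S.G x)^2) * Φ x := mag.mul hΦ
  have mR' : Measurable fun x => ENNReal.ofReal ((S.a i (U x) / S.G (U x))^2) * Φ (U x) := mR.comp mU
  have c4 : ∫⁻ x, (ENNReal.ofReal ((S.a i (U x) / S.G (U x))^2) * Φ (U x)) * ENNReal.ofReal (S.N (x i) ^ 2) ∂P ≤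
      (2 * I + ENNReal.ofReal (8 / (σ * k) * S.w i) * (J * ENNReal.ofReal σ)) * ENNReal.ofReal σ := by
    rw [fub_mul ν S.z n i _ mR _ mN2]; gcongr; exact S.n2
  calc _ ≤ ∫⁻ x, (8 * ((ENNReal.ofReal ((S.a i (U x) / S.G (U x))^2) * Φ (U x)) * ENNReal.ofReal (S.N (x i) ^ 2)) +
        ENNReal.ofReal (2 / (σ * k) * S.w i) * (Φ (U x) * ENNReal.ofReal (S.N (x i)^4))) ∂P := by
          refine lintegral_mono fun x => ?_
          refine (mul_le_mul_left (b2 x) (Φ (U x))).trans (le_of_eq ?_)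
          ring
    _ = 8 * ∫⁻ x, (ENNReal.ofReal ((S.a i (U x) / S.G (U x))^2) * Φ (U x)) * ENNReal.ofReal (S.N (x i) ^ 2) ∂P +
        ENNReal.ofReal (2 / (σ * k) * S.w i) * ∫⁻ x, Φ (U x) * ENNReal.ofReal (S.N (x i)^4) ∂P := by
          exact lint_lin P _ _ _ _ (mR'.mul mN2') (mΦU.mul mN4')
    _ ≤ 8 * ((2 * I + ENNReal.ofReal (8 / (σ * k) * S.w i) * (J * ENNReal.ofReal σ)) * ENNReal.ofReal σ) +
        ENNReal.ofReal (2 / (σ * k) * S.w i) * (J * ENNReal.ofReal t) := by gcongr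
    _ = _ := by
      have e8 : (8:ENNReal) = ENNReal.ofReal 8 := by norm_num
      have e2 : (2:ENNReal) = ENNReal.ofReal 2 := by norm_num
      have r1 : ENNReal.ofReal (16 * σ) = 8 * 2 * ENNReal.ofReal σ := by
        rw [ENNReal.ofReal_mul (by norm_num)]; norm_num
      have r2 : ENNReal.ofReal ((64 * σ + 2 * t / σ) / k * S.w i) =
         8 * ENNReal.ofReal (8 / (σ * k) * S.w i) * ENNReal.ofReal σ * ENNReal.ofReal σ +
         ENNReal.ofReal (2 / (σ * k) * S.w i) * ENNReal.ofReal t := by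
        rw [e8, ← ENNReal.ofReal_mul (by positivity), ← ENNReal.ofReal_mul (by positivity),
          ← ENNReal.ofReal_mul (by positivity), ← ENNReal.ofReal_mul (by positivity),
          ← ENNReal.ofReal_add (by positivity) (by positivity)]
        congr 1
        field_simp
        ring
      rw [r1, r2]
      ring

lemma sum_w (b : ℝ) (hb : 0 ≤ b) : ∑ i, ENNReal.ofReal (b / k * S.w i) ≤ ENNReal.ofReal b := by
  have hk0 : 0 < k := by linarith [S.hk]
  rw [← ENNReal.ofReal_sum_of_nonneg fun i _ => by have := S.w0 i; positivity]
  apply ENNReal.ofReal_le_ofReal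
  rw [← Finset.mul_sum]
  calc b / k * ∑ i, S.w i ≤ b / k * k := by gcongr; exact S.wk
    _ = b := by field_simp

lemma sum_ag (x) : ∑ i, ENNReal.ofReal ((S.a i x / S.G x)^2) ≤ 1 := by
  rw [← ENNReal.ofReal_sum_of_nonneg fun i _ => by positivity]
  rw [← ENNReal.ofReal_one]
  apply ENNReal.ofReal_le_ofReal
  simp only [div_pow]
  rw [← Finset.sum_div, div_le_one (by have := S.G_pos x; positivity)]
  refine (S.h4 x).trans ?_
  have := S.Z0 x
  gcongr
  exact le_max_left _ _

lemma mag (i) : Measurable fun x => ENNReal.ofReal ((S.a i x / S.G x)^2) :=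
    (((S.ma i).div S.mG).pow_const 2).ennreal_ofReal

noncomputable def D2 (_S : Su ν n p σ t k) : ℝ := 80 * σ + 2 * t / σ

lemma D2_pos : 0 < S.D2 := by have := S.hσ; have := S.ht; unfold D2; positivity

lemma varG : ∫⁻ x, ENNReal.ofReal (S.G x)^2 ∂(Measure.pi fun _ => ν) ≤
    (∫⁻ x, ENNReal.ofReal (S.G x) ∂(Measure.pi fun _ => ν))^2 + ENNReal.ofReal S.D2 := by
  have hσ := S.hσ
  have ht := S.ht
  refine (efron_stein ν S.z n _ S.mG.ennreal_ofReal).trans ?_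
  gcongr
  have : ∀ i x, sd (ENNReal.ofReal (S.G x)) (ENNReal.ofReal (S.G (Function.update x i S.z))) ^ 2
     = ENNReal.ofReal ((S.G x - S.G (Function.update x i S.z))^2) * (fun _ => 1) (Function.update x i S.z) := by
    intro i x
    rw [sd_ofReal _ _ (S.G_pos _).le (S.G_pos _).le, ← ENNReal.ofReal_pow (abs_nonneg _), sq_abs]; simp
  simp only [this]
  refine (Finset.sum_le_sum fun i _ => S.weights i _ measurable_const).trans ?_
  simp only [mul_one, lintegral_const, measure_univ]
  rw [Finset.sum_add_distrib, ← Finset.mul_sum, ← lintegral_finsetSum _ fun i _ => S.mag i]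
  have e : S.D2 = 16 * σ + (64 * σ + 2 * t / σ) := by unfold D2; ring
  rw [e, ENNReal.ofReal_add (by positivity) (by positivity)]
  refine add_le_add ?_ (S.sum_w _ (by positivity))
  refine mul_le_of_le_one_right' ?_
  refine (lintegral_mono S.sum_ag).trans ?_
  simp

end Su

lemma tail_point (Z M s y p : ℝ) (hp : 2 < p) (hs : 0 < s) (hy : 1 < y) (hM : M ≤ √2 * s) (hZ : 0 ≤ Z) :
    max (Z^2 - 2 * y^2 * s^2) 0 ≤ (y / (y-1))^2 / ((y-1) * s)^(p-2) * |max Z s - M|^p := by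
  rcases le_total (Z^2 - 2 * y^2 * s^2) 0 with h | h
  · rw [max_eq_right h]
    have : 0 < y - 1 := by linarith
    positivity
  · rw [max_eq_left h]
    have hy1 : 0 < y - 1 := by linarith
    have h2 : (1:ℝ) ≤ √2 := by rw [Real.one_le_sqrt]; norm_num
    have hz : y * (√2 * s) ≤ Z := by
      refine (sq_le_sq₀ (by positivity) hZ).1 ?_
      have : (y * (√2 * s))^2 = 2 * y^2 * s^2 := by
        rw [mul_pow, mul_pow, Real.sq_sqrt (by norm_num)]; ring
      linarith
    have hss : s ≤ √2 * s := by nlinarith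
    have hzs : s ≤ Z := by nlinarith
    rw [max_eq_left hzs]
    have hT : (y - 1) * s ≤ Z - M := by nlinarith
    have hT0 : 0 < (y-1) * s := by positivity
    rw [abs_of_nonneg (by linarith)]
    set T := Z - M with hTd
    have hZT : Z ≤ y / (y-1) * T := by
      rw [div_mul_eq_mul_div, le_div_iff₀ hy1]
      nlinarith
    have e2 : T^p = T^2 * T^(p-2) := by
      rw [← Real.rpow_natCast T 2, ← Real.rpow_add' (by linarith) (by push_cast; linarith)]; congr 1; push_cast; ring
    have hT' : 0 < T := by linarith
    have e3 : ((y-1)*s)^(p-2) ≤ T^(p-2) := by gcongr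
    have e4 : 0 < ((y-1)*s)^(p-2) := by positivity
    calc Z^2 - 2 * y^2 * s^2 ≤ Z^2 := by have : 0 ≤ 2 * y^2 * s^2 := by positivity
                                         linarith
      _ ≤ (y / (y-1) * T)^2 := by gcongr
      _ = (y / (y-1))^2 / ((y-1) * s)^(p-2) * (T^2 * ((y-1) * s)^(p-2)) := by field_simp
      _ ≤ _ := by rw [e2]; gcongr

set_option linter.unusedSectionVars false
namespace Su
variable {X : Type*} [MeasurableSpace X] {ν : Measure X} [IsProbabilityMeasure ν] {n : ℕ} {p σ t k : ℝ}
  (S : Su ν n p σ t k)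

lemma G2 : ∫⁻ x, ENNReal.ofReal (S.G x)^2 ∂(Measure.pi fun _ => ν) ≤ ENNReal.ofReal (2 * (σ * k)) := by
  have h : ∀ x, ENNReal.ofReal (S.G x)^2 ≤ ENNReal.ofReal (S.Z x^2) + ENNReal.ofReal (σ * k) := by
    intro x
    rw [← ENNReal.ofReal_pow (S.G_pos x).le, ← ENNReal.ofReal_add (by positivity) S.ck.le]
    apply ENNReal.ofReal_le_ofReal
    rw [← S.s_sq]
    unfold G
    rcases le_total (S.Z x) S.s with h | h
    · rw [max_eq_right h]; nlinarith [sq_nonneg (S.Z x)]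
    · rw [max_eq_left h]; nlinarith [sq_nonneg (S.s)]
  refine (lintegral_mono h).trans ?_
  rw [lintegral_add_right _ measurable_const]
  simp only [lintegral_const, measure_univ, mul_one]
  rw [two_mul, ENNReal.ofReal_add S.ck.le S.ck.le]
  gcongr
  exact S.z2

lemma Gint_ne : ∫⁻ x, ENNReal.ofReal (S.G x) ∂(Measure.pi fun _ => ν) ≠ ⊤ := by
  intro h
  have := (lint_cs _ _ S.mG.ennreal_ofReal).trans S.G2
  rw [h] at this
  exact absurd this (by simp [ENNReal.mul_eq_top])

noncomputable def M : ℝ := (∫⁻ x, ENNReal.ofReal (S.G x) ∂(Measure.pi fun _ => ν)).toReal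
lemma M_eq : ENNReal.ofReal S.M = ∫⁻ x, ENNReal.ofReal (S.G x) ∂(Measure.pi fun _ => ν) :=
  ENNReal.ofReal_toReal S.Gint_ne
lemma M0 : 0 ≤ S.M := ENNReal.toReal_nonneg
lemma M_le : S.M ≤ √2 * S.s := by
  have := (lint_cs _ _ S.mG.ennreal_ofReal).trans S.G2
  have hc := S.ck
  rw [← S.M_eq, ← ENNReal.ofReal_pow S.M0, ENNReal.ofReal_le_ofReal_iff (by positivity)] at this
  unfold s
  rw [← Real.sqrt_mul (by norm_num)]
  exact Real.le_sqrt_of_sq_le this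

noncomputable def T (x : Fin n → X) : ℝ := |S.G x - S.M|
lemma T0 (x) : 0 ≤ S.T x := abs_nonneg _
lemma mT : Measurable S.T := by
  have := S.mG
  unfold T; 
  exact (this.sub_const _).norm
lemma mTq (q : ℝ) : Measurable fun x => ENNReal.ofReal (S.T x ^ q) := (S.mT.pow_const q).ennreal_ofReal

noncomputable def A (q : ℝ) : ENNReal := ∫⁻ x, ENNReal.ofReal (S.T x ^ q) ∂(Measure.pi fun _ => ν)

lemma A2 : ∫⁻ x, ENNReal.ofReal (S.T x ^ 2) ∂(Measure.pi fun _ => ν) ≤ ENNReal.ofReal S.D2 := by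
  have hM := S.M0
  have h : ∀ x, ENNReal.ofReal (S.T x ^ 2) + ENNReal.ofReal (2 * S.M) * ENNReal.ofReal (S.G x) =
      ENNReal.ofReal (S.G x)^2 + ENNReal.ofReal (S.M ^ 2) := by
    intro x
    have hG := (S.G_pos x).le
    rw [← ENNReal.ofReal_mul (by positivity), ← ENNReal.ofReal_pow hG,
      ← ENNReal.ofReal_add (by positivity) (by positivity), ← ENNReal.ofReal_add (by positivity) (by positivity)]
    congr 1
    unfold T; rw [sq_abs]; ring
  have h2 := lintegral_congr (μ := Measure.pi fun _ : Fin n => ν) h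
  rw [lintegral_add_right _ (S.mG.ennreal_ofReal.const_mul _), lintegral_const_mul _ S.mG.ennreal_ofReal,
    lintegral_add_right _ measurable_const, ← S.M_eq] at h2
  simp only [lintegral_const, measure_univ, mul_one] at h2
  have h3 := S.varG
  rw [← S.M_eq] at h3
  have h4 := h2.le.trans (add_le_add_left h3 _)
  have e : ENNReal.ofReal S.M ^ 2 + ENNReal.ofReal S.D2 + ENNReal.ofReal (S.M ^ 2)
     = ENNReal.ofReal S.D2 + ENNReal.ofReal (2 * S.M) * ENNReal.ofReal S.M := by
    have := S.D2_pos
    rw [← ENNReal.ofReal_mul (by positivity), ← ENNReal.ofReal_pow hM, 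
      ← ENNReal.ofReal_add (by positivity) (by positivity), ← ENNReal.ofReal_add (by positivity) (by positivity),
      ← ENNReal.ofReal_add (by positivity) (by positivity)]
    congr 1; ring
  rw [e] at h4
  exact (ENNReal.add_le_add_iff_right (ENNReal.mul_ne_top ENNReal.ofReal_ne_top ENNReal.ofReal_ne_top)).1 h4

lemma Ap_ne : S.A p ≠ ⊤ := by
  have hp := S.hp
  have hc : 0 ≤ S.s + S.M := add_nonneg S.s_pos.le S.M0
  have h : ∀ x, ENNReal.ofReal (S.T x ^ p) ≤ ENNReal.ofReal (2^p) * ENNReal.ofReal (S.Z x ^ p) +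
      ENNReal.ofReal (2^p * (S.s + S.M)^p) := by
    intro x
    have hZ := S.Z0 x
    rw [← ENNReal.ofReal_mul (by positivity), ← ENNReal.ofReal_add (by positivity) (by positivity)]
    apply ENNReal.ofReal_le_ofReal
    rw [← mul_add]
    refine le_trans ?_ (pow_add_le _ _ p hZ hc (by linarith))
    have := S.T0 x
    gcongr
    unfold T G
    have := S.s_pos; have := S.M0
    rw [abs_le]
    rcases le_total (S.Z x) S.s with h | h
    · rw [max_eq_right h]; constructor <;> linarith
    · rw [max_eq_left h]; constructor <;> linarith
  refine ne_top_of_le_ne_top ?_ (lintegral_mono h)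
  rw [lintegral_add_right _ measurable_const, lintegral_const_mul' _ _ ENNReal.ofReal_ne_top]
  simp only [lintegral_const, measure_univ, mul_one]
  exact ENNReal.add_ne_top.2 ⟨ENNReal.mul_ne_top ENNReal.ofReal_ne_top S.zp, ENNReal.ofReal_ne_top⟩

lemma T_diff (i x) : |S.T x - S.T (Function.update x i S.z)| ≤ |S.G x - S.G (Function.update x i S.z)| := by
  unfold T
  refine (abs_abs_sub_abs_le_abs_sub _ _).trans (le_of_eq ?_)
  congr 1; ring

lemma Tq (i x) : ENNReal.ofReal (S.T (Function.update x i S.z) ^ (p-2)) ≤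
    ENNReal.ofReal (2^(p-2)) * (ENNReal.ofReal (S.T x ^ (p-2)) +
      ENNReal.ofReal (S.w i) * ENNReal.ofReal (S.N (x i) ^ (p-2))) := by
  have hp := S.hp
  have hN := S.N0 (x i)
  have hw := S.w0 i
  have hT := S.T0 x
  have hT' := S.T0 (Function.update x i S.z)
  have hv := S.v0 i x
  rw [← ENNReal.ofReal_mul hw, ← ENNReal.ofReal_add (by positivity) (by positivity), ← ENNReal.ofReal_mul (by positivity)]
  apply ENNReal.ofReal_le_ofReal
  have h := (S.T_diff i x).trans (S.G_diff i x)
  have h' : S.T (Function.update x i S.z) ≤ S.T x + S.v i x := by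
    have := (abs_le.1 h).1; linarith
  calc _ ≤ (S.T x + S.v i x)^(p-2) := by gcongr; linarith
    _ ≤ _ := pow_add_le _ _ _ hT hv (by linarith)
    _ ≤ _ := by
      gcongr
      exact v_pow _ _ _ _ hv hw (S.w1 i) hN (S.h5 i x) (by linarith)

lemma wN (q : ℝ) (h : ∫⁻ y, ENNReal.ofReal (S.N y ^ q) ∂ν ≤ ENNReal.ofReal t) (i : Fin n) :
    ∫⁻ x, ENNReal.ofReal (S.w i) * ENNReal.ofReal (S.N (x i) ^ q) ∂(Measure.pi fun _ : Fin n => ν) ≤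
      ENNReal.ofReal (S.w i) * ENNReal.ofReal t := by
  rw [lintegral_const_mul' _ _ ENNReal.ofReal_ne_top]
  rw [S.int_coord i (fun y => ENNReal.ofReal (S.N y ^ q)) (S.mN.pow_const q).ennreal_ofReal]
  gcongr

lemma wsum : ∑ i, ENNReal.ofReal (S.w i) * ENNReal.ofReal t ≤ ENNReal.ofReal (k * t) := by
  rw [← Finset.sum_mul, ENNReal.ofReal_mul (by linarith [S.hk]),
    ← ENNReal.ofReal_sum_of_nonneg fun i _ => S.w0 i]
  gcongr
  exact S.wk

lemma wt_le (i) : ENNReal.ofReal (S.w i) * ENNReal.ofReal t ≤ ENNReal.ofReal (k * t) :=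
  (Finset.single_le_sum (f := fun i => ENNReal.ofReal (S.w i) * ENNReal.ofReal t)
    (fun _ _ => zero_le) (Finset.mem_univ i)).trans S.wsum

lemma mNq (q : ℝ) (i : Fin n) : Measurable fun x : Fin n → X => ENNReal.ofReal (S.w i) * ENNReal.ofReal (S.N (x i) ^ q) :=
  Measurable.const_mul (((S.mN.pow_const q).ennreal_ofReal).comp (measurable_pi_apply i)) _

lemma Jb (i) : ∫⁻ x, ENNReal.ofReal (S.T (Function.update x i S.z) ^ (p-2)) ∂(Measure.pi fun _ => ν) ≤
    ENNReal.ofReal (2^(p-2)) * (S.A (p-2) + ENNReal.ofReal (k * t)) := by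
  refine (lintegral_mono (S.Tq i)).trans ?_
  rw [lintegral_const_mul' _ _ ENNReal.ofReal_ne_top, lintegral_add_left (S.mTq _)]
  gcongr
  · exact le_rfl
  · exact (S.wN _ S.nq i).trans (S.wt_le i)

lemma Ib : ∑ i, ∫⁻ x, ENNReal.ofReal ((S.a i x / S.G x)^2) * ENNReal.ofReal (S.T (Function.update x i S.z) ^ (p-2))
     ∂(Measure.pi fun _ => ν) ≤
    ENNReal.ofReal (2^(p-2)) * (S.A (p-2) + ENNReal.ofReal (k * t)) := by
  have h : ∀ i x, ENNReal.ofReal ((S.a i x / S.G x)^2) * ENNReal.ofReal (S.T (Function.update x i S.z) ^ (p-2)) ≤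
      ENNReal.ofReal (2^(p-2)) * (ENNReal.ofReal ((S.a i x / S.G x)^2) * ENNReal.ofReal (S.T x ^ (p-2)) +
      ENNReal.ofReal (S.w i) * ENNReal.ofReal (S.N (x i) ^ (p-2))) := by
    intro i x
    have h1 : ENNReal.ofReal ((S.a i x / S.G x)^2) ≤ 1 :=
      (Finset.single_le_sum (f := fun i => ENNReal.ofReal ((S.a i x / S.G x)^2))
        (fun _ _ => zero_le) (Finset.mem_univ i)).trans (S.sum_ag x)
    refine (mul_le_mul_right (S.Tq i x) _).trans ?_
    rw [mul_left_comm, mul_add (ENNReal.ofReal ((S.a i x / S.G x)^2))]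
    refine mul_le_mul_right (add_le_add le_rfl ?_) _
    exact mul_le_of_le_one_left' h1
  refine (Finset.sum_le_sum fun i _ => lintegral_mono (h i)).trans ?_
  have mm : ∀ i, Measurable fun x => ENNReal.ofReal ((S.a i x / S.G x)^2) * ENNReal.ofReal (S.T x ^ (p-2)) :=
    fun i => (S.mag i).mul (S.mTq _)
  have e : ∀ i, ∫⁻ x, ENNReal.ofReal (2^(p-2)) * (ENNReal.ofReal ((S.a i x / S.G x)^2) * ENNReal.ofReal (S.T x ^ (p-2)) +
      ENNReal.ofReal (S.w i) * ENNReal.ofReal (S.N (x i) ^ (p-2))) ∂(Measure.pi fun _ => ν) =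
      ENNReal.ofReal (2^(p-2)) * (∫⁻ x, ENNReal.ofReal ((S.a i x / S.G x)^2) * ENNReal.ofReal (S.T x ^ (p-2))
        ∂(Measure.pi fun _ => ν) +
      ∫⁻ x, ENNReal.ofReal (S.w i) * ENNReal.ofReal (S.N (x i) ^ (p-2)) ∂(Measure.pi fun _ : Fin n => ν)) := by
    intro i
    rw [lintegral_const_mul' _ _ ENNReal.ofReal_ne_top, lintegral_add_left (mm i)]
  simp only [e]
  rw [← Finset.mul_sum, Finset.sum_add_distrib, ← lintegral_finsetSum _ fun i _ => mm i]
  gcongr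
  · refine lintegral_mono fun x => ?_
    rw [← Finset.sum_mul]
    exact mul_le_of_le_one_left' (S.sum_ag x)
  · exact (Finset.sum_le_sum fun i _ => S.wN _ S.nq i).trans S.wsum

noncomputable def Kc (p : ℝ) : ℝ := (p/2)^2 * 2^(p-2)

lemma rec1 : S.A p ≤ S.A (p/2)^2 + ENNReal.ofReal (Kc p) *
    (ENNReal.ofReal S.D2 * (ENNReal.ofReal (2^(p-2)) * (S.A (p-2) + ENNReal.ofReal (k * t))) + ENNReal.ofReal (k * t)) := by
  have hp := S.hp
  have hσ := S.hσ
  have ht := S.ht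
  have hK : 0 ≤ Kc p := by unfold Kc; positivity
  have es := efron_stein ν S.z n _ (S.mTq (p/2))
  have e1 : ∀ x, ENNReal.ofReal (S.T x ^ (p/2))^2 = ENNReal.ofReal (S.T x ^ p) := by
    intro x
    have := S.T0 x
    rw [← ENNReal.ofReal_pow (by positivity), ← Real.rpow_natCast, ← Real.rpow_mul this]
    congr 2; push_cast; ring
  simp only [e1] at es
  refine es.trans (add_le_add le_rfl ?_)
  have b : ∀ i x, sd (ENNReal.ofReal (S.T x ^ (p/2))) (ENNReal.ofReal (S.T (Function.update x i S.z) ^ (p/2)))^2 ≤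
      ENNReal.ofReal (Kc p) * (ENNReal.ofReal ((S.G x - S.G (Function.update x i S.z))^2) *
        ENNReal.ofReal (S.T (Function.update x i S.z) ^ (p-2)) +
         ENNReal.ofReal (S.w i) * ENNReal.ofReal (S.N (x i) ^ p)) := by
    intro i x
    have hN := S.N0 (x i)
    have hw := S.w0 i
    have hT := S.T0 x
    have hT' := S.T0 (Function.update x i S.z)
    have hv := S.v0 i x
    rw [sd_ofReal _ _ (by positivity) (by positivity), ← ENNReal.ofReal_pow (by positivity),
      ← ENNReal.ofReal_mul hw, ← ENNReal.ofReal_mul (by positivity),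
      ← ENNReal.ofReal_add (by positivity) (by positivity), ← ENNReal.ofReal_mul hK]
    apply ENNReal.ofReal_le_ofReal
    refine (rpow_diff3 _ _ _ _ p hT hT' (S.T_diff i x) (S.G_diff i x) (by linarith)).trans ?_
    rw [sq_abs]
    unfold Kc
    gcongr
    exact v_pow _ _ _ _ hv hw (S.w1 i) hN (S.h5 i x) (by linarith)
  refine (Finset.sum_le_sum fun i _ => lintegral_mono (b i)).trans ?_
  simp only [lintegral_const_mul' _ _ (ENNReal.ofReal_ne_top (r := Kc p))]
  rw [← Finset.mul_sum]
  gcongr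
  have e2 : ∀ i, ∫⁻ x, (ENNReal.ofReal ((S.G x - S.G (Function.update x i S.z))^2) *
        ENNReal.ofReal (S.T (Function.update x i S.z) ^ (p-2)) +
         ENNReal.ofReal (S.w i) * ENNReal.ofReal (S.N (x i) ^ p)) ∂(Measure.pi fun _ => ν) =
      ∫⁻ x, ENNReal.ofReal ((S.G x - S.G (Function.update x i S.z))^2) *
        ENNReal.ofReal (S.T (Function.update x i S.z) ^ (p-2)) ∂(Measure.pi fun _ => ν) +
       ∫⁻ x, ENNReal.ofReal (S.w i) * ENNReal.ofReal (S.N (x i) ^ p) ∂(Measure.pi fun _ : Fin n => ν) := by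
    intro i
    rw [lintegral_add_right _ (S.mNq p i)]
  simp only [e2]
  rw [Finset.sum_add_distrib]
  refine add_le_add ?_ ((Finset.sum_le_sum fun i _ => S.wN _ S.np i).trans S.wsum)
  refine (Finset.sum_le_sum fun i _ => S.weights i (fun x => ENNReal.ofReal (S.T x ^ (p-2))) (S.mTq _)).trans ?_
  rw [Finset.sum_add_distrib, ← Finset.mul_sum]
  have e : S.D2 = 16 * σ + (64 * σ + 2 * t / σ) := by unfold D2; ring
  rw [e, ENNReal.ofReal_add (by positivity) (by positivity), add_mul]
  refine add_le_add ?_ ?_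
  · gcongr; exact S.Ib
  · refine (Finset.sum_le_sum fun i _ => mul_le_mul_right (S.Jb i) _).trans ?_
    rw [← Finset.sum_mul]
    gcongr
    exact S.sum_w _ (by positivity)

lemma half : S.A (p/2)^2 ≤ ENNReal.ofReal S.D2 * S.A (p-2) := by
  have hp := S.hp
  have e : S.A (p/2) = ∫⁻ x, ENNReal.ofReal (S.T x) * ENNReal.ofReal (S.T x ^ (p/2-1)) ∂(Measure.pi fun _ => ν) := by
    unfold A
    congr 1; ext x
    have := S.T0 x
    rw [← ENNReal.ofReal_mul this, ← Real.rpow_one_add' this (by linarith)]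
    congr 2; ring
  rw [e]
  refine (lint_cs2 _ _ _ S.mT.ennreal_ofReal (S.mTq _)).trans ?_
  gcongr
  · refine le_trans (le_of_eq ?_) S.A2
    congr 1; ext x
    rw [ENNReal.ofReal_pow (S.T0 x)]
  · refine le_of_eq ?_
    unfold A
    congr 1; ext x
    have := S.T0 x
    rw [← ENNReal.ofReal_pow (by positivity), ← Real.rpow_natCast, ← Real.rpow_mul this]
    congr 2; push_cast; ring

lemma youngA (η : ℝ) (hη : 0 < η) : S.A (p-2) ≤ ENNReal.ofReal η * S.A p + ENNReal.ofReal ((η⁻¹)^((p-2)/2)) := by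
  have hp := S.hp
  have h : ∀ x, ENNReal.ofReal (S.T x ^ (p-2)) ≤ ENNReal.ofReal η * ENNReal.ofReal (S.T x ^ p) +
      ENNReal.ofReal ((η⁻¹)^((p-2)/2)) := by
    intro x
    have := S.T0 x
    rw [← ENNReal.ofReal_mul hη.le, ← ENNReal.ofReal_add (by positivity) (by positivity)]
    exact ENNReal.ofReal_le_ofReal (young_q _ _ _ this hη (by linarith))
  refine (lintegral_mono h).trans ?_
  rw [lintegral_add_right _ measurable_const, lintegral_const_mul' _ _ ENNReal.ofReal_ne_top]
  simp [A]

end Su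

/-- constants -/
noncomputable def cD (σ t : ℝ) : ℝ := 80 * σ + 2 * t / σ
noncomputable def cB (p σ t : ℝ) : ℝ := cD σ t + Su.Kc p * cD σ t * 2^(p-2)
noncomputable def cA (p σ t : ℝ) : ℝ :=
  2 * (cB p σ t * ((((2 * cB p σ t)⁻¹)⁻¹)^((p-2)/2)) + Su.Kc p * (cD σ t * 2^(p-2) + 1) * t)
noncomputable def cF (δ p σ t : ℝ) : ℝ :=
  (√(1+δ) / (√(1+δ)-1))^2 / (√(1+δ)-1)^(p-2) * σ^(-((p-2)/2)) * cA p σ t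

namespace Su
variable {X : Type*} [MeasurableSpace X] {ν : Measure X} [IsProbabilityMeasure ν] {n : ℕ} {p σ t k : ℝ}
  (S : Su ν n p σ t k)

lemma A_bound : S.A p ≤ ENNReal.ofReal (cA p σ t * k) := by
  have hp := S.hp
  have hσ := S.hσ
  have ht := S.ht
  have hk := S.hk
  have hD : 0 < S.D2 := S.D2_pos
  have hDe : S.D2 = cD σ t := rfl
  have hK : 0 < Kc p := by unfold Kc; positivity
  have hB : 0 < cB p σ t := by unfold cB; rw [← hDe]; positivity
  set η := (2 * cB p σ t)⁻¹ with hη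
  have hη0 : 0 < η := by positivity
  set α := (S.A p).toReal with hα
  have hα0 : 0 ≤ α := ENNReal.toReal_nonneg
  have hA : S.A p = ENNReal.ofReal α := (ENNReal.ofReal_toReal S.Ap_ne).symm
  set y := (η⁻¹)^((p-2)/2) with hy
  have hy0 : 0 ≤ y := by positivity
  have hq : S.A (p-2) ≤ ENNReal.ofReal (η * α + y) := by
    refine (S.youngA η hη0).trans (le_of_eq ?_)
    rw [hA, ← ENNReal.ofReal_mul hη0.le, ← ENNReal.ofReal_add (by positivity) hy0]
  have main : ENNReal.ofReal α ≤ ENNReal.ofReal (S.D2 * (η * α + y) + Kc p * (S.D2 * (2^(p-2) * ((η * α + y) + k * t)) + k * t)) := by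
    rw [← hA]
    refine S.rec1.trans ?_
    rw [ENNReal.ofReal_add (by positivity) (by positivity), ENNReal.ofReal_mul hD.le,
      ENNReal.ofReal_mul hK.le, ENNReal.ofReal_add (p := S.D2 * (2^(p-2) * ((η * α + y) + k * t))) (by positivity) (by positivity),
      ENNReal.ofReal_mul (p := S.D2) (q := (2^(p-2) * ((η * α + y) + k * t))) hD.le, ENNReal.ofReal_mul (p := 2^(p-2)) (by positivity),
      ENNReal.ofReal_add (p := η * α + y) (by positivity) (by positivity)]
    refine add_le_add (S.half.trans ?_) ?_
    · gcongr
    · gcongr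
  rw [ENNReal.ofReal_le_ofReal_iff (by positivity)] at main
  rw [hA]
  apply ENNReal.ofReal_le_ofReal
  have e1 : cB p σ t * η = 1/2 := by rw [hη]; field_simp
  have e2 : S.D2 * (η * α + y) + Kc p * (S.D2 * (2^(p-2) * ((η * α + y) + k * t)) + k * t) =
     (cB p σ t * η) * α + cB p σ t * y + Kc p * (cD σ t * 2^(p-2) + 1) * t * k := by
    rw [hDe]; unfold cB; ring
  rw [e2, e1] at main
  have e3 : cA p σ t = 2 * (cB p σ t * y + Kc p * (cD σ t * 2^(p-2) + 1) * t) := rfl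
  rw [e3]
  have : cB p σ t * y ≤ cB p σ t * y * k := le_mul_of_one_le_right (by positivity) hk
  linarith

lemma final (δ : ℝ) (hδ : 0 < δ) : ∫⁻ x, ENNReal.ofReal (max (S.Z x ^ 2 - 2 * (1+δ) * σ * k) 0) ∂(Measure.pi fun _ => ν) ≤
    ENNReal.ofReal (cF δ p σ t * k ^ (-(p/2-2))) := by
  have hp := S.hp
  have hσ := S.hσ
  have ht := S.ht
  have hk := S.hk
  have hk0 : 0 < k := by linarith
  have hs := S.s_pos
  set y := √(1+δ) with hy
  have hy2 : y^2 = 1 + δ := Real.sq_sqrt (by linarith)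
  have hy1 : 1 < y := by rw [hy, Real.lt_sqrt (by norm_num)]; linarith
  have hy0 : 0 < y - 1 := by linarith
  set β := (y / (y-1))^2 / ((y-1) * S.s)^(p-2) with hβ
  have hβ0 : 0 ≤ β := by positivity
  have h : ∀ x, ENNReal.ofReal (max (S.Z x ^ 2 - 2 * (1+δ) * σ * k) 0) ≤ ENNReal.ofReal β * ENNReal.ofReal (S.T x ^ p) := by
    intro x
    rw [← ENNReal.ofReal_mul hβ0]
    apply ENNReal.ofReal_le_ofReal
    have := tail_point (S.Z x) S.M S.s y p (by linarith) hs hy1 S.M_le (S.Z0 x)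
    rw [hy2, S.s_sq] at this
    refine le_trans (le_of_eq ?_) this
    congr 2; ring
  refine (lintegral_mono h).trans ?_
  rw [lintegral_const_mul' _ _ ENNReal.ofReal_ne_top]
  refine (mul_le_mul_right S.A_bound _).trans ?_
  rw [← ENNReal.ofReal_mul hβ0]
  apply ENNReal.ofReal_le_ofReal
  apply le_of_eq
  have e1 : ((y-1) * S.s)^(p-2) = (y-1)^(p-2) * (σ^((p-2)/2) * k^((p-2)/2)) := by
    rw [Real.mul_rpow hy0.le hs.le]
    congr 1
    rw [← Real.mul_rpow hσ.le hk0.le, ← S.s_sq, ← Real.rpow_natCast, ← Real.rpow_mul hs.le]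
    congr 1; push_cast; ring
  have e2 : k ^ (-(p/2-2)) = (k^((p-2)/2))⁻¹ * k := by
    rw [← Real.rpow_neg hk0.le, ← Real.rpow_add_one hk0.ne']
    congr 1; ring
  rw [hβ, e1, e2]
  unfold cF
  rw [← hy, Real.rpow_neg hσ.le]
  field_simp

end Su

section geom
variable {H : Type u} [NormedAddCommGroup H] [InnerProductSpace ℝ H] {n : ℕ}
  (L : Submodule ℝ (PiLp 2 fun _ : Fin n => H)) [FiniteDimensional ℝ L]

lemma inner_single (y : PiLp 2 fun _ : Fin n => H) (i : Fin n) (h : H) :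
    ⟪y, WithLp.toLp 2 (Pi.single i h)⟫ = ⟪y i, h⟫ := by
  rw [PiLp.inner_apply, Finset.sum_eq_single i]
  · simp
  · intro j _ hj; simp [hj]
  · simp

lemma norm_single' (i : Fin n) (h : H) :
    ‖(WithLp.toLp 2 (Pi.single i h) : PiLp 2 fun _ : Fin n => H)‖ = ‖h‖ := by
  exact PiLp.norm_toLp_single 2 (fun _ : Fin n => H) i h

noncomputable def bb (i : Fin n) : ℝ :=
  ∑ l, ‖((stdOrthonormalBasis ℝ L l : L) : PiLp 2 fun _ : Fin n => H) i‖ ^ 2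

lemma bb_sum : ∑ i, bb L i = Module.finrank ℝ L := by
  unfold bb
  rw [Finset.sum_comm]
  have : ∀ l, ∑ i, ‖((stdOrthonormalBasis ℝ L l : L) : PiLp 2 fun _ : Fin n => H) i‖ ^ 2 = 1 := by
    intro l
    rw [← PiLp.norm_sq_eq_of_L2]
    have := (stdOrthonormalBasis ℝ L).orthonormal.1 l
    rw [Submodule.coe_norm] at this
    rw [this]; simp
  simp [this]

lemma norm_proj_sq (y : PiLp 2 fun _ : Fin n => H) :
    ‖L.starProjection y‖^2 = ∑ l, ⟪((stdOrthonormalBasis ℝ L l : L) : PiLp 2 fun _ : Fin n => H), y⟫^2 := by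
  rw [Submodule.starProjection_apply, ← Submodule.coe_norm, ← (stdOrthonormalBasis ℝ L).sum_sq_norm_inner_right]
  refine Finset.sum_congr rfl fun l _ => ?_
  rw [Submodule.coe_inner, ← Submodule.starProjection_apply, ← Submodule.inner_starProjection_left_eq_right,
    Submodule.starProjection_eq_self_iff.2 (Submodule.coe_mem _)]
  simp

lemma proj_single (i : Fin n) (h : H) :
    ‖L.starProjection (WithLp.toLp 2 (Pi.single i h))‖^2 ≤ min (bb L i) 1 * ‖h‖^2 := by
  rcases min_choice (bb L i) 1 with e | e
  · rw [e, norm_proj_sq]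
    unfold bb
    rw [Finset.sum_mul]
    refine Finset.sum_le_sum fun l _ => ?_
    rw [inner_single, ← mul_pow, ← sq_abs]
    gcongr
    exact abs_real_inner_le_norm _ _
  · rw [e, one_mul]
    gcongr
    refine (L.norm_starProjection_apply_le _).trans ?_
    rw [norm_single']

lemma upd_eq (x : Fin n → H) (i : Fin n) :
    L.starProjection (WithLp.toLp 2 x) = L.starProjection (WithLp.toLp 2 (Function.update x i 0)) +
      L.starProjection (WithLp.toLp 2 (Pi.single i (x i))) := by
  rw [← map_add, ← WithLp.toLp_add]
  congr 2
  ext j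
  rcases eq_or_ne j i with rfl | h
  · simp
  · simp [h]

end geom

section mom
variable {H : Type u} [NormedAddCommGroup H] [InnerProductSpace ℝ H] [CompleteSpace H]
        [SecondCountableTopology H] [MeasurableSpace H] [BorelSpace H] 
        (ν : Measure H) [IsProbabilityMeasure ν] {p : ℝ}

lemma mom_le (hi : Integrable (fun y => ‖y‖^p) ν) (q : ℝ) (hq : 0 ≤ q) (hqp : q ≤ p) :
    ∫⁻ y, ENNReal.ofReal (‖y‖^q) ∂ν ≤ ENNReal.ofReal (1 + ∫ y, ‖y‖^p ∂ν) := by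
  have h : ∀ y : H, ‖y‖^q ≤ 1 + ‖y‖^p := by
    intro y
    have h0 := norm_nonneg y
    rcases le_total ‖y‖ 1 with h | h
    · have := Real.rpow_le_one h0 h hq
      have : 0 ≤ ‖y‖^p := by positivity
      linarith
    · have := Real.rpow_le_rpow_of_exponent_le h hqp
      linarith
  refine (lintegral_mono fun y => ENNReal.ofReal_le_ofReal (h y)).trans (le_of_eq ?_)
  rw [← ofReal_integral_eq_lintegral_ofReal]
  · rw [integral_add (by simp) hi]; simp
  · exact Integrable.add (by simp) hi
  · exact ae_of_all _ fun y => by positivity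

lemma memLp_id' (hp : 6 < p) (hi : Integrable (fun y => ‖y‖^p) ν) : MemLp (fun y : H => y) (ENNReal.ofReal p) ν := by
  rw [← integrable_norm_rpow_iff (by fun_prop) (by simp; linarith) (by simp)]
  rw [ENNReal.toReal_ofReal (by linarith)]
  exact hi

lemma memLp_two (hp : 6 < p) (hi : Integrable (fun y => ‖y‖^p) ν) : MemLp (fun y : H => y) 2 ν := by
  refine (memLp_id' ν hp hi).mono_exponent ?_
  rw [show (2:ENNReal) = ENNReal.ofReal 2 by norm_num]
  exact ENNReal.ofReal_le_ofReal (by linarith)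

variable {n : ℕ} 

lemma inner_sq (hp : 6 < p) (hi : Integrable (fun y => ‖y‖^p) ν) (h0 : ∫ y, y ∂ν = 0)
    (e : PiLp 2 fun _ : Fin n => H) :
    ∫⁻ x, ENNReal.ofReal (⟪e, WithLp.toLp 2 x⟫^2) ∂(Measure.pi fun _ => ν) ≤
      ENNReal.ofReal (‖e‖^2 * ∫ y, ‖y‖^2 ∂ν) := by
  have m2 := memLp_two ν hp hi
  have mi : ∀ i, MemLp (fun y : H => ⟪e i, y⟫) 2 ν := fun i => m2.const_inner (e i)
  have hmean : ∀ i, ∫ y, ⟪e i, y⟫ ∂ν = 0 := by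
    intro i
    rw [integral_inner (m2.integrable (by norm_num)), h0, inner_zero_right]
  have hv := variance_sum_pi (μ := fun _ : Fin n => ν) (X := fun i y => ⟪e i, y⟫) mi
  have mpi : ∀ i, MemLp (fun x : Fin n → H => ⟪e i, x i⟫) 2 (Measure.pi fun _ => ν) := fun i =>
    (mi i).comp_measurePreserving (measurePreserving_eval (fun _ : Fin n => ν) i)
  have hsum : MemLp (fun x : Fin n → H => ∑ i, ⟪e i, x i⟫) 2 (Measure.pi fun _ => ν) :=
    memLp_finset_sum _ fun i _ => mpi i
  have hz : ∫ x : Fin n → H, ∑ i, ⟪e i, x i⟫ ∂(Measure.pi fun _ => ν) = 0 := by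
    rw [integral_finset_sum _ fun i _ => (mpi i).integrable (by norm_num)]
    refine Finset.sum_eq_zero fun i _ => ?_
    have := integral_comp_eval (μ := fun _ : Fin n => ν) (i := i) (f := fun y => ⟪e i, y⟫) (mi i).1
    rw [this, hmean i]
  have e1 : ∀ x : Fin n → H, ⟪e, WithLp.toLp 2 x⟫ = ∑ i, ⟪e i, x i⟫ := fun x => by
    rw [PiLp.inner_apply]
  simp only [e1]
  rw [← ofReal_integral_eq_lintegral_ofReal hsum.integrable_sq (ae_of_all _ fun x => by positivity)]
  apply ENNReal.ofReal_le_ofReal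
  have hv2 := variance_of_integral_eq_zero hsum.1.aemeasurable hz
  have hv' : Var[fun x : Fin n → H => ∑ i, ⟪e i, x i⟫; Measure.pi fun _ => ν] = ∑ i, Var[fun y => ⟪e i, y⟫; ν] := by
    rw [← hv]; congr 1; ext x; simp
  rw [← hv2, hv', PiLp.norm_sq_eq_of_L2, Finset.sum_mul]
  refine Finset.sum_le_sum fun i _ => ?_
  rw [variance_of_integral_eq_zero (mi i).1.aemeasurable (hmean i), ← integral_const_mul]
  refine integral_mono (mi i).integrable_sq (((m2.norm).integrable_sq).const_mul _) fun y => ?_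
  simp only
  rw [← mul_pow, ← sq_abs]
  gcongr
  exact abs_real_inner_le_norm _ _

variable (L : Submodule ℝ (PiLp 2 fun _ : Fin n => H)) [FiniteDimensional ℝ L]

lemma meas_proj : Continuous fun x : Fin n → H => L.starProjection (WithLp.toLp 2 x) :=
  L.starProjection.continuous.comp (PiLp.continuous_toLp 2 _)

noncomputable def mkSu (hp : 6 < p) (hi : Integrable (fun y => ‖y‖^p) ν) (h0 : ∫ y, y ∂ν = 0)
    (σ : ℝ) (hσ : 0 < σ) (hσ2 : σ = ∫ y, ‖y‖^2 ∂ν) (k : ℕ) (hk : 1 ≤ k) (hL : Module.finrank ℝ L ≤ k) :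
    Su ν n p σ (1 + ∫ y, ‖y‖^p ∂ν) k where
  z := 0
  N y := ‖y‖
  Z x := ‖L.starProjection (WithLp.toLp 2 x)‖
  a i x := ‖(L.starProjection (WithLp.toLp 2 x)) i‖
  v i x := ‖L.starProjection (WithLp.toLp 2 (Pi.single i (x i)))‖
  w i := min (bb L i) 1
  mN := by fun_prop
  mZ := (meas_proj L).norm.measurable
  ma i := ((PiLp.continuous_apply 2 _ i).comp (meas_proj L)).norm.measurable
  N0 x := norm_nonneg _
  Z0 x := norm_nonneg _
  a0 i x := norm_nonneg _
  v0 i x := norm_nonneg _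
  w0 i := le_min (by unfold bb; positivity) (by norm_num)
  w1 i := min_le_right _ _
  wk := by
    refine (Finset.sum_le_sum fun i _ => min_le_left (bb L i) 1).trans ?_
    rw [bb_sum]; exact_mod_cast hL
  hp := hp
  hσ := hσ
  ht := by
    have : 0 ≤ ∫ y, ‖y‖^p ∂ν := integral_nonneg fun y => by positivity
    linarith
  hk := by exact_mod_cast hk
  h1 i x := by
    refine (abs_norm_sub_norm_le _ _).trans (le_of_eq ?_)
    rw [upd_eq L x i, add_sub_cancel_left]
  h2 i x := by
    set y := L.starProjection (WithLp.toLp 2 (Function.update x i 0)) with hy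
    rw [upd_eq L x i, ← hy, norm_add_sq_real]
    have e : ⟪y, L.starProjection (WithLp.toLp 2 (Pi.single i (x i)))⟫ = ⟪y i, x i⟫ := by
      rw [← Submodule.inner_starProjection_left_eq_right, Submodule.starProjection_eq_self_iff.2 (Submodule.starProjection_apply_mem _ _), inner_single]
    rw [e]
    have := abs_real_inner_le_norm (y i) (x i)
    rw [abs_le] at this ⊢
    have h3 := sq_nonneg ‖L.starProjection (WithLp.toLp 2 (Pi.single i (x i)))‖
    constructor <;> nlinarith
  h3 i x := by
    have := congrArg (fun y : PiLp 2 fun _ : Fin n => H => y i) (upd_eq L x i)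
    simp only [PiLp.add_apply] at this
    rw [this]
    set A := L.starProjection (WithLp.toLp 2 (Function.update x i 0))
    set B := L.starProjection (WithLp.toLp 2 (Pi.single i (x i)))
    have h1 : ‖A i‖ ≤ ‖A i + B i‖ + ‖B i‖ := by
      have := norm_sub_le (A i + B i) (B i)
      simpa using this
    have h2 : ‖B i‖ ≤ ‖B‖ := PiLp.norm_apply_le B i
    linarith
  h4 x := by rw [PiLp.norm_sq_eq_of_L2]
  h5 i x := proj_single L i (x i)
  n2 := by
    rw [hσ2, ← ofReal_integral_eq_lintegral_ofReal ((memLp_two ν hp hi).norm.integrable_sq) (ae_of_all _ fun x => by positivity)]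
  n4 := by
    have := mom_le ν hi 4 (by norm_num) (by linarith)
    exact_mod_cast this
  nq := mom_le ν hi (p-2) (by linarith) (by linarith)
  np := mom_le ν hi p (by linarith) (by linarith)
  z2 := by
    simp only [norm_proj_sq]
    have : ∀ x : Fin n → H, ENNReal.ofReal (∑ l, ⟪((stdOrthonormalBasis ℝ L l : L) : PiLp 2 fun _ : Fin n => H), WithLp.toLp 2 x⟫^2)
      = ∑ l, ENNReal.ofReal (⟪((stdOrthonormalBasis ℝ L l : L) : PiLp 2 fun _ : Fin n => H), WithLp.toLp 2 x⟫^2) := fun x =>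
      ENNReal.ofReal_sum_of_nonneg fun l _ => sq_nonneg _
    simp only [this]
    rw [lintegral_finsetSum]
    · refine (Finset.sum_le_sum fun l _ => inner_sq ν hp hi h0 _).trans ?_
      rw [← hσ2, ← ENNReal.ofReal_sum_of_nonneg fun l _ => by positivity]
      apply ENNReal.ofReal_le_ofReal
      have h1 : ∀ l, ‖((stdOrthonormalBasis ℝ L l : L) : PiLp 2 fun _ : Fin n => H)‖ = 1 := fun l => by
        have := (stdOrthonormalBasis ℝ L).orthonormal.1 l
        rwa [Submodule.coe_norm] at this
      simp only [h1]
      have : (Module.finrank ℝ L : ℝ) ≤ k := by exact_mod_cast hL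
      simp
      nlinarith
    · intro l _
      have : Continuous fun x : Fin n → H => ⟪((stdOrthonormalBasis ℝ L l : L) : PiLp 2 fun _ : Fin n => H), WithLp.toLp 2 x⟫ :=
        continuous_const.inner (PiLp.continuous_toLp 2 _)
      exact (this.measurable.pow_const 2).ennreal_ofReal
  zp := by
    have mpi : ∀ i : Fin n, MemLp (fun x : Fin n → H => ‖x i‖) (ENNReal.ofReal p) (Measure.pi fun _ => ν) := fun i =>
      ((memLp_id' ν hp hi).norm).comp_measurePreserving (measurePreserving_eval (fun _ : Fin n => ν) i)
    have hsum : MemLp (fun x : Fin n → H => ∑ i, ‖x i‖) (ENNReal.ofReal p) (Measure.pi fun _ => ν) :=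
      memLp_finset_sum _ fun i _ => mpi i
    have hI := hsum.integrable_norm_rpow (by simp; linarith) (by simp)
    rw [ENNReal.toReal_ofReal (by linarith)] at hI
    refine ne_top_of_le_ne_top hI.lintegral_lt_top.ne (lintegral_mono fun x => ?_)
    apply ENNReal.ofReal_le_ofReal
    gcongr
    refine (L.norm_starProjection_apply_le _).trans ?_
    rw [Real.norm_of_nonneg (by positivity)]
    have e : (WithLp.toLp 2 x : PiLp 2 fun _ : Fin n => H) = ∑ i, WithLp.toLp 2 (Pi.single i (x i)) := by
      rw [← WithLp.toLp_sum, Finset.univ_sum_single]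
    rw [e]
    refine (norm_sum_le _ _).trans (le_of_eq ?_)
    simp only [norm_single']

end mom

lemma one_term {H : Type u} [NormedAddCommGroup H] [InnerProductSpace ℝ H] [CompleteSpace H]
    [SecondCountableTopology H] [MeasurableSpace H] [BorelSpace H]
    {Ω : Type v} [MeasurableSpace Ω] (μ : Measure Ω) [IsProbabilityMeasure μ]
    (ε : ℕ → Ω → H) (hm : ∀ i, Measurable (ε i)) (hind : iIndepFun ε μ)
    (hid : ∀ i, IdentDistrib (ε i) (ε 0) μ μ) (h0 : (∫ ω, ε 0 ω ∂μ) = 0)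
    {p δ σ τ : ℝ} (hδ : 0 < δ) (hp : 6 < p) (hσ : 0 < σ)
    (hi : Integrable (fun ω => ‖ε 0 ω‖ ^ p) μ) (hσ2 : σ = ∫ ω, ‖ε 0 ω‖ ^ 2 ∂μ)
    (hτ : τ = ∫ ω, ‖ε 0 ω‖ ^ p ∂μ) (n : ℕ) (hn : 1 ≤ n) (k : ℕ) (hk : 1 ≤ k)
    (L : Submodule ℝ (PiLp 2 fun _ : Fin n => H)) [FiniteDimensional ℝ L]
    (hL : Module.finrank ℝ L ≤ k) :
    ∫⁻ ω, ENNReal.ofReal (max ((n : ℝ)⁻¹ *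
        ‖L.starProjection (WithLp.toLp 2 fun i : Fin n => ε i ω)‖ ^ 2 -
        2 * (1 + δ) * σ * (k : ℕ) / n) 0) ∂μ ≤
      ENNReal.ofReal ((n : ℝ)⁻¹ * (cF δ p σ (1 + τ) * (k : ℝ) ^ (-(p/2-2)))) := by
  have hnpos : (0 : ℝ) < n := by exact_mod_cast hn
  set ν : Measure H := μ.map (ε 0) with hν
  haveI : IsProbabilityMeasure ν := Measure.isProbabilityMeasure_map (hm 0).aemeasurable
  have mp : Measurable (fun y : H => ‖y‖ ^ p) := measurable_norm.pow_const p
  have hi' : Integrable (fun y => ‖y‖ ^ p) ν :=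
    (integrable_map_measure mp.aestronglyMeasurable (hm 0).aemeasurable).2 hi
  have h0' : ∫ y, y ∂ν = 0 := by
    rw [hν, integral_map (hm 0).aemeasurable (by fun_prop)]; exact h0
  have hσ' : σ = ∫ y, ‖y‖ ^ 2 ∂ν := by
    rw [hν, integral_map (hm 0).aemeasurable (by fun_prop)]; exact hσ2
  have hτ' : τ = ∫ y, ‖y‖ ^ p ∂ν := by
    rw [hν, integral_map (hm 0).aemeasurable mp.aestronglyMeasurable]; exact hτ
  have hlaw : μ.map (fun ω => fun i : Fin n => ε i ω) = Measure.pi fun _ => ν := by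
    have h := hind.precomp (g := (fun i : Fin n => (i : ℕ))) Fin.val_injective
    have h2 := (iIndepFun_iff_map_fun_eq_pi_map (fun i : Fin n => (hm i).aemeasurable)).1 h
    refine h2.trans ?_
    congr 1
    funext i
    exact (hid i).map_eq
  have hme : Measurable (fun ω => fun i : Fin n => ε i ω) := measurable_pi_lambda _ fun i => hm i
  have hfin := (mkSu ν L hp hi' h0' σ hσ hσ' k hk hL).final δ hδ
  have hZ : ∀ x, (mkSu ν L hp hi' h0' σ hσ hσ' k hk hL).Z x = ‖L.starProjection (WithLp.toLp 2 x)‖ :=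
    fun _ => rfl
  simp only [hZ] at hfin
  rw [← hτ'] at hfin
  have hc : Continuous fun x : Fin n → H => ‖L.starProjection (WithLp.toLp 2 x)‖ :=
    (L.starProjection.continuous.comp (PiLp.continuous_toLp 2 _)).norm
  have hmF : Measurable fun x : Fin n → H =>
      ENNReal.ofReal (max (‖L.starProjection (WithLp.toLp 2 x)‖ ^ 2 - 2 * (1+δ) * σ * k) 0) :=
    (((hc.measurable.pow_const 2).sub_const _).max measurable_const).ennreal_ofReal
  rw [← hlaw, lintegral_map hmF hme] at hfin
  have hpt : ∀ ω, ENNReal.ofReal (max ((n : ℝ)⁻¹ *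
        ‖L.starProjection (WithLp.toLp 2 fun i : Fin n => ε i ω)‖ ^ 2 -
        2 * (1 + δ) * σ * (k : ℕ) / n) 0) = ENNReal.ofReal ((n : ℝ)⁻¹) *
        ENNReal.ofReal (max (‖L.starProjection (WithLp.toLp 2 fun i : Fin n => ε i ω)‖ ^ 2
          - 2 * (1+δ) * σ * k) 0) := fun ω => by
    rw [← ENNReal.ofReal_mul (by positivity), mul_max_of_nonneg _ _ (by positivity), mul_zero]
    congr 2
    field_simp
  simp only [hpt]
  rw [lintegral_const_mul' _ _ ENNReal.ofReal_ne_top, ENNReal.ofReal_mul (p := (n : ℝ)⁻¹) (by positivity)]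
  gcongr
/-- Talagrand-type bound: for i.i.d. centered noise with `p > 6` moments,
with `p(k) = 2(1+δ)σ²k/n`, for any family of subspaces `L_k ⊂ H^n` with `dim L_k ≤ k`,
`Σ_{m'=1}^{N} E[((1/n)‖Π_{L_{m∨m'}}(ε̄)‖² − p(m∨m'))₊] ≤ C/n`,
where the constant `C` depends only on `δ`, `p`, `σ²` and `τ_p`. -/
theorem talagrand_type_sum_bound :
    ∀ (δ : ℝ), 0 < δ → ∀ (p : ℝ), 6 < p → ∀ (σsq τp : ℝ), 0 < σsq →
    ∃ C : ℝ, 0 < C ∧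
      ∀ (H : Type u) [NormedAddCommGroup H] [InnerProductSpace ℝ H] [CompleteSpace H]
        [SecondCountableTopology H] [MeasurableSpace H] [BorelSpace H]
        (Ω : Type v) [MeasurableSpace Ω] (μ : Measure Ω) [IsProbabilityMeasure μ]
        (ε : ℕ → Ω → H),
        (∀ i, Measurable (ε i)) →
        iIndepFun ε μ →
        (∀ i, IdentDistrib (ε i) (ε 0) μ μ) →
        (∫ ω, ε 0 ω ∂μ) = 0 →
        Integrable (fun ω => ‖ε 0 ω‖ ^ p) μ →
        σsq = ∫ ω, ‖ε 0 ω‖ ^ 2 ∂μ →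
        τp = ∫ ω, ‖ε 0 ω‖ ^ p ∂μ →
      ∀ (n : ℕ), 1 ≤ n → ∀ (m : ℕ), 1 ≤ m → ∀ (N : ℕ), 1 ≤ N →
      ∀ (L : ℕ → Submodule ℝ (PiLp 2 fun _ : Fin n => H))
        [∀ k, FiniteDimensional ℝ (L k)],
        (∀ k, 1 ≤ k → k ≤ max N m → Module.finrank ℝ (L k) ≤ k) →
        ∑ m' ∈ Finset.Icc 1 N,
            ∫⁻ ω, ENNReal.ofReal
              (max ((n : ℝ)⁻¹ *
                  ‖(Submodule.orthogonalProjection (L (max m m'))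
                      ((WithLp.equiv 2 (∀ _ : Fin n, H)).symm fun i : Fin n => ε i ω) :
                    PiLp 2 fun _ : Fin n => H)‖ ^ 2 -
                2 * (1 + δ) * σsq * (max m m' : ℕ) / n) 0) ∂μ ≤
          ENNReal.ofReal (C / n) := by
  intro δ hδ p hp σ τ hσ
  have hsm : Summable fun j : ℕ => (j : ℝ) ^ (-(p/2-2)) :=
    Real.summable_nat_rpow.2 (by linarith)
  have htn : 0 ≤ ∑' j : ℕ, (j : ℝ) ^ (-(p/2-2)) := tsum_nonneg fun j => by positivity
  refine ⟨|cF δ p σ (1 + τ)| * (∑' j : ℕ, (j : ℝ) ^ (-(p/2-2))) + 1, by positivity, ?_⟩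
  intro H _ _ _ _ _ _ Ω _ μ _ ε hm hind hid h0 hi hσ2 hτ n hn m hm1 N hN L _ hL
  have hnpos : (0 : ℝ) < n := by exact_mod_cast hn
  have key : ∀ m' ∈ Finset.Icc 1 N, ∫⁻ ω, ENNReal.ofReal
              (max ((n : ℝ)⁻¹ *
                  ‖(Submodule.orthogonalProjection (L (max m m'))
                      ((WithLp.equiv 2 (∀ _ : Fin n, H)).symm fun i : Fin n => ε i ω) :
                    PiLp 2 fun _ : Fin n => H)‖ ^ 2 -
                2 * (1 + δ) * σ * (max m m' : ℕ) / n) 0) ∂μ ≤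
      ENNReal.ofReal ((n : ℝ)⁻¹ * (|cF δ p σ (1 + τ)| * (m' : ℝ) ^ (-(p/2-2)))) := by
    intro m' hm'
    rw [Finset.mem_Icc] at hm'
    refine (one_term μ ε hm hind hid h0 hδ hp hσ hi hσ2 hτ n hn (max m m')
      (by omega) (L (max m m')) (hL _ (by omega) (by omega))).trans ?_
    apply ENNReal.ofReal_le_ofReal
    have hpos : (0 : ℝ) < m' := by exact_mod_cast hm'.1
    have hle : (m' : ℝ) ≤ ((max m m' : ℕ) : ℝ) := by exact_mod_cast le_max_right m m'
    have hr := Real.rpow_le_rpow_of_nonpos hpos hle (z := -(p/2-2)) (by linarith)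
    have h1 := le_abs_self (cF δ p σ (1 + τ))
    gcongr
  refine (Finset.sum_le_sum key).trans ?_
  rw [← ENNReal.ofReal_sum_of_nonneg fun j _ => by positivity]
  apply ENNReal.ofReal_le_ofReal
  rw [← Finset.mul_sum, ← Finset.mul_sum, div_eq_inv_mul _ (n : ℝ)]
  have := hsm.sum_le_tsum (Finset.Icc 1 N) fun j _ => by positivity
  have h2 : |cF δ p σ (1 + τ)| * ∑ j ∈ Finset.Icc 1 N, (j : ℝ) ^ (-(p/2-2)) ≤
      |cF δ p σ (1 + τ)| * (∑' j : ℕ, (j : ℝ) ^ (-(p/2-2))) + 1 := by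
    have := mul_le_mul_of_nonneg_left this (abs_nonneg (cF δ p σ (1 + τ)))
    linarith
  gcongr
end
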